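/- Assume [H1] and [H2], and let ψ : [0,T_max) → W^{σ,p}(𝕋ⁿ) be the maximal mild solution of the nonlocal Fokker–Planck equation. Then: (i) Δψ ∈ C^{ν−ε}_loc((0,T_max), L^p(𝕋ⁿ)) and dψ/dt ∈ C^{ν−ε}_loc((0,T_max), L^p(𝕋ⁿ)) for every ε ∈ (0,ν), where ν := min(1 − σ/2, σ/2 − 1/2 − n/(2p)); and (ii) if in addition ψ₀ ∈ W^{2,p}(𝕋ⁿ), then Δψ and dψ/dt are continuous on [0,T_max) with values in L^p(𝕋ⁿ). -/

import Mathlib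

open MeasureTheory ENNReal Set Filter

noncomputable section

/-- Ambient space `ℝ × ℝ^m`: the universal cover of the torus `𝕋^{m+1}` (so `n = m + 1`). -/
abbrev Spc (m : ℕ) : Type := ℝ × (Fin m → ℝ)

/-- Unit cube in the last `m` coordinates: a fundamental domain for `𝕋^m`. -/
def cube1 (m : ℕ) : Set (Fin m → ℝ) := Set.pi Set.univ fun _ => Set.Ico (0 : ℝ) 1

/-- A fundamental domain for the torus `𝕋^{m+1}`. -/
def cube (m : ℕ) : Set (Spc m) := Set.Ico (0 : ℝ) 1 ×ˢ cube1 m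

/-- The measure of the torus: Lebesgue measure restricted to a fundamental domain. -/
def μT (m : ℕ) : Measure (Spc m) := volume.restrict (cube m)

/-- `ℤ^{m+1}`-periodicity: `f` is a function on the torus `𝕋^{m+1}`. -/
def IsPeriodic {m : ℕ} (f : Spc m → ℝ) : Prop :=
  ∀ (x : Spc m) (k : ℤ) (j : Fin m → ℤ), f (x.1 + k, fun i => x.2 i + j i) = f x

/-- The first coordinate direction. -/
def e1 (m : ℕ) : Spc m := (1, 0)

/-- The remaining coordinate directions. -/
def eC (m : ℕ) (i : Fin m) : Spc m := (0, Pi.single i 1)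

/-- Partial derivative in the direction `v`. -/
def pd {m : ℕ} (v : Spc m) (f : Spc m → ℝ) (x : Spc m) : ℝ := fderiv ℝ f x v

/-- `∇f ⋅ ∇g`. -/
def gradDot {m : ℕ} (f g : Spc m → ℝ) (x : Spc m) : ℝ :=
  pd (e1 m) f x * pd (e1 m) g x + ∑ i, pd (eC m i) f x * pd (eC m i) g x

/-- The Laplacian. -/
def lap {m : ℕ} (f : Spc m → ℝ) (x : Spc m) : ℝ :=
  pd (e1 m) (pd (e1 m) f) x + ∑ i, pd (eC m i) (pd (eC m i) f) x

/-- The marginal `ψ̄(x₁) = ∫_{𝕋^m} ψ(x₁, ⋅)`. -/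
def marg {m : ℕ} (ψ : Spc m → ℝ) (x1 : ℝ) : ℝ := ∫ y in cube1 m, ψ (x1, y)

/-- The nonlocal coefficient `φ_ψ = (∫ ∂_{x₁}V ψ dx₂…dxₙ) / ψ̄`. -/
def phiF {m : ℕ} (V ψ : Spc m → ℝ) (x1 : ℝ) : ℝ :=
  (∫ y in cube1 m, pd (e1 m) V (x1, y) * ψ (x1, y)) / marg ψ x1

/-- `F(ψ) = ∇V⋅∇ψ + ΔV ψ − ∂_{x₁}(φ_ψ ψ)`. -/
def Fop {m : ℕ} (V ψ : Spc m → ℝ) (x : Spc m) : ℝ :=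
  gradDot V ψ x + lap V x * ψ x - pd (e1 m) (fun z => phiF V ψ z.1 * ψ z) x

/-- `L^p`-norm on the torus. -/
def LpN {m : ℕ} (p : ℝ) (f : Spc m → ℝ) : ℝ≥0∞ := eLpNorm f (ENNReal.ofReal p) (μT m)

/-- Gagliardo (Sobolev–Slobodeckij) seminorm of fractional order `s`. -/
def gagl {m : ℕ} {F : Type*} [NormedAddCommGroup F] (s p : ℝ) (f : Spc m → F) : ℝ≥0∞ :=
  (∫⁻ x in cube m, ∫⁻ y in cube m,
      ENNReal.ofReal (‖f x - f y‖ ^ p / ‖x - y‖ ^ ((m : ℝ) + 1 + s * p))) ^ (1 / p)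

/-- The differential of `f`. -/
def grd {m : ℕ} (f : Spc m → ℝ) (x : Spc m) : Spc m →L[ℝ] ℝ := fderiv ℝ f x

/-- The `W^{σ,p}`-norm on the torus, for `0 ≤ σ ≤ 2`. -/
def WNorm {m : ℕ} (σ p : ℝ) (f : Spc m → ℝ) : ℝ≥0∞ :=
  if σ ≤ 0 then LpN p f
  else if σ < 1 then LpN p f + gagl σ p f
  else if σ < 2 then
    LpN p f + eLpNorm (fun x => ‖grd f x‖) (ENNReal.ofReal p) (μT m)
      + (if σ = 1 then 0 else gagl (σ - 1) p (grd f))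
  else
    LpN p f + eLpNorm (fun x => ‖grd f x‖) (ENNReal.ofReal p) (μT m)
      + eLpNorm (fun x => ‖iteratedFDeriv ℝ 2 f x‖) (ENNReal.ofReal p) (μT m)

/-- Membership in `W^{σ,p}(𝕋^{m+1})`, for `0 ≤ σ ≤ 2`. -/
def MemW {m : ℕ} (σ p : ℝ) (f : Spc m → ℝ) : Prop :=
  IsPeriodic f ∧ Measurable f ∧ (1 ≤ σ → Differentiable ℝ f) ∧
    (2 ≤ σ → Differentiable ℝ (grd f)) ∧ WNorm σ p f < ⊤

/-- Membership in `𝒟^{σ,p}(𝕋^{m+1}) = {ψ ∈ W^{σ,p} | ψ̄ > 0}`. -/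
def MemD {m : ℕ} (σ p : ℝ) (f : Spc m → ℝ) : Prop :=
  MemW σ p f ∧ ∀ x1 : ℝ, 0 < marg f x1

/-- Hypothesis `[H₁]`: `ψ₀ ∈ 𝒟^{σ,p}`, `ψ₀ ≥ 0`, `∫ ψ₀ = 1`. -/
def Hyp1 {m : ℕ} (σ p : ℝ) (ψ0 : Spc m → ℝ) : Prop :=
  MemD σ p ψ0 ∧ (∀ x, 0 ≤ ψ0 x) ∧ (∫ x in cube m, ψ0 x) = 1

/-- Hypothesis `[H₂]`: `n = m + 1 ≥ 2`, `p > n`, `σ ∈ (1 + n/p, 2)`. -/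
def Hyp2 (m : ℕ) (σ p : ℝ) : Prop :=
  1 ≤ m ∧ (m : ℝ) + 1 < p ∧ 1 + ((m : ℝ) + 1) / p < σ ∧ σ < 2

/-- The real interval `[0, Tmax)`, where `Tmax ∈ (0, ∞]`. -/
def Ico0 (Tmax : ℝ≥0∞) : Set ℝ := {t : ℝ | 0 ≤ t ∧ ENNReal.ofReal t < Tmax}

/-- The real interval `(0, Tmax)`, where `Tmax ∈ (0, ∞]`. -/
def Ioo0 (Tmax : ℝ≥0∞) : Set ℝ := {t : ℝ | 0 < t ∧ ENNReal.ofReal t < Tmax}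

/-- Continuity in `W^{σ,p}`-norm of a curve, on a time set `s`. -/
def ContW {m : ℕ} (σ p : ℝ) (s : Set ℝ) (ψ : ℝ → Spc m → ℝ) : Prop :=
  ∀ t ∈ s, ∀ ε : ℝ, 0 < ε → ∃ δ > 0, ∀ t' ∈ s, |t' - t| < δ →
    WNorm σ p (fun x => ψ t' x - ψ t x) < ENNReal.ofReal ε

/-- Hölder continuity (exponent `α`) in `W^{σ,p}`-norm of a curve, on a time set `s`. -/
def HolderW {m : ℕ} (α σ p : ℝ) (s : Set ℝ) (ψ : ℝ → Spc m → ℝ) : Prop :=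
  ∃ C : ℝ, ∀ t ∈ s, ∀ t' ∈ s,
    WNorm σ p (fun x => ψ t' x - ψ t x) ≤ ENNReal.ofReal (C * |t' - t| ^ α)

/-- `ψ` is an `L^p`-solution on `[0, Tmax)` of the nonlocal Fokker–Planck equation
`∂ₜψ = div(∇V ψ + β⁻¹∇ψ) − ∂_{x₁}(φ_ψ ψ) = β⁻¹Δψ + F(ψ)`, `ψ(0) = ψ₀`. -/
structure IsLpSolution {m : ℕ} (V : Spc m → ℝ) (β σ p : ℝ) (ψ0 : Spc m → ℝ)
    (Tmax : ℝ≥0∞) (ψ : ℝ → Spc m → ℝ) : Prop where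
  init : ∀ x, ψ 0 x = ψ0 x
  contLp : ContW 0 p (Ico0 Tmax) ψ
  regW2 : ∀ t ∈ Ioo0 Tmax, MemW 2 p (ψ t)
  regD : ∀ t ∈ Ioo0 Tmax, MemD σ p (ψ t)
  eqn : ∀ t ∈ Ioo0 Tmax,
    Tendsto (fun h : ℝ => LpN p
        (fun x => (ψ (t + h) x - ψ t x) / h - (β⁻¹ * lap (ψ t) x + Fop V (ψ t) x)))
      (nhdsWithin 0 {h : ℝ | h ≠ 0}) (nhds 0)
  derivCont : ContW 0 p (Ioo0 Tmax)
    (fun t x => β⁻¹ * lap (ψ t) x + Fop V (ψ t) x)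

/-- A maximal `L^p`-solution: an `L^p`-solution admitting no proper extension. -/
def IsMaximalLpSolution {m : ℕ} (V : Spc m → ℝ) (β σ p : ℝ) (ψ0 : Spc m → ℝ)
    (Tmax : ℝ≥0∞) (ψ : ℝ → Spc m → ℝ) : Prop :=
  IsLpSolution V β σ p ψ0 Tmax ψ ∧ 0 < Tmax ∧
    ∀ (Tmax' : ℝ≥0∞) (ψ' : ℝ → Spc m → ℝ), IsLpSolution V β σ p ψ0 Tmax' ψ' →
      (∀ t ∈ Ico0 Tmax, ψ' t = ψ t) → Tmax' ≤ Tmax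

/-- The Euclidean quadratic form on `Spc m`. -/
def qd {m : ℕ} (z : Spc m) : ℝ := z.1 ^ 2 + ∑ i, z.2 i ^ 2

/-- The heat semigroup `e^{β⁻¹ t Δ}` on the torus, realized by convolution with the Gaussian
heat kernel on the universal cover (and the identity for `t ≤ 0`). -/
def heatSG {m : ℕ} (β t : ℝ) (f : Spc m → ℝ) (x : Spc m) : ℝ :=
  if t ≤ 0 then f x
  else ∫ y : Spc m, (4 * Real.pi * (t / β)) ^ (-((m : ℝ) + 1) / 2) *
      Real.exp (-qd (x - y) / (4 * (t / β))) * f y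

/-- `ψ` is a mild solution of the nonlocal Fokker–Planck equation on `[0, Tmax)`:
`ψ ∈ C([0,Tmax), 𝒟^{σ,p})` and `ψ(t) = e^{β⁻¹tΔ}ψ₀ + ∫₀ᵗ e^{β⁻¹(t−s)Δ} F(ψ(s)) ds`. -/
def IsMildSolution {m : ℕ} (V : Spc m → ℝ) (β σ p : ℝ) (ψ0 : Spc m → ℝ)
    (Tmax : ℝ≥0∞) (ψ : ℝ → Spc m → ℝ) : Prop :=
  (∀ x, ψ 0 x = ψ0 x) ∧ (∀ t ∈ Ico0 Tmax, MemD σ p (ψ t)) ∧ ContW σ p (Ico0 Tmax) ψ ∧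
    ∀ t ∈ Ico0 Tmax, ∀ᵐ x ∂(volume : Measure (Spc m)),
      ψ t x = heatSG β t ψ0 x + ∫ s in Set.Ioc (0 : ℝ) t, heatSG β (t - s) (Fop V (ψ s)) x

/-- A maximal mild solution. -/
def IsMaximalMildSolution {m : ℕ} (V : Spc m → ℝ) (β σ p : ℝ) (ψ0 : Spc m → ℝ)
    (Tmax : ℝ≥0∞) (ψ : ℝ → Spc m → ℝ) : Prop :=
  IsMildSolution V β σ p ψ0 Tmax ψ ∧ 0 < Tmax ∧
    ∀ (Tmax' : ℝ≥0∞) (ψ' : ℝ → Spc m → ℝ), IsMildSolution V β σ p ψ0 Tmax' ψ' →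
      (∀ t ∈ Ico0 Tmax, ψ' t = ψ t) → Tmax' ≤ Tmax

/-- `L^p`-norm on the one-dimensional torus `𝕋`. -/
def LpN1 (p : ℝ) (g : ℝ → ℝ) : ℝ≥0∞ :=
  eLpNorm g (ENNReal.ofReal p) (volume.restrict (Set.Ico (0 : ℝ) 1))

/-- Membership in `L^p₀(𝕋^{m+1})`: periodic, `L^p` and of mean zero. -/
def MemL0 {m : ℕ} (p : ℝ) (f : Spc m → ℝ) : Prop :=
  IsPeriodic f ∧ Measurable f ∧ LpN p f < ⊤ ∧ (∫ x in cube m, f x) = 0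

open Finset (sum_congr mul_sum sum_nonneg sum_le_sum sum_sub_distrib single_le_sum sum_add_distrib sum_mul)
open Real (norm_eq_abs dist_eq)
local notation "oR" => ENNReal.ofReal
local notation:max "pdo" m:max => pd (e1 m)
local notation:max "OF" m:max => Option (Fin m)
local notation "byl" => (by linarith)
local notation "byp" => (by positivity)
local notation "byf" => (by fun_prop)
local notation "byn" => (by norm_num)
local notation:max "FS" m:max => (Spc m → ℝ)
local notation "evf" => Eventually.of_forall
local notation "mll" => mul_le_mul_of_nonneg_left
local notation "mlr" => mul_le_mul_of_nonneg_right
local notation "sp2" => sub_pos.mpr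
local notation "aop" => abs_of_pos
local notation "oRm" => ofReal_le_ofReal
local notation "anz" => abs_nonneg
local notation "icm" => integral_const_mul
local notation "ccm" => continuous_const.mul

section
variable {m : ℕ} {r a α γ K c c0 B p R b s ε η H M β t e C a' τ d δ μ σ : ℝ} {S : Set ℝ} {x : Spc m} {f g k h V χ : FS m} {ψ : ℝ → FS m}

def co (v : OF m) : Spc m →L[ℝ] ℝ :=
  match v with
  | none => ContinuousLinearMap.fst ℝ ℝ (Fin m → ℝ)
  | some i => (ContinuousLinearMap.proj i).comp (ContinuousLinearMap.snd ℝ ℝ (Fin m → ℝ))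

def ev (v : OF m) : Spc m :=
  match v with
  | none => e1 m
  | some i => eC m i
lemma Ka (z : Spc m) : co none z = z.1 := rfl
lemma Kb (i : Fin m) (z : Spc m) : co (some i) z = z.2 i := rfl
local notation:max "pdv" v:max => pd (ev v)
lemma Kc (v w : OF m) : co v (ev w) = if v = w then 1 else 0 := by
  cases v <;> cases w <;> simp [co, ev, e1, eC, Pi.single_apply]
lemma Kd (z : Spc m) : qd z = ∑ v, (co v z) ^ 2 := by
  simp [qd, Fintype.sum_option, Ka, Kb]
lemma Ke {y : Spc m} (h : ∀ v, co v x = co v y) : x = y := by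
  ext i
  · exact h none
  · exact h (some i)
lemma Kf (z : Spc m) : ∑ v, co v z • ev v = z := by
  apply Ke
  intro w
  rw [map_sum]
  simp [Kc]
lemma Kg (L : Spc m →L[ℝ] ℝ) (z : Spc m) : L z = ∑ v, co v z * L (ev v) := by
  conv_lhs => rw [← Kf z]
  simp [map_sum]
lemma Kh (L : Spc m →L[ℝ] ℝ) : L = ∑ v, L (ev v) • co v := by
  refine ContinuousLinearMap.ext fun z => ?_
  rw [Kg]
  simp [mul_comm]
lemma Ki (v : OF m) (z : Spc m) : |co v z| ≤ ‖z‖ := by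
  cases v with
  | none => exact norm_fst_le z
  | some i => exact (norm_le_pi_norm z.2 i).trans (norm_snd_le z)
lemma Kj (z : Spc m) (hr : 0 ≤ r) (h : ∀ v, |co v z| ≤ r) : ‖z‖ ≤ r := by
  rw [Prod.norm_def]
  exact max_le (h none) ((pi_norm_le_iff_of_nonneg hr).2 fun i => h (some i))
lemma Kk (v : OF m) : ‖(co v : Spc m →L[ℝ] ℝ)‖ ≤ 1 :=
  ContinuousLinearMap.opNorm_le_bound _ zero_le_one fun z => by simpa using Ki v z
lemma Kl (z : Spc m) : 0 ≤ qd z := by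
  rw [Kd]; positivity
lemma Km (v : OF m) (z : Spc m) : (co v z) ^ 2 ≤ qd z := by
  rw [Kd]
  exact single_le_sum (f := fun v => (co v z) ^ 2) (fun _ _ => sq_nonneg _) (Finset.mem_univ v)
lemma Kn (z : Spc m) : ‖z‖ ^ 2 ≤ qd z := by
  have : ‖z‖ ≤ Real.sqrt (qd z) :=
    Kj z (Real.sqrt_nonneg _) fun v => Real.abs_le_sqrt (Km v z)
  calc ‖z‖ ^ 2 ≤ Real.sqrt (qd z) ^ 2 := by gcongr
    _ = qd z := Real.sq_sqrt (Kl z)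
lemma Ko (z : Spc m) : qd z ≤ (m + 1) * ‖z‖ ^ 2 := by
  rw [Kd]
  calc ∑ v, (co v z) ^ 2 ≤ ∑ v : OF m, ‖z‖ ^ 2 := by
        apply sum_le_sum
        intro v _
        rw [← sq_abs]
        gcongr
        exact Ki v z
    _ = _ := by simp
lemma Kq (x y : Spc m) : qd (x + y) ≤ 2 * qd x + 2 * qd y := by
  rw [Kd, Kd, Kd, mul_sum, mul_sum, ← sum_add_distrib]
  apply sum_le_sum
  intro v _
  rw [map_add]
  nlinarith [sq_nonneg (co v x - co v y)]
lemma Kr (c : ℝ) (x : Spc m) : qd (c • x) = c ^ 2 * qd x := by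
  rw [Kd, Kd, mul_sum]
  simp [mul_pow]
lemma Kt (x : Spc m) : qd (-x) = qd x := by
  rw [Kd, Kd]; simp
lemma Ku : Continuous (qd : FS m) := by
  unfold qd; fun_prop
lemma Kv (m : ℕ) : Module.finrank ℝ (Spc m) = m + 1 := by
  simp [Spc, add_comm]

def gau (a : ℝ) (z : Spc m) : ℝ := Real.exp (-a * qd z)
local notation "gq" => gau (1/4)
lemma Kw (a : ℝ) (z : Spc m) : 0 < gau a z := Real.exp_pos _
lemma Kx (a : ℝ) : Continuous (gau a : FS m) := by
  unfold gau; exact Real.continuous_exp.comp (ccm Ku)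
lemma Ky (a : ℝ) (z : Spc m) :
    gau a z = Real.exp (-a * z.1 ^ 2) * ∏ i, Real.exp (-a * z.2 i ^ 2) := by
  rw [← Real.exp_sum, ← Real.exp_add]
  unfold gau qd
  rw [mul_add, mul_sum]
lemma Kz (ha : 0 < a) : Integrable (gau a : FS m) := by
  have h1 := integrable_exp_neg_mul_sq ha
  have h2 : Integrable (fun y : Fin m → ℝ => ∏ i, Real.exp (-a * y i ^ 2)) :=
    Integrable.fintype_prod (f := fun _ (x : ℝ) => Real.exp (-a * x ^ 2)) fun _ => h1
  have := h1.mul_prod h2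
  exact this.congr (evf fun z => (Ky a z).symm)
lemma La (_ha : 0 < a) :
    ∫ z : Spc m, gau a z = Real.sqrt (Real.pi / a) ^ (m + 1) := by
  simp_rw [Ky]
  have : (volume : Measure (Spc m)) = (volume : Measure ℝ).prod volume := rfl
  rw [this, integral_prod_mul (fun x : ℝ => Real.exp (-a * x ^ 2))
    (fun y : Fin m → ℝ => ∏ i, Real.exp (-a * y i ^ 2)), integral_gaussian,
    integral_fintype_prod_volume_eq_pow (fun x : ℝ => Real.exp (-a * x ^ 2)), integral_gaussian,
    Fintype.card_fin, pow_succ, mul_comm]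

def rho (z : Spc m) : ℝ := (Real.sqrt (2 * Real.pi) ^ (m + 1))⁻¹ * gau (1 / 2) z
lemma Lb (z : Spc m) : 0 < rho z := by
  unfold rho
  have := Kw (1/2) z
  have : 0 < Real.sqrt (2 * Real.pi) := Real.sqrt_pos.2 byp
  positivity
lemma Ld : Continuous (rho : FS m) := ccm (Kx _)
lemma Le : Integrable (rho : FS m) := (Kz byn).const_mul _
lemma Lf : ∫ z : Spc m, rho z = 1 := by
  unfold rho
  rw [icm, La byn]
  have : Real.pi / (1 / 2) = 2 * Real.pi := by ring
  rw [this, inv_mul_cancel₀]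
  have : 0 < Real.sqrt (2 * Real.pi) := Real.sqrt_pos.2 byp
  positivity
lemma Lg (z : Spc m) : rho z ≤ gq z := by
  unfold rho
  have h1 : (1 : ℝ) ≤ Real.sqrt (2 * Real.pi) := by
    rw [Real.one_le_sqrt]; nlinarith [Real.pi_gt_three]
  have h2 : (Real.sqrt (2 * Real.pi) ^ (m + 1))⁻¹ ≤ 1 := inv_le_one_of_one_le₀ (one_le_pow₀ h1)
  have h3 : gau (1 / 2) z ≤ gq z := by
    unfold gau; apply Real.exp_le_exp.2; nlinarith [Kl z]
  calc _ ≤ 1 * gau (1 / 2) z := by gcongr; exact (Kw _ _).le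
    _ ≤ _ := by rw [one_mul]; exact h3
lemma Lh (z : Spc m) : (1 + ‖z‖) * gau (1 / 2) z ≤ 4 * gq z := by
  have h : gau (1 / 2) z = gq z * gq z := by
    unfold gau; rw [← Real.exp_add]; congr 1; ring
  have h2 : (1 + ‖z‖) * gq z ≤ 4 := by
    have e : gq z = (Real.exp (1 / 4 * qd z))⁻¹ := by
      unfold gau; rw [← Real.exp_neg]; congr 1; ring
    rw [e, ← div_eq_mul_inv, div_le_iff₀ (Real.exp_pos _)]
    have := Real.add_one_le_exp (1 / 4 * qd z)
    nlinarith [Kn z, sq_nonneg (‖z‖ - 2), norm_nonneg z]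
  rw [h, ← mul_assoc]
  exact mlr h2 (Kw _ _).le
lemma Li (z : Spc m) : (1 + ‖z‖) * rho z ≤ 4 * gq z := by
  have h1 : (1 : ℝ) ≤ Real.sqrt (2 * Real.pi) := by
    rw [Real.one_le_sqrt]; nlinarith [Real.pi_gt_three]
  have h2 : (Real.sqrt (2 * Real.pi) ^ (m + 1))⁻¹ ≤ 1 := inv_le_one_of_one_le₀ (one_le_pow₀ h1)
  have h3 : rho z ≤ gau (1 / 2) z := by
    unfold rho
    calc _ ≤ 1 * gau (1 / 2) z := by gcongr; exact (Kw _ _).le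
      _ = _ := one_mul _
  refine le_trans ?_ (Lh z)
  gcongr
lemma Lj (v : OF m) (z : Spc m) : |co v z * rho z| ≤ 4 * gq z := by
  rw [abs_mul, aop (Lb z)]
  refine le_trans ?_ (Li z)
  have := Ki v z
  have := Lb z
  gcongr
  linarith
lemma Lk (v : OF m) : Integrable (fun z : Spc m => co v z * rho z) :=
  Integrable.mono' ((Kz (a := 1 / 4) byn).const_mul 4)
    (((co v).continuous.mul Ld).aestronglyMeasurable)
    (evf fun z => Lj v z)
lemma Ll (z : Spc m) :
    HasFDerivAt (rho : FS m) (-∑ v, (co v z * rho z) • co v) z := by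
  have h1 : HasFDerivAt (qd : FS m) (∑ v, (2 * co v z) • co v) z := by
    have : (qd : FS m) = fun z => ∑ v, (co v z) ^ 2 := funext Kd
    rw [this]
    apply HasFDerivAt.fun_sum
    intro v _
    have := ((co v : Spc m →L[ℝ] ℝ).hasFDerivAt (x := z)).pow 2
    simpa [two_mul] using this
  have h2 := ((h1.const_mul (-(1/2 : ℝ))).exp).const_mul ((Real.sqrt (2 * Real.pi) ^ (m + 1))⁻¹)
  refine h2.congr_fderiv ?_
  rw [← Finset.sum_neg_distrib, Finset.smul_sum, Finset.smul_sum, Finset.smul_sum]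
  refine sum_congr rfl fun v _ => ?_
  refine ContinuousLinearMap.ext fun w => ?_
  simp only [ContinuousLinearMap.smul_apply, ContinuousLinearMap.neg_apply, smul_eq_mul]
  unfold rho gau
  ring

instance spc_haar (m : ℕ) : (volume : Measure (Spc m)).IsAddHaarMeasure :=
  inferInstanceAs ((volume : Measure ℝ).prod (volume : Measure (Fin m → ℝ))).IsAddHaarMeasure
lemma Lm (v : OF m) : ∫ z : Spc m, co v z * rho z = 0 := by
  have h := integral_neg_eq_self (fun z : Spc m => co v z * rho z) volume
  have h2 : ∀ z : Spc m, co v (-z) * rho (-z) = - (co v z * rho z) := by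
    intro z; unfold rho gau; rw [Kt]; simp
  simp_rw [h2] at h
  rw [integral_neg] at h
  linarith

def Per {α : Type*} (f : Spc m → α) : Prop :=
  ∀ (x : Spc m) (k : ℤ) (j : Fin m → ℤ), f (x.1 + k, fun i => x.2 i + j i) = f x
lemma Per.comp {α γ : Type*} {f : Spc m → α} (hf : Per f) (g : α → γ) :
    Per (fun x => g (f x)) := fun x k j => congrArg g (hf x k j)

def lat (k : ℤ) (j : Fin m → ℤ) : Spc m := ((k : ℝ), fun i => (j i : ℝ))
lemma Per.lat {α : Type*} {f : Spc m → α} (hf : Per f) (x : Spc m) (k : ℤ) (j : Fin m → ℤ) :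
    f (x + lat k j) = f x := hf x k j
lemma Ln {α : Type*} {f : Spc m → α} : Per f ↔ ∀ x k j, f (x + lat k j) = f x := Iff.rfl
lemma Lo (x : Spc m) : ∃ k j, x + lat k j ∈ cube m := by
  refine ⟨-⌊x.1⌋, fun i => -⌊x.2 i⌋, ?_⟩
  refine ⟨⟨?_, ?_⟩, ?_⟩
  · simp [lat, Int.floor_le]
  · simp only [lat, Prod.fst_add]; push_cast; linarith [Int.lt_floor_add_one x.1]
  · intro i _
    simp only [lat, Prod.snd_add, Pi.add_apply]; push_cast
    exact ⟨by linarith [Int.floor_le (x.2 i)], by linarith [Int.lt_floor_add_one (x.2 i)]⟩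

def bas (m : ℕ) : Module.Basis (Unit ⊕ Fin m) ℝ (Spc m) :=
  (Module.Basis.singleton Unit ℝ).prod (Pi.basisFun ℝ (Fin m))
lemma Lq (m : ℕ) : ZSpan.fundamentalDomain (bas m) = cube m := by
  ext x
  rw [ZSpan.mem_fundamentalDomain]
  simp [bas, cube, cube1, Module.Basis.prod_repr_inl, Module.Basis.prod_repr_inr, Set.mem_prod,
    Set.mem_pi]
lemma fund (m : ℕ) : IsAddFundamentalDomain (Submodule.span ℤ (Set.range (bas m))).toAddSubgroup (cube m)
    (volume : Measure (Spc m)) := by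
  rw [← Lq]; exact ZSpan.isAddFundamentalDomain' (bas m) volume
lemma Lr (g : (Submodule.span ℤ (Set.range (bas m))).toAddSubgroup) : ∃ k j, (g : Spc m) = lat k j := by
  have h := ((bas m).mem_span_iff_repr_mem ℤ (g : Spc m)).1 g.2
  choose c hc using h
  refine ⟨c (Sum.inl ()), fun i => c (Sum.inr i), ?_⟩
  ext i
  · have := hc (Sum.inl ()); simp [bas, Module.Basis.prod_repr_inl] at this; simp [lat, this]
  · have := hc (Sum.inr i); simp [bas, Module.Basis.prod_repr_inr] at this; simp [lat, this]
lemma Lt (m : ℕ) : MeasurableSet (cube m) :=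
  measurableSet_Ico.prod (MeasurableSet.pi countable_univ fun _ _ => measurableSet_Ico)

open scoped Pointwise in
lemma Lu {g : Spc m → ℝ≥0∞} (hg : Per g) (x : Spc m) :
    ∫⁻ u in cube m, g (x + u) = ∫⁻ u in cube m, g u := by
  have h2 : IsAddFundamentalDomain (Submodule.span ℤ (Set.range (bas m))).toAddSubgroup (x +ᵥ cube m)
      (volume : Measure (Spc m)) := (fund m).vadd_of_comm x
  haveI : Countable (Submodule.span ℤ (Set.range (bas m))).toAddSubgroup :=
    inferInstanceAs (Countable (Submodule.span ℤ (Set.range (bas m))))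
  have h3 := h2.setLIntegral_eq (fund m) g (by
    intro l y
    obtain ⟨k, j, h⟩ := Lr l
    rw [AddSubgroup.vadd_def, h, vadd_eq_add, add_comm]
    exact hg.lat y k j)
  rw [← h3]
  have hmp : MeasurePreserving (fun u : Spc m => x + u) volume volume :=
    measurePreserving_add_left volume x
  have he : MeasurableEmbedding (fun u : Spc m => x + u) := measurableEmbedding_addLeft x
  have := hmp.setLIntegral_comp_emb he g (cube m)
  exact this
lemma Lv (m : ℕ) : volume (cube m) = 1 := by
  have h : (volume : Measure (Spc m)) (cube m) = volume (Set.Ico (0:ℝ) 1) * volume (cube1 m) := by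
    show ((volume : Measure ℝ).prod volume) _ = _
    rw [cube, Measure.prod_prod]
  rw [h, cube1, Real.volume_pi_Ico]
  simp

instance prob_T (m : ℕ) : IsProbabilityMeasure (μT m) := ⟨by rw [μT, Measure.restrict_apply_univ, Lv]⟩
lemma Lw {u : Spc m} (hu : u ∈ cube m) : ‖u‖ ≤ 1 := by
  apply Kj u zero_le_one
  intro v
  cases v with
  | none => rw [Ka, abs_of_nonneg hu.1.1]; exact hu.1.2.le
  | some i => rw [Kb, abs_of_nonneg (hu.2 i trivial).1]; exact (hu.2 i trivial).2.le
lemma Lx (ha : 0 < a) : ∃ C : ℝ, 0 < C ∧ ∀ g : Spc m → ℝ≥0∞, Measurable g → Per g →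
    ∀ x, ∫⁻ w, oR (gau a w) * g (x + w) ≤ oR C * ∫⁻ u in cube m, g u := by
  set K := Real.exp (a * (m + 1)) with hK
  set I := ∫ z : Spc m, gau (a / 2) z with hI
  have hIpos : 0 < I := by
    rw [hI, La byp]
    have : 0 < Real.sqrt (Real.pi / (a / 2)) := Real.sqrt_pos.2 byp
    positivity
  refine ⟨K * I, by positivity, fun g hgm hg x => ?_⟩
  have key : ∀ w, ∀ u ∈ cube m, gau a w ≤ K * gau (a / 2) (w - u) := by
    intro w u hu
    rw [hK]; unfold gau
    rw [← Real.exp_add]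
    apply Real.exp_le_exp.2
    have h1 := Kq w (-u)
    rw [Kt, ← sub_eq_add_neg] at h1
    have h2 := Ko u
    have h3 : ‖u‖ ^ 2 ≤ 1 := pow_le_one₀ (norm_nonneg u) (Lw hu)
    have h4 : qd u ≤ m + 1 := h2.trans (by nlinarith [Nat.cast_nonneg (α := ℝ) m])
    nlinarith
  have key2 : ∀ w, oR (gau a w) ≤ ∫⁻ u in cube m, oR (K * gau (a / 2) (w - u)) := by
    intro w
    calc oR (gau a w) = ∫⁻ u in cube m, oR (gau a w) := by
          rw [setLIntegral_const, Lv, mul_one]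
      _ ≤ _ := setLIntegral_mono' (Lt m) fun u hu => oRm (key w u hu)
  have gm : Measurable (gau (a / 2) : FS m) := (Kx _).measurable
  calc ∫⁻ w, oR (gau a w) * g (x + w)
      ≤ ∫⁻ w, ∫⁻ u in cube m, oR (K * gau (a / 2) (w - u)) * g (x + w) := by
        apply lintegral_mono
        intro w
        refine (mul_le_mul_left (key2 w) _).trans ?_
        exact (lintegral_mul_const _ byf).ge
    _ = ∫⁻ u in cube m, ∫⁻ w, oR (K * gau (a / 2) (w - u)) * g (x + w) := by
        apply lintegral_lintegral_swap
        apply Measurable.aemeasurable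
        apply Measurable.mul
        · exact ENNReal.measurable_ofReal.comp (measurable_const.mul (gm.comp (measurable_fst.sub measurable_snd)))
        · exact hgm.comp (measurable_const.add measurable_fst)
    _ = ∫⁻ u in cube m, ∫⁻ w, oR (K * gau (a / 2) w) * g (x + w + u) := by
        refine lintegral_congr fun u => ?_
        rw [← lintegral_add_right_eq_self _ u]
        refine lintegral_congr fun w => ?_
        simp [add_assoc]
    _ = ∫⁻ w, ∫⁻ u in cube m, oR (K * gau (a / 2) w) * g (x + w + u) := by
        apply lintegral_lintegral_swap
        apply Measurable.aemeasurable
        apply Measurable.mul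
        · exact ENNReal.measurable_ofReal.comp (measurable_const.mul (gm.comp measurable_snd))
        · exact hgm.comp ((measurable_const.add measurable_snd).add measurable_fst)
    _ = ∫⁻ w, oR (K * gau (a / 2) w) * ∫⁻ u in cube m, g u := by
        refine lintegral_congr fun w => ?_
        rw [lintegral_const_mul _ byf, Lu hg]
    _ = oR (K * I) * ∫⁻ u in cube m, g u := by
        rw [lintegral_mul_const _ byf]
        congr 1
        rw [← ofReal_integral_eq_lintegral_ofReal ((Kz byp).const_mul K)
          (evf fun z => by have := Kw (a / 2) z; positivity), icm]

def Kop (k : FS m) (c : ℝ) (f : FS m) (x : Spc m) : ℝ := ∫ z, k z * f (x + c • z)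

def Ker (K : ℝ) (k : FS m) : Prop := Continuous k ∧ ∀ z, |k z| ≤ K * gq z

def PL (f : FS m) : Prop := Per f ∧ Measurable f ∧ ∫⁻ u in cube m, ‖f u‖ₑ < ⊤
lemma Ker.nonneg (hk : Ker K k) : 0 ≤ K := by
  have := (anz _).trans (hk.2 0)
  exact nonneg_of_mul_nonneg_left this (Kw _ _)
lemma Ker.int (hk : Ker K k) : Integrable k :=
  ((Kz (a := 1/4) byn).const_mul K).mono' hk.1.aestronglyMeasurable
    (evf hk.2)
lemma Ly : Ker 4 (rho : FS m) :=
  ⟨Ld, fun z => by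
    rw [aop (Lb z)]
    linarith [Lg z, Kw (1/4) z]⟩
lemma Lz (v : OF m) : Ker 4 (fun z : Spc m => co v z * rho z) :=
  ⟨(co v).continuous.mul Ld, Lj v⟩
lemma Na (hf : PL f) (ha : 0 < a) (x : Spc m) :
    Integrable (fun w => gau a w * f (x + w)) := by
  obtain ⟨C, hC, h⟩ := Lx (m := m) ha
  refine ⟨?_, ?_⟩
  · exact ((Kx a).measurable.mul (hf.2.1.comp (measurable_const_add x))).aestronglyMeasurable
  · rw [hasFiniteIntegral_iff_enorm]
    have h1 := h (fun u => ‖f u‖ₑ) hf.2.1.enorm (hf.1.comp _) x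
    refine lt_of_le_of_lt ?_ (lt_of_le_of_lt h1 (ENNReal.mul_lt_top ofReal_lt_top hf.2.2))
    apply lintegral_mono
    intro w
    show ‖gau a w * f (x + w)‖ₑ ≤ _
    rw [enorm_mul, Real.enorm_of_nonneg (Kw a w).le]
lemma Nb (hf : PL f) (ha : 0 < a) (x : Spc m) :
    Integrable (fun y => gau a (y - x) * f y) := by
  have := (Na hf ha x).comp_sub_right x
  simpa using this
lemma Nc (a c : ℝ) (z : Spc m) : gau a (c • z) = gau (a * c ^ 2) z := by
  unfold gau; rw [Kr]; congr 1; ring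
lemma Nd (g : FS m) (hc : 0 < c) (x : Spc m) :
    ∫ z, g (x + c • z) = (c ^ (m + 1))⁻¹ * ∫ y, g y := by
  have := Measure.integral_comp_smul (μ := (volume : Measure (Spc m))) (fun z => g (x + z)) c
  rw [this, Kv, integral_add_left_eq_self (fun z => g z) x, aop byp, smul_eq_mul]
lemma Nf (k : FS m) (hc : 0 < c) (f : FS m) (x : Spc m) :
    Kop k c f x = (c ^ (m + 1))⁻¹ * ∫ y, k (c⁻¹ • (y - x)) * f y := by
  rw [← Nd _ hc x]
  unfold Kop
  congr 1; ext z
  simp [smul_smul, hc.ne']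
lemma Ng (hk : Ker K k) (hc : 0 < c) (hcc : c ≤ c0)
    {x0 : Spc m} (hx : ‖x - x0‖ ≤ c0) (y : Spc m) :
    |k (c⁻¹ • (y - x))| ≤ K * Real.exp ((m + 1) / 4 * c0 ^ 2 * (c⁻¹)^2) * gau (1 / (8 * c0 ^ 2)) (y - x0) := by
  have hc0 : 0 < c0 := hc.trans_le hcc
  refine (hk.2 _).trans ?_
  rw [mul_assoc]
  apply mll _ hk.nonneg
  rw [Nc]
  unfold gau
  rw [← Real.exp_add]
  apply Real.exp_le_exp.2
  have h1 : qd (y - x0) ≤ 2 * qd (y - x) + 2 * qd (x - x0) := by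
    have := Kq (y - x) (x - x0); simpa using this
  have h2 : qd (x - x0) ≤ (m + 1) * c0 ^ 2 := by
    refine (Ko _).trans ?_
    gcongr
  have h3 : (c0 ^ 2)⁻¹ ≤ (c⁻¹) ^ 2 := by
    rw [inv_pow]; gcongr
  have h4 : 1 / (8 * c0 ^ 2) = (c0 ^ 2)⁻¹ / 8 := by field_simp
  rw [h4]
  have h5 := Kl (y - x0)
  have h6 : (c0 ^ 2)⁻¹ * qd (y - x0) ≤ (c⁻¹) ^ 2 * qd (y - x0) := by gcongr
  have h7 : (c⁻¹)^2 * qd (y - x0) ≤ (c⁻¹)^2 * (2 * qd (y - x) + 2 * ((m + 1) * c0 ^ 2)) := by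
    gcongr; linarith
  linarith
lemma Nh (hk : Ker K k) (hc : 0 < c) 
    (hf : PL f) (x : Spc m) : Integrable (fun y => k (c⁻¹ • (y - x)) * f y) := by
  refine ((Nb hf (a := 1 / (8 * c ^ 2)) byp x).norm.const_mul
    (K * Real.exp ((m + 1) / 4 * c ^ 2 * (c⁻¹)^2))).mono' ?_ ?_
  · exact ((hk.1.measurable.comp byf).mul hf.2.1).aestronglyMeasurable
  · refine evf fun y => ?_
    rw [norm_mul, norm_mul, ← mul_assoc, norm_eq_abs, norm_eq_abs (gau _ _), aop (Kw _ _)]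
    gcongr
    exact Ng hk hc le_rfl (by simpa using hc.le) y
lemma Ni (hk : Ker K k) (hc : 0 < c) 
    (hf : PL f) (x : Spc m) : Integrable (fun z => k z * f (x + c • z)) := by
  have h := (Nh hk hc hf x)
  have h1 := h.comp_add_left x
  have h2 := (integrable_comp_smul_iff (μ := (volume : Measure (Spc m))) _ hc.ne').2 h1
  refine h2.congr (evf fun z => ?_)
  simp [smul_smul, hc.ne']
lemma PL.congr_int (hf : PL f) : Integrable f (μT m) :=
  ⟨hf.2.1.aestronglyMeasurable, hf.2.2⟩
lemma Nj (hk : Ker K k) 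
    (hf : PL f) : ContinuousOn (fun q : ℝ × Spc m => Kop k q.1 f q.2) {q | 0 < q.1} := by
  rintro ⟨c0, x0⟩ (h0 : 0 < c0)
  have key : ContinuousAt (fun q : ℝ × Spc m => (q.1 ^ (m + 1))⁻¹ * ∫ y, k (q.1⁻¹ • (y - q.2)) * f y) (c0, x0) := by
    have e1 : ∀ᶠ q : ℝ × Spc m in nhds (c0, x0), c0 / 2 < q.1 ∧ q.1 < 2 * c0 ∧ ‖q.2 - x0‖ < 2 * c0 := by
      have a1 : ContinuousAt (fun q : ℝ × Spc m => q.1) (c0, x0) := continuousAt_fst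
      have a2 : ContinuousAt (fun q : ℝ × Spc m => ‖q.2 - x0‖) (c0, x0) := by fun_prop
      filter_upwards [a1.eventually (lt_mem_nhds (show c0 / 2 < c0 by linarith)),
        a1.eventually (gt_mem_nhds (show c0 < 2 * c0 by linarith)),
        a2.eventually (gt_mem_nhds (show ‖x0 - x0‖ < 2 * c0 by simpa using h0))] with q b1 b2 b3
      exact ⟨b1, b2, b3⟩
    apply ContinuousAt.mul
    · apply ContinuousAt.inv₀
      · fun_prop
      · have : c0 ≠ 0 := h0.ne'
        simp [this]
    · refine continuousAt_of_dominated (bound := fun y => K * Real.exp ((m + 1) / 4 * (2 * c0) ^ 2 * (2 * c0⁻¹)^2) *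
        ‖gau (1 / (8 * (2 * c0) ^ 2)) (y - x0) * f y‖) ?_ ?_ ?_ ?_
      · exact evf fun q => ((hk.1.measurable.comp byf).mul hf.2.1).aestronglyMeasurable
      · filter_upwards [e1] with q hq
        refine evf fun y => ?_
        have hq1 : 0 < q.1 := by linarith [hq.1]
        rw [norm_mul, norm_mul, ← mul_assoc, norm_eq_abs, norm_eq_abs (gau _ _), aop (Kw _ _)]
        gcongr
        refine (Ng hk hq1 hq.2.1.le hq.2.2.le y).trans ?_
        have := Kw (1 / (8 * (2 * c0) ^ 2)) (y - x0)
        have := hk.nonneg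
        have h3 : q.1⁻¹ ≤ 2 * c0⁻¹ := by
          have : 2 * c0⁻¹ = (c0 / 2)⁻¹ := by field_simp
          rw [this]; gcongr; exact hq.1.le
        gcongr
      · exact (Nb hf byp x0).norm.const_mul _
      · refine evf fun y => ?_
        apply ContinuousAt.mul _ continuousAt_const
        apply hk.1.continuousAt.comp
        exact ContinuousAt.smul (f := fun q : ℝ × Spc m => q.1⁻¹) (g := fun q : ℝ × Spc m => y - q.2)
          (ContinuousAt.inv₀ continuousAt_fst h0.ne') byf
  refine (key.congr ?_).continuousWithinAt
  have : ∀ᶠ q : ℝ × Spc m in nhds (c0, x0), 0 < q.1 :=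
    (continuousAt_fst (p := ((c0, x0) : ℝ × Spc m))).eventually (lt_mem_nhds h0)
  filter_upwards [this] with q hq
  rw [Nf k hq]

def Ah (c : ℝ) (f : FS m) : FS m := Kop rho c f
def Dh (v : OF m) (c : ℝ) (f : FS m) (x : Spc m) : ℝ :=
  c⁻¹ * Kop (fun z => co v z * rho z) c f x
lemma Nk {κ : OF m → FS m} {K' : ℝ} (hk : Ker K k)
    (hκ : ∀ v, Ker K' (κ v)) (hkd : ∀ z, HasFDerivAt k (-∑ v, κ v z • co v) z)
    (hc : 0 < c) (hf : PL f) (x0 : Spc m) :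
    HasFDerivAt (Kop k c f) (∑ v, (c⁻¹ * Kop (κ v) c f x0) • co v) x0 := by
  have h1 : Kop k c f = fun x => (c ^ (m + 1))⁻¹ * ∫ y, k (c⁻¹ • (y - x)) * f y := by
    ext x; exact Nf _ hc _ _
  have hder : ∀ x y : Spc m, HasFDerivAt (fun x => k (c⁻¹ • (y - x)) * f y)
      (∑ v, (c⁻¹ * (κ v (c⁻¹ • (y - x)) * f y)) • co v) x := by
    intro x y
    have e1 : HasFDerivAt (fun x : Spc m => c⁻¹ • (y - x)) (-(c⁻¹ • ContinuousLinearMap.id ℝ (Spc m))) x := by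
      have := ((hasFDerivAt_id (𝕜 := ℝ) x).const_sub y).const_smul c⁻¹
      refine HasFDerivAt.congr_fderiv this ?_
      simp
    have e2 := ((hkd (c⁻¹ • (y - x))).comp x e1).mul_const (f y)
    refine e2.congr_fderiv ?_
    refine ContinuousLinearMap.ext fun z => ?_
    simp [mul_sum, -Fintype.sum_option]
    refine sum_congr rfl fun v _ => ?_
    ring
  have key := hasFDerivAt_integral_of_dominated_of_fderiv_le (μ := (volume : Measure (Spc m))) (𝕜 := ℝ)
    (F := fun x y => k (c⁻¹ • (y - x)) * f y)
    (F' := fun x y => ∑ v, (c⁻¹ * (κ v (c⁻¹ • (y - x)) * f y)) • co v)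
    (x₀ := x0) (s := Metric.ball x0 c)
    (bound := fun y => ∑ v : OF m, c⁻¹ * (K' * Real.exp ((m + 1) / 4 * c ^ 2 * (c⁻¹)^2) *
        ‖gau (1 / (8 * c ^ 2)) (y - x0) * f y‖)) (Metric.ball_mem_nhds x0 hc) ?_ ?_ ?_ ?_ ?_ ?_
  · rw [h1]
    refine (key.const_mul ((c ^ (m + 1))⁻¹)).congr_fderiv ?_
    rw [integral_finsetSum]
    · rw [Finset.smul_sum]
      refine sum_congr rfl fun v _ => ?_
      rw [integral_smul_const, Nf _ hc, icm, smul_smul]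
      congr 1; ring
    · intro v _
      exact ((Nh (hκ v) hc hf x0).const_mul c⁻¹).smul_const (co v)
  · exact evf fun x => ((hk.1.measurable.comp byf).mul hf.2.1).aestronglyMeasurable
  · exact Nh hk hc hf x0
  · refine Finset.aestronglyMeasurable_fun_sum _ fun v _ => ?_
    exact ((Nh (hκ v) hc hf x0).const_mul c⁻¹).smul_const (co v) |>.aestronglyMeasurable
  · refine evf fun y x hx => ?_
    refine norm_sum_le_of_le _ fun v _ => ?_
    rw [norm_smul]
    refine (mul_le_of_le_one_right (norm_nonneg _) (Kk v)).trans ?_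
    rw [norm_mul, norm_mul, norm_mul (gau _ _), ← mul_assoc (K' * _), norm_eq_abs c⁻¹, aop (by positivity : 0 < c⁻¹), norm_eq_abs (κ v _), norm_eq_abs (gau _ _), aop (Kw _ _)]
    gcongr
    exact Ng (hκ v) hc le_rfl (by rw [Metric.mem_ball, dist_eq_norm] at hx; exact hx.le) y
  · refine integrable_finsetSum _ fun v _ => ?_
    exact ((Nb hf byp x0).norm.const_mul _).const_mul _
  · exact evf fun y x _ => hder x y
lemma Nl (hc : 0 < c) (hf : PL f) (x0 : Spc m) :
    HasFDerivAt (Ah c f) (∑ v, Dh v c f x0 • co v) x0 :=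
  Nk Ly Lz Ll hc hf x0
lemma Nm (k : FS m) (c : ℝ) (hf : Per f) : Per (Kop k c f) := by
  rw [Ln]; intro x i j
  unfold Kop; congr 1; ext z
  rw [add_right_comm, hf.lat]

def G4 (m : ℕ) : ℝ := ∫ z : Spc m, gq z
lemma Nn (m : ℕ) : 0 < G4 m := by
  unfold G4; rw [La byn]
  have : 0 < Real.sqrt (Real.pi / (1 / 4)) := Real.sqrt_pos.2 byp
  positivity
lemma No (hk : Ker K k) (c : ℝ) 
    (hf : ∀ x, |f x| ≤ B) (x : Spc m) : |Kop k c f x| ≤ K * G4 m * B := by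
  have : K * G4 m * B = ∫ z : Spc m, K * gq z * B := by
    rw [integral_mul_const, icm, G4]
  rw [this, ← norm_eq_abs, Kop]
  refine norm_integral_le_of_norm_le (((Kz (a := 1/4) byn).const_mul K).mul_const B) ?_
  refine evf fun z => ?_
  rw [norm_mul]
  exact mul_le_mul (hk.2 z) (hf _) (norm_nonneg _) (mul_nonneg hk.nonneg (Kw _ _).le)
lemma Nq {g : Spc m → ℝ≥0∞} (hg : Measurable g) (hc : 0 < c) (x : Spc m) :
    ∫⁻ z, g (x + c • z) = oR ((c ^ (m + 1))⁻¹) * ∫⁻ w, g (x + w) := by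
  have h1 : Measurable fun w => g (x + w) := hg.comp (measurable_const_add x)
  have h := lintegral_map (μ := (volume : Measure (Spc m))) h1 (measurable_const_smul c)
  rw [← h, Measure.map_addHaar_smul _ hc.ne', Kv, lintegral_smul_measure,
    aop byp, smul_eq_mul]
lemma Nr (hp : 0 < p) (hR : 0 < R) : ∃ C : ℝ, 0 < C ∧
    ∀ c, 0 < c → c ≤ R → ∀ f : FS m, Per f → Measurable f → ∀ x,
      ∫⁻ z, oR (gq z) * ‖f (x + c • z)‖ₑ ^ p ≤
        oR (C * (c ^ (m + 1))⁻¹) * ∫⁻ u in cube m, ‖f u‖ₑ ^ p := by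
  obtain ⟨C, hC, h⟩ := Lx (m := m) (a := 1 / (4 * R ^ 2)) byp
  refine ⟨C, hC, fun c hc hcR f hf hfm x => ?_⟩
  have h1 := h (fun u => ‖f u‖ₑ ^ p) (hfm.enorm.pow_const p) (hf.comp (fun a => ‖a‖ₑ ^ p)) x
  have hm : Measurable (fun w : Spc m => oR (gau (1 / (4 * R ^ 2)) (w - x)) * ‖f w‖ₑ ^ p) :=
    (((Kx _).measurable.comp byf).ennreal_ofReal).mul (hfm.enorm.pow_const p)
  have h2 := Nq hm hc x
  simp only [add_sub_cancel_left] at h2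
  calc _ ≤ ∫⁻ z, oR (gau (1 / (4 * R ^ 2)) (c • z)) * ‖f (x + c • z)‖ₑ ^ p := by
        apply lintegral_mono
        intro z
        dsimp only
        gcongr
        rw [Nc]
        unfold gau
        apply Real.exp_le_exp.2
        have : 1 / (4 * R ^ 2) * c ^ 2 ≤ 1 / 4 := by
          rw [div_mul_eq_mul_div, div_le_div_iff₀ byp byn]
          nlinarith [pow_le_pow_left₀ hc.le hcR 2]
        nlinarith [Kl z]
    _ = _ := h2
    _ ≤ oR ((c ^ (m + 1))⁻¹) * (oR C * ∫⁻ u in cube m, ‖f u‖ₑ ^ p) := by gcongr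
    _ = _ := by
      rw [← mul_assoc, ← ofReal_mul byp, mul_comm C]
lemma Nt (hp : 0 < p) (f : FS m) :
    LpN p f = (∫⁻ u in cube m, ‖f u‖ₑ ^ p) ^ (1 / p) := by
  rw [LpN, eLpNorm_eq_lintegral_rpow_enorm_toReal (by simpa using hp) ofReal_ne_top, ENNReal.toReal_ofReal hp.le]
  rfl
lemma Nu (hp : 1 < p) (hR : 0 < R) : ∃ C : ℝ, 0 < C ∧
    ∀ (K : ℝ) (k : FS m), Ker K k → ∀ c, 0 < c → c ≤ R → ∀ f : FS m, Per f → Measurable f →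
      ∀ B : ℝ, 0 ≤ B → LpN p f ≤ oR B → ∀ x,
      |Kop k c f x| ≤ C * K * c ^ (-((m + 1) / p : ℝ)) * B := by
  have hp0 : 0 < p := by linarith
  obtain ⟨C, hC, h⟩ := Nr (m := m) hp0 hR
  set q := Real.conjExponent p with hq
  have hpq : p.HolderConjugate q := Real.HolderConjugate.conjExponent hp
  refine ⟨G4 m ^ (1 / q) * C ^ (1 / p), by have := Nn m; positivity, fun K k hk c hc hcR f hf hfm B hB hfB x => ?_⟩
  have hK := hk.nonneg
  have hG := Nn m
  have h1 : ‖Kop k c f x‖ₑ ≤ oR (G4 m ^ (1 / q) * C ^ (1 / p) * K * c ^ (-((m + 1) / p : ℝ)) * B) := by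
    calc ‖Kop k c f x‖ₑ ≤ ∫⁻ z, ‖k z * f (x + c • z)‖ₑ := enorm_integral_le_lintegral_enorm _
      _ ≤ ∫⁻ z, oR K * (oR (gq z ^ (1 / p)) * ‖f (x + c • z)‖ₑ * oR (gq z ^ (1/q))) := by
          apply lintegral_mono
          intro z
          dsimp only
          have e : gq z = gq z ^ (1 / p) * gq z ^ (1/q) := by
            rw [← Real.rpow_add (Kw _ _), one_div p, one_div q, hpq.inv_add_inv_eq_one, Real.rpow_one]
          have e2 : ‖k z‖ₑ ≤ oR K * (oR (gq z ^ (1 / p)) * oR (gq z ^ (1/q))) := by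
            rw [← ofReal_mul (Real.rpow_nonneg (Kw _ _).le _), ← e, ← ofReal_mul hK, Real.enorm_eq_ofReal_abs]
            exact oRm (hk.2 z)
          rw [enorm_mul]
          calc _ ≤ _ := mul_le_mul_left e2 _
            _ = _ := by ring
      _ = oR K * ∫⁻ z, (oR (gq z ^ (1 / p)) * ‖f (x + c • z)‖ₑ * oR (gq z ^ (1/q))) :=
          lintegral_const_mul' _ _ ofReal_ne_top
      _ ≤ oR K * ((∫⁻ z, (oR (gq z ^ (1 / p)) * ‖f (x + c • z)‖ₑ) ^ p) ^ (1 / p) *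
          (∫⁻ z : Spc m, (oR (gq z ^ (1/q))) ^ q) ^ (1 / q)) := by
          gcongr
          refine ENNReal.lintegral_mul_le_Lp_mul_Lq volume hpq ?_ ?_
          · exact ((((Kx _).measurable.pow_const _).ennreal_ofReal).mul (hfm.comp byf).enorm).aemeasurable
          · exact (((Kx _).measurable.pow_const _).ennreal_ofReal).aemeasurable
      _ ≤ oR K * ((oR (C * (c ^ (m + 1))⁻¹) ^ (1 / p) * oR B) * oR (G4 m) ^ (1 / q)) := by
          have hq1 : (0:ℝ) ≤ 1 / q := one_div_nonneg.2 hpq.symm.pos.le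
          gcongr
          · have e : ∀ z : Spc m, (oR (gq z ^ (1 / p)) * ‖f (x + c • z)‖ₑ) ^ p
                = oR (gq z) * ‖f (x + c • z)‖ₑ ^ p := by
              intro z
              rw [ENNReal.mul_rpow_of_nonneg _ _ hp0.le, ofReal_rpow_of_nonneg (Real.rpow_nonneg (Kw _ _).le _) hp0.le,
                ← Real.rpow_mul (Kw _ _).le, one_div_mul_cancel hp0.ne', Real.rpow_one]
            simp_rw [e]
            calc _ ≤ (oR (C * (c ^ (m + 1))⁻¹) * ∫⁻ u in cube m, ‖f u‖ₑ ^ p) ^ (1 / p) := by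
                  gcongr; exact h c hc hcR f hf hfm x
              _ = _ := ENNReal.mul_rpow_of_nonneg _ _ byp
              _ ≤ _ := by rw [← Nt hp0]; gcongr
          · have hq0 := hpq.symm.pos
            have e : ∀ z : Spc m, (oR (gq z ^ (1/q))) ^ q = oR (gq z) := by
              intro z
              rw [ofReal_rpow_of_nonneg (Real.rpow_nonneg (Kw _ _).le _) hq0.le,
                ← Real.rpow_mul (Kw _ _).le, one_div_mul_cancel hq0.ne', Real.rpow_one]
            have hq1 : (0:ℝ) ≤ 1 / q := one_div_nonneg.2 hq0.le
            simp_rw [e]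
            rw [← ofReal_integral_eq_lintegral_ofReal (Kz byn) (evf fun z => (Kw _ _).le)]
            rfl
      _ = _ := by
          have hq1 : (0:ℝ) ≤ 1 / q := one_div_nonneg.2 hpq.symm.pos.le
          rw [ofReal_rpow_of_nonneg byp byp, ofReal_rpow_of_nonneg hG.le hq1,
            ← ofReal_mul byp, ← ofReal_mul byp, ← ofReal_mul byp]
          congr 1
          rw [Real.mul_rpow hC.le byp, Real.inv_rpow byp, ← Real.rpow_natCast, ← Real.rpow_mul hc.le,
            ← Real.rpow_neg hc.le]
          push_cast
          have : -(((m:ℝ) + 1) * (1 / p)) = -((m + 1) / p : ℝ) := by ring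
          rw [this]; ring
  rw [Real.enorm_eq_ofReal_abs] at h1
  exact (ofReal_le_ofReal_iff byp).1 h1

def rotL (a b : ℝ) : (Spc m × Spc m) →ₗ[ℝ] (Spc m × Spc m) where
  toFun q := (a • q.1 + b • q.2, b • q.1 - a • q.2)
  map_add' x y := by ext <;> simp <;> ring
  map_smul' c x := by ext <;> simp <;> ring
lemma Nv (h : a ^ 2 + b ^ 2 = 1) : |LinearMap.det (rotL (m := m) a b)| = 1 := by
  have h1 : rotL (m := m) a b ∘ₗ rotL a b = LinearMap.id := by
    refine LinearMap.ext fun q => ?_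
    have e1 : a • (a • q.1 + b • q.2) + b • (b • q.1 - a • q.2) = (a ^ 2 + b ^ 2) • q.1 := by module
    have e2 : b • (a • q.1 + b • q.2) - a • (b • q.1 - a • q.2) = (a ^ 2 + b ^ 2) • q.2 := by module
    show (a • (a • q.1 + b • q.2) + b • (b • q.1 - a • q.2), b • (a • q.1 + b • q.2) - a • (b • q.1 - a • q.2)) = q
    rw [e1, e2, h]; simp
  have h2 := congrArg LinearMap.det h1
  rw [LinearMap.det_comp, LinearMap.det_id] at h2
  have := congrArg abs h2
  rw [abs_mul, abs_one] at this
  nlinarith [anz (LinearMap.det (rotL (m := m) a b))]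

instance spc2_haar (m : ℕ) : ((volume : Measure (Spc m)).prod (volume : Measure (Spc m))).IsAddHaarMeasure :=
  Measure.prod.instIsAddHaarMeasure _ _
lemma Nw (h : a ^ 2 + b ^ 2 = 1) :
    MeasurePreserving (fun q : Spc m × Spc m => (a • q.1 + b • q.2, b • q.1 - a • q.2))
      ((volume : Measure (Spc m)).prod volume) ((volume : Measure (Spc m)).prod volume) := by
  refine ⟨by fun_prop, ?_⟩
  have h0 := Nv (m := m) h
  have hne : LinearMap.det (rotL (m := m) a b) ≠ 0 := by intro e; simp [e] at h0
  have := Measure.map_linearMap_addHaar_eq_smul_addHaar ((volume : Measure (Spc m)).prod (volume : Measure (Spc m))) hne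
  rw [abs_inv, h0, inv_one, ofReal_one, one_smul] at this
  exact this
lemma Nx (h : a ^ 2 + b ^ 2 = 1) (z w : Spc m) :
    qd (a • z + b • w) + qd (b • z - a • w) = qd z + qd w := by
  rw [Kd, Kd, Kd, Kd, ← sum_add_distrib, ← sum_add_distrib]
  refine sum_congr rfl fun v _ => ?_
  simp only [map_add, map_sub, map_smul, smul_eq_mul]
  linear_combination ((co v z) ^ 2 + (co v w) ^ 2) * h
lemma Ny (r : ℝ) (h : a ^ 2 + b ^ 2 = 1) (z w : Spc m) :
    gau r (a • z + b • w) * gau r (b • z - a • w) = gau r z * gau r w := by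
  unfold gau
  rw [← Real.exp_add, ← mul_add, Nx h, mul_add, Real.exp_add]
lemma Nz (h : a ^ 2 + b ^ 2 = 1) (z w : Spc m) :
    rho (a • z + b • w) * rho (b • z - a • w) = rho z * rho w := by
  unfold rho
  linear_combination (Real.sqrt (2 * Real.pi) ^ (m + 1))⁻¹ * (Real.sqrt (2 * Real.pi) ^ (m + 1))⁻¹ * Ny (1/2) h z w
lemma Qa {K1 K2 : ℝ} {k1 k2 : FS m} (hk1 : Ker K1 k1) (hk2 : Ker K2 k2) 
    (hf : PL f) (_ha : 0 < a) (hb : 0 < b) (hs : 0 < s) (h : a ^ 2 + b ^ 2 = s ^ 2) (x : Spc m) :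
    Integrable (fun q : Spc m × Spc m => (k1 ((a / s) • q.1 + (b / s) • q.2) *
      k2 ((b / s) • q.1 - (a / s) • q.2)) * f (x + s • q.1)) ((volume : Measure (Spc m)).prod volume) ∧
    Kop k1 a (Kop k2 b f) x = ∫ q : Spc m × Spc m, (k1 ((a / s) • q.1 + (b / s) • q.2) *
      k2 ((b / s) • q.1 - (a / s) • q.2)) * f (x + s • q.1) ∂((volume : Measure (Spc m)).prod volume) := by
  have h1 : (a / s) ^ 2 + (b / s) ^ 2 = 1 := by
    field_simp; exact h
  have hmp := Nw (m := m) h1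
  have e : ∀ z w : Spc m, x + a • ((a / s) • z + (b / s) • w) + b • ((b / s) • z - (a / s) • w) = x + s • z := by
    intro z w
    have : s = (a ^ 2 + b ^ 2) / s := by rw [h]; field_simp
    conv_rhs => rw [this]
    module
  have hm1 := hk1.1.measurable
  have hm2 := hk2.1.measurable
  have hm3 := hf.2.1
  have I1 : Integrable (fun q : Spc m × Spc m => (k1 ((a / s) • q.1 + (b / s) • q.2) *
      k2 ((b / s) • q.1 - (a / s) • q.2)) * f (x + s • q.1)) ((volume : Measure (Spc m)).prod volume) := by
    have i0 : Integrable (fun z : Spc m => gq z * f (x + s • z)) :=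
      Ni (K := 1) ⟨Kx _, fun z => by rw [aop (Kw _ _), one_mul]⟩ hs hf x
    have i1 := i0.mul_prod (Kz (m := m) (a := 1/4) byn)
    refine (i1.norm.const_mul (K1 * K2)).mono' ?_ ?_
    · exact Measurable.aestronglyMeasurable byf
    · refine evf fun q => ?_
      rw [norm_mul, norm_mul, norm_mul, norm_mul, norm_eq_abs (gau _ _), norm_eq_abs (gau _ _),
        aop (Kw _ _), aop (Kw _ _)]
      have := mul_le_mul (hk1.2 ((a / s) • q.1 + (b / s) • q.2)) (hk2.2 ((b / s) • q.1 - (a / s) • q.2)) (anz _)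
        (mul_nonneg hk1.nonneg (Kw _ _).le)
      have e2 := Ny (1/4) h1 q.1 q.2
      calc _ ≤ (K1 * gq ((a / s) • q.1 + (b / s) • q.2) * (K2 * gq ((b / s) • q.1 - (a / s) • q.2))) * ‖f (x + s • q.1)‖ := by
            exact mlr this (norm_nonneg _)
        _ = _ := by linear_combination K1 * K2 * ‖f (x + s • q.1)‖ * e2
  refine ⟨I1, ?_⟩
  have hE : MeasurableEmbedding (fun q : Spc m × Spc m => ((a / s) • q.1 + (b / s) • q.2, (b / s) • q.1 - (a / s) • q.2)) := by
    apply Continuous.measurableEmbedding byf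
    intro q q' hq
    obtain ⟨e1, e2⟩ := Prod.mk.inj hq
    have f1 : ∀ q : Spc m × Spc m, (a / s) • ((a / s) • q.1 + (b / s) • q.2) + (b / s) • ((b / s) • q.1 - (a / s) • q.2) = q.1 := by
      intro q
      have : (a / s) • ((a / s) • q.1 + (b / s) • q.2) + (b / s) • ((b / s) • q.1 - (a / s) • q.2) = ((a/s)^2+(b/s)^2) • q.1 := by module
      rw [this, h1, one_smul]
    have f2 : ∀ q : Spc m × Spc m, (b / s) • ((a / s) • q.1 + (b / s) • q.2) - (a / s) • ((b / s) • q.1 - (a / s) • q.2) = q.2 := by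
      intro q
      have : (b / s) • ((a / s) • q.1 + (b / s) • q.2) - (a / s) • ((b / s) • q.1 - (a / s) • q.2) = ((a/s)^2+(b/s)^2) • q.2 := by module
      rw [this, h1, one_smul]
    ext1
    · rw [← f1 q, ← f1 q', e1, e2]
    · rw [← f2 q, ← f2 q', e1, e2]
  have hI := hmp.integral_comp hE (fun q : Spc m × Spc m => (k1 q.1 * k2 q.2) * f (x + a • q.1 + b • q.2))
  have hI2 := hmp.integrable_comp_emb hE (g := fun q : Spc m × Spc m => (k1 q.1 * k2 q.2) * f (x + a • q.1 + b • q.2))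
  dsimp only [Function.comp_def] at hI hI2
  simp only [e] at hI hI2
  rw [hI, integral_prod _ (hI2.1 I1)]
  unfold Kop
  congr 1; ext z
  rw [← icm]
  congr 1; ext w
  ring
lemma Qb (hf : PL f) (ha : 0 < a) (hb : 0 < b) (hs : 0 < s)
    (h : a ^ 2 + b ^ 2 = s ^ 2) (x : Spc m) : Ah a (Ah b f) x = Ah s f x := by
  have h1 : (a / s) ^ 2 + (b / s) ^ 2 = 1 := by
    field_simp; exact h
  unfold Ah
  rw [(Qa Ly Ly hf ha hb hs h x).2]
  simp_rw [Nz h1]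
  have : ∀ q : Spc m × Spc m, rho q.1 * rho q.2 * f (x + s • q.1) = (rho q.1 * f (x + s • q.1)) * rho q.2 := by
    intro q; ring
  simp_rw [this]
  rw [integral_prod_mul (fun z : Spc m => rho z * f (x + s • z)) rho, Lf, mul_one, Kop]
lemma Qc (hf : PL f) (hs : 0 < s) (x : Spc m) (v : OF m) (α γ : ℝ) :
    ∫ q : Spc m × Spc m, ((α * co v q.1 + γ * co v q.2) * (rho q.1 * rho q.2)) * f (x + s • q.1) ∂((volume : Measure (Spc m)).prod volume)
      = α * Kop (fun z => co v z * rho z) s f x := by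
  have : ∀ q : Spc m × Spc m, ((α * co v q.1 + γ * co v q.2) * (rho q.1 * rho q.2)) * f (x + s • q.1) =
      α * (((co v q.1 * rho q.1) * f (x + s • q.1)) * rho q.2) + γ * ((rho q.1 * f (x + s • q.1)) * (co v q.2 * rho q.2)) := by
    intro q; ring
  simp_rw [this]
  rw [integral_add, icm, icm,
    integral_prod_mul (fun z : Spc m => (co v z * rho z) * f (x + s • z)) rho,
    integral_prod_mul (fun z : Spc m => rho z * f (x + s • z)) (fun z => co v z * rho z), Lm, Lf]
  · simp [Kop]
  · exact ((Ni (Lz v) hs hf x).mul_prod Le).const_mul α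
  · exact ((Ni Ly hs hf x).mul_prod (Lk v)).const_mul γ
lemma Qd (hf : PL f) (ha : 0 < a) (hb : 0 < b) (hs : 0 < s)
    (h : a ^ 2 + b ^ 2 = s ^ 2) (v : OF m) (x : Spc m) : Dh v a (Ah b f) x = Dh v s f x := by
  have h1 : (a / s) ^ 2 + (b / s) ^ 2 = 1 := by
    field_simp; exact h
  unfold Dh Ah
  rw [(Qa (Lz v) Ly hf ha hb hs h x).2]
  have e := Qc hf hs x v (a / s) (b / s)
  have e2 : ∀ q : Spc m × Spc m, co v ((a / s) • q.1 + (b / s) • q.2) * rho ((a / s) • q.1 + (b / s) • q.2) *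
      rho ((b / s) • q.1 - (a / s) • q.2) = (a / s * co v q.1 + b / s * co v q.2) * (rho q.1 * rho q.2) := by
    intro q; rw [mul_assoc, Nz h1]; simp
  simp_rw [e2]
  rw [e]; field_simp
lemma Qe (hf : PL f) (ha : 0 < a) (hb : 0 < b) (hs : 0 < s)
    (h : a ^ 2 + b ^ 2 = s ^ 2) (v : OF m) (x : Spc m) : Ah a (Dh v b f) x = Dh v s f x := by
  have h1 : (a / s) ^ 2 + (b / s) ^ 2 = 1 := by
    field_simp; exact h
  have e0 : Ah a (Dh v b f) x = b⁻¹ * Kop rho a (Kop (fun z => co v z * rho z) b f) x := by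
    unfold Ah Dh
    rw [Kop, Kop, ← icm]
    congr 1; ext z; ring
  rw [e0, (Qa Ly (Lz v) hf ha hb hs h x).2]
  have e := Qc hf hs x v (b / s) (-(a / s))
  have e2 : ∀ q : Spc m × Spc m, rho ((a / s) • q.1 + (b / s) • q.2) * (co v ((b / s) • q.1 - (a / s) • q.2) *
      rho ((b / s) • q.1 - (a / s) • q.2)) = (b / s * co v q.1 + -(a / s) * co v q.2) * (rho q.1 * rho q.2) := by
    intro q; rw [mul_left_comm, Nz h1]; simp; left; ring
  simp_rw [e2]
  rw [e, Dh]; field_simp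
lemma PL.of_bdd (hp : Per f) (hm : Measurable f) (hB : ∀ x, |f x| ≤ B) : PL f := by
  refine ⟨hp, hm, ?_⟩
  calc ∫⁻ u in cube m, ‖f u‖ₑ ≤ ∫⁻ u in cube m, oR B := by
        apply lintegral_mono; intro u
        dsimp only
        rw [Real.enorm_eq_ofReal_abs]; exact oRm (hB u)
    _ < ⊤ := by rw [setLIntegral_const, Lv]; simp
lemma PL.of_LpN (hp1 : 1 ≤ p) (hp : Per f) (hm : Measurable f) (hB : LpN p f < ⊤) : PL f := by
  refine ⟨hp, hm, ?_⟩
  have h1 : eLpNorm f 1 (μT m) ≤ LpN p f :=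
    eLpNorm_le_eLpNorm_of_exponent_le (by simpa using hp1) hm.aestronglyMeasurable
  rw [eLpNorm_one_eq_lintegral_enorm] at h1
  exact h1.trans_lt hB
lemma Qf (hB : ∀ x, |f x| ≤ B) : LpN p f ≤ oR B := by
  have := eLpNorm_le_of_ae_bound (μ := μT m) (p := oR p) (f := f) (C := B) (evf hB)
  simpa [LpN] using this
lemma Qg (hk : Ker K k) 
    (hf : PL f) (hc : 0 < c) : Continuous (Kop k c f) := by
  have h := Nj hk hf
  rw [continuous_iff_continuousAt]
  intro x
  have h1 : ContinuousAt (fun q : ℝ × Spc m => Kop k q.1 f q.2) (c, x) :=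
    (h (c, x) hc).continuousAt ((isOpen_lt continuous_const continuous_fst).mem_nhds hc)
  exact ContinuousAt.comp (g := fun q : ℝ × Spc m => Kop k q.1 f q.2) (f := fun x => (c, x)) h1 byf
lemma Qh (hp : Per f) (hc : Continuous f) : ∃ B, 0 ≤ B ∧ ∀ x, |f x| ≤ B := by
  obtain ⟨B, hB⟩ := (isCompact_closedBall (0 : Spc m) 1).exists_bound_of_continuousOn hc.continuousOn
  refine ⟨max B 0, le_max_right _ _, fun x => ?_⟩
  obtain ⟨k, j, h⟩ := Lo x
  rw [← hp.lat x k j]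
  exact (hB _ (by simpa using Lw h)).trans (le_max_left _ _)
lemma PL.of_cont (hp : Per f) (hc : Continuous f) : PL f := by
  obtain ⟨B, _, hB⟩ := Qh hp hc
  exact PL.of_bdd hp hc.measurable hB
lemma Qi (hk : Ker K k) 
    (hf : PL f) (hc : 0 < c) : PL (Kop k c f) :=
  PL.of_cont (Nm k c hf.1) (Qg hk hf hc)
lemma Qj (hf : PL f) (hc : 0 < c) (v : OF m) : PL (Dh v c f) :=
  PL.of_cont ((Nm _ c hf.1).comp fun t => c⁻¹ * t) (ccm (Qg (Lz v) hf hc))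
lemma Qk (hp : Per f) (hc : Continuous f) (hε : 0 < ε) :
    ∃ δ > 0, ∀ x y, ‖y‖ < δ → |f (x + y) - f x| < ε := by
  have := (isCompact_closedBall (0 : Spc m) 2).uniformContinuousOn_of_continuous hc.continuousOn
  obtain ⟨δ, hδ, h⟩ := Metric.uniformContinuousOn_iff.1 this ε hε
  refine ⟨min δ 1, by positivity, fun x y hy => ?_⟩
  obtain ⟨k, j, hk⟩ := Lo x
  have hk' := Lw hk
  have e := h (x + y + lat k j) (by
    rw [mem_closedBall_zero_iff, add_right_comm]
    calc _ ≤ ‖x + lat k j‖ + ‖y‖ := norm_add_le _ _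
      _ ≤ 2 := by linarith [hy.le.trans (min_le_right _ _)]) (x + lat k j) (by
    rw [mem_closedBall_zero_iff]; linarith) (by
    rw [dist_eq_norm]
    have : x + y + lat k j - (x + lat k j) = y := by abel
    rw [this]; exact hy.trans_le (min_le_left _ _))
  rwa [hp.lat, hp.lat] at e
lemma Ql (hp : Per f) (v : Spc m) : Per (pd v f) := by
  rw [Ln]; intro x k j
  unfold pd
  have : f = fun y => f (y + lat k j) := by ext y; rw [hp.lat]
  conv_rhs => rw [this, fderiv_comp_add_right]
lemma Qm (hg : Differentiable ℝ g) (hg1 : PL g) (v : OF m) (hg2 : PL (pdv v g))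
    (hc : 0 < c) (x : Spc m) : Dh v c g x = Ah c (pdv v g) x := by
  unfold Dh Ah
  rw [Nf _ hc, Nf _ hc]
  have hd : ∀ y : Spc m, HasFDerivAt (fun y => rho (c⁻¹ • (y - x)))
      (∑ w, (-(c⁻¹ * (co w (c⁻¹ • (y - x)) * rho (c⁻¹ • (y - x))))) • co w) y := by
    intro y
    have e1 : HasFDerivAt (fun y : Spc m => c⁻¹ • (y - x)) ((c⁻¹ • ContinuousLinearMap.id ℝ (Spc m))) y :=
      ((hasFDerivAt_id (𝕜 := ℝ) y).sub_const x).const_smul c⁻¹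
    refine ((Ll (c⁻¹ • (y - x))).comp y e1).congr_fderiv ?_
    refine ContinuousLinearMap.ext fun z => ?_
    simp [mul_sum, -Fintype.sum_option]
    refine sum_congr rfl fun v _ => ?_
    ring
  have hdv : ∀ y : Spc m, fderiv ℝ (fun y => rho (c⁻¹ • (y - x))) y (ev v) = -(c⁻¹ * (co v (c⁻¹ • (y - x)) * rho (c⁻¹ • (y - x)))) := by
    intro y
    rw [(hd y).fderiv]
    simp only [sum_apply, smul_apply, Kc, smul_eq_mul]
    rw [Finset.sum_eq_single v]
    · simp
    · intro w _ hw; simp [hw]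
    · simp
  have := integral_mul_fderiv_eq_neg_fderiv_mul_of_integrable (μ := (volume : Measure (Spc m))) (𝕜 := ℝ)
    (f := fun y => rho (c⁻¹ • (y - x))) (g := g) (v := ev v) ?_ ?_ ?_ (fun y _ => (hd y).differentiableAt) (fun y _ => hg y)
  · unfold pd
    rw [this]
    simp_rw [hdv]
    have e : ∀ y, -(c⁻¹ * (co v (c⁻¹ • (y - x)) * rho (c⁻¹ • (y - x)))) * g y = -(c⁻¹ * (co v (c⁻¹ • (y - x)) * rho (c⁻¹ • (y - x)) * g y)) := by
      intro y; ring
    simp_rw [e]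
    rw [integral_neg, icm]
    ring
  · simp_rw [hdv]
    refine ((Nh (Lz v) hc hg1 x).const_mul (-c⁻¹)).congr (evf fun y => ?_)
    ring
  · exact Nh Ly hc hg2 x
  · exact Nh Ly hc hg1 x
lemma Qn (g : FS m) (x z : Spc m) : fderiv ℝ g x z = ∑ v, co v z * pdv v g x :=
  Kg _ _
lemma Qo (hg : ContDiff ℝ 1 g) (hp : Per g) (x : Spc m) (c : ℝ) :
    HasDerivAt (fun c => Ah c g x) (∑ v, Kop (fun z => co v z * rho z) c (pdv v g) x) c := by
  have hgc := hg.continuous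
  have hgd := hg.differentiable byn
  have hfc : Continuous (fderiv ℝ g) := hg.continuous_fderiv byn
  have hpc : ∀ v : OF m, Continuous (pdv v g) := fun v => hfc.clm_apply continuous_const
  have hb : ∀ v : OF m, ∃ B, 0 ≤ B ∧ ∀ x, |pdv v g x| ≤ B := fun v => Qh (Ql hp _) (hpc v)
  choose B hB0 hB using hb
  obtain ⟨B0, _, hB00⟩ := Qh hp hgc
  have hint : ∀ {k : FS m} {K : ℝ}, Ker K k → ∀ {f : FS m} {B : ℝ}, Continuous f → (∀ x, |f x| ≤ B) → ∀ c : ℝ,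
      Integrable (fun z => k z * f (x + c • z)) := by
    intro k K hk f B hf hfB c
    refine hk.int.mul_bdd (c := B) byf ?_
    exact evf fun z => hfB _
  have key := hasDerivAt_integral_of_dominated_loc_of_deriv_le (μ := (volume : Measure (Spc m))) (𝕜 := ℝ)
    (F := fun c z => rho z * g (x + c • z))
    (F' := fun c z => ∑ v, co v z * rho z * pdv v g (x + c • z)) (x₀ := c) (s := Set.univ)
    (bound := fun z => ∑ v, |co v z * rho z| * B v) univ_mem ?_ ?_ ?_ ?_ ?_ ?_
  · have := key.2
    rw [integral_finsetSum] at this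
    · exact this
    · intro v _; exact hint (Lz v) (hpc v) (hB v) c
  · exact evf fun c => (Ld.mul (hgc.comp byf)).aestronglyMeasurable
  · exact hint Ly hgc hB00 c
  · refine Continuous.aestronglyMeasurable ?_
    refine continuous_finsetSum _ fun v _ => ?_
    exact ((co v).continuous.mul Ld).mul ((hpc v).comp byf)
  · refine evf fun z c _ => ?_
    refine norm_sum_le_of_le _ fun v _ => ?_
    rw [norm_mul]
    exact mll (hB v _) (norm_nonneg _)
  · exact integrable_finsetSum _ fun v _ => (Lk v).abs.mul_const _
  · refine evf fun z c _ => ?_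
    have e1 : HasDerivAt (fun c : ℝ => x + c • z) z c := by
      simpa using ((hasDerivAt_id c).smul_const z).const_add x
    have e2 := ((hgd (x + c • z)).hasFDerivAt.comp_hasDerivAt c e1).const_mul (rho z)
    refine e2.congr_deriv ?_
    rw [Qn, mul_sum]
    refine sum_congr rfl fun v _ => ?_
    ring
lemma Qq (g : FS m) : Ah 0 g = g := by
  ext x; simp [Ah, Kop, integral_mul_const, Lf]

def Ker2 (K : ℝ) (k : FS m) : Prop := Continuous k ∧ ∀ z, (1 + ‖z‖) * |k z| ≤ K * gq z
lemma Qr (z : Spc m) : (1 + ‖z‖) ^ 2 * rho z ≤ 16 * gq z := by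
  have h1 : (1 : ℝ) ≤ Real.sqrt (2 * Real.pi) := by
    rw [Real.one_le_sqrt]; nlinarith [Real.pi_gt_three]
  have h2 : (Real.sqrt (2 * Real.pi) ^ (m + 1))⁻¹ ≤ 1 := inv_le_one_of_one_le₀ (one_le_pow₀ h1)
  have h3 : rho z ≤ gau (1 / 2) z := by
    unfold rho; exact mul_le_of_le_one_left (Kw _ _).le h2
  have h4 : gau (1 / 2) z = gq z * gq z := by
    unfold gau; rw [← Real.exp_add]; congr 1; ring
  have h5 : (1 + ‖z‖) ^ 2 * gq z ≤ 16 := by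
    have e : gq z = (Real.exp (1 / 4 * qd z))⁻¹ := by
      unfold gau; rw [← Real.exp_neg]; congr 1; ring
    rw [e, ← div_eq_mul_inv, div_le_iff₀ (Real.exp_pos _)]
    have := Real.add_one_le_exp (1 / 4 * qd z)
    have := Kn z
    nlinarith [sq_nonneg (‖z‖ - 1), norm_nonneg z]
  calc (1 + ‖z‖) ^ 2 * rho z ≤ (1 + ‖z‖) ^ 2 * (gq z * gq z) := by rw [← h4]; gcongr
    _ = ((1 + ‖z‖) ^ 2 * gq z) * gq z := by ring
    _ ≤ _ := mlr h5 (Kw _ _).le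
lemma Qt : Ker2 16 (rho : FS m) := ⟨Ld, fun z => by
  rw [aop (Lb z)]
  refine le_trans ?_ (Qr z)
  have := Lb z
  have := norm_nonneg z
  gcongr
  nlinarith⟩
lemma Qu (hk : Ker2 K k) {F : FS m} (hα : 0 ≤ α)
    (hF : ∀ z, |F z| ≤ α * (1 + ‖z‖)) : |∫ z, k z * F z| ≤ K * G4 m * α := by
  have : K * G4 m * α = ∫ z : Spc m, K * gq z * α := by
    rw [integral_mul_const, icm, G4]
  rw [this, ← norm_eq_abs]
  refine norm_integral_le_of_norm_le (((Kz (a := 1/4) byn).const_mul K).mul_const α) ?_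
  refine evf fun z => ?_
  rw [norm_mul]
  calc ‖k z‖ * ‖F z‖ ≤ |k z| * (α * (1 + ‖z‖)) := by gcongr; exacts [le_rfl, hF z]
    _ = ((1 + ‖z‖) * |k z|) * α := by ring
    _ ≤ _ := mlr (hk.2 z) hα
lemma Qv (hk : Ker K k) (hf : Measurable f) 
    (hB : ∀ x, |f x| ≤ B) (x : Spc m) (c : ℝ) : Integrable (fun z => k z * f (x + c • z)) :=
  hk.int.mul_bdd (c := B) (hf.comp byf).aestronglyMeasurable (evf fun _ => hB _)
lemma Qw (hf : Measurable f) (hB : ∀ x, |f x| ≤ B) (c : ℝ) (x : Spc m) :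
    Ah c f x - f x = ∫ z, rho z * (f (x + c • z) - f x) := by
  simp_rw [mul_sub]
  rw [integral_sub (Qv Ly hf hB x c) (Le.mul_const _), integral_mul_const, Lf, one_mul]
  rfl
lemma Qx (hp : Per g) (hg : Continuous g) (hv : 0 < η) :
    ∃ δ > 0, ∀ c, 0 ≤ c → c ≤ δ → ∀ x, |Ah c g x - g x| ≤ η := by
  obtain ⟨B, hB0, hB⟩ := Qh hp hg
  have hG := Nn m
  obtain ⟨δ, hδ, h⟩ := Qk hp hg (ε := η / (16 * G4 m)) byp
  refine ⟨η / (16 * G4 m) * δ / (2 * B + 1), by positivity, fun c hc hcδ x => ?_⟩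
  rw [Qw hg.measurable hB]
  have := Qu Qt (F := fun z => g (x + c • z) - g x) (α := η / (16 * G4 m)) byp ?_
  · refine this.trans (le_of_eq ?_); field_simp
  · intro z
    by_cases hz : ‖c • z‖ < δ
    · refine (h x _ hz).le.trans ?_
      have := norm_nonneg z
      exact le_mul_of_one_le_right byp byl
    · push Not at hz
      rw [norm_smul, Real.norm_of_nonneg hc] at hz
      have h1 : |g (x + c • z) - g x| ≤ 2 * B := (abs_sub _ _).trans (by linarith [hB (x + c • z), hB x])
      refine h1.trans ?_
      rw [le_div_iff₀ byp] at hcδ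
      have h2 : (2 * B) * δ ≤ (2 * B + 1) * (c * ‖z‖) := by nlinarith
      have h3 : (2 * B + 1) * (c * ‖z‖) ≤ η / (16 * G4 m) * δ * ‖z‖ := by nlinarith [norm_nonneg z]
      have h4 : 2 * B * δ ≤ (η / (16 * G4 m) * ‖z‖) * δ := by linarith
      have h5 := le_of_mul_le_mul_right h4 hδ
      have : 0 < η / (16 * G4 m) := by positivity
      nlinarith
lemma Qy (hc : 0 ≤ c) (hγ : 0 ≤ γ) (hγ1 : γ ≤ 1) (z : Spc m) : ‖c • z‖ ^ γ ≤ c ^ γ * (1 + ‖z‖) := by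
  rw [norm_smul, Real.norm_of_nonneg hc, Real.mul_rpow hc (norm_nonneg z)]
  gcongr
  calc ‖z‖ ^ γ ≤ (1 + ‖z‖) ^ γ := by gcongr; linarith
    _ ≤ (1 + ‖z‖) ^ (1:ℝ) := Real.rpow_le_rpow_of_exponent_le (by linarith [norm_nonneg z]) hγ1
    _ = _ := Real.rpow_one _

def Hol (γ H : ℝ) (f : FS m) : Prop := ∀ x y, |f (x + y) - f x| ≤ H * ‖y‖ ^ γ
lemma Qz (hf : Measurable f) (hB : ∀ x, |f x| ≤ B) (hH : 0 ≤ H) (hγ : 0 ≤ γ) (hγ1 : γ ≤ 1)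
    (hh : Hol γ H f) (hc : 0 ≤ c) (x : Spc m) : |Ah c f x - f x| ≤ 16 * G4 m * (H * c ^ γ) := by
  rw [Qw hf hB]
  refine Qu Qt byp fun z => (hh _ _).trans ?_
  rw [mul_assoc]; gcongr; exact Qy hc hγ hγ1 z
lemma Ta (hB : ∀ x, |f x| ≤ B) (c : ℝ) (x : Spc m) : |Ah c f x| ≤ 4 * G4 m * B :=
  No Ly c hB x
lemma Tb (hB : ∀ x, |f x| ≤ B) (v : OF m) (hc : 0 < c) (x : Spc m) :
    |Dh v c f x| ≤ 4 * G4 m * B * c⁻¹ := by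
  rw [Dh, abs_mul, aop byp, mul_comm]
  gcongr
  exact No (Lz v) c hB x
lemma Tc {h h' : ℝ → ℝ} {θ : ℝ} (hc : 0 ≤ c) (hθ : θ < 1) (hcont : ContinuousOn h (Icc 0 c))
    (hd : ∀ s ∈ Ioo 0 c, HasDerivAt h (h' s) s) (hb : ∀ s ∈ Ioo 0 c, |h' s| ≤ M * s ^ (-θ)) :
    |h c - h 0| ≤ M / (1 - θ) * c ^ (1 - θ) := by
  have hθ' : 0 < 1 - θ := by linarith
  set P : ℝ → ℝ := fun s => M / (1 - θ) * s ^ (1 - θ) with hP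
  have hPc : ContinuousOn P (Icc 0 c) := (ccm (Real.continuous_rpow_const hθ'.le)).continuousOn
  have hPd : ∀ s ∈ Ioo 0 c, HasDerivAt P (M * s ^ (-θ)) s := by
    intro s hs
    have := (Real.hasDerivAt_rpow_const (x := s) (p := 1 - θ) (Or.inl hs.1.ne')).const_mul (M / (1 - θ))
    refine this.congr_deriv ?_
    have : (1 - θ - 1) = -θ := by ring
    rw [this]; field_simp
  have hP0 : P 0 = 0 := by simp [hP, Real.zero_rpow hθ'.ne']
  have a1 : AntitoneOn (fun s => h s - P s) (Icc 0 c) := by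
    apply antitoneOn_of_deriv_nonpos (convex_Icc 0 c) (hcont.sub hPc)
    · intro s hs; rw [interior_Icc] at hs
      exact ((hd s hs).sub (hPd s hs)).differentiableAt.differentiableWithinAt
    · intro s hs; rw [interior_Icc] at hs
      rw [((hd s hs).sub (hPd s hs)).deriv]
      linarith [(abs_le.1 (hb s hs)).2]
  have a2 : MonotoneOn (fun s => h s + P s) (Icc 0 c) := by
    apply monotoneOn_of_deriv_nonneg (convex_Icc 0 c) (hcont.add hPc)
    · intro s hs; rw [interior_Icc] at hs
      exact ((hd s hs).add (hPd s hs)).differentiableAt.differentiableWithinAt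
    · intro s hs; rw [interior_Icc] at hs
      rw [((hd s hs).add (hPd s hs)).deriv]
      linarith [(abs_le.1 (hb s hs)).1]
  have b1 := a1 (left_mem_Icc.2 hc) (right_mem_Icc.2 hc) hc
  have b2 := a2 (left_mem_Icc.2 hc) (right_mem_Icc.2 hc) hc
  simp only [hP0] at b1 b2
  rw [abs_le]
  constructor <;> simp only [hP] at b1 b2 <;> linarith
lemma Td (hc : 0 < c) (hf : PL f) : ContDiff ℝ 1 (Ah c f) := by
  rw [contDiff_one_iff_fderiv]
  refine ⟨fun x => (Nl hc hf x).differentiableAt, ?_⟩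
  have : fderiv ℝ (Ah c f) = fun x => ∑ v, Dh v c f x • co v := by
    ext1 x; exact (Nl hc hf x).fderiv
  rw [this]
  refine continuous_finsetSum _ fun v _ => ?_
  exact (ccm (Qg (Lz v) hf hc)).smul continuous_const
lemma Te {a : OF m → ℝ} 
    (h : HasFDerivAt g (∑ v, a v • co v) x) (v : OF m) : pdv v g x = a v := by
  unfold pd; rw [h.fderiv]
  simp only [sum_apply, smul_apply, Kc, smul_eq_mul]
  rw [Finset.sum_eq_single v]
  · simp
  · intro w _ hw; simp [hw]
  · simp
lemma Tf (hc : 0 < c) (hf : PL f) (v : OF m) : pdv v (Ah c f) = Dh v c f := by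
  ext x; exact Te (Nl hc hf x) v
lemma Tg (hf : Per f) (c : ℝ) : Per (Ah c f) := Nm _ _ hf
lemma morrey (hp : (m : ℝ) + 1 < p) (hR : 0 < R) : ∃ C : ℝ, 0 < C ∧
    ∀ g : FS m, Per g → Differentiable ℝ g → ∀ B : ℝ, 0 ≤ B → (∀ v, LpN p (pdv v g) ≤ oR B) →
    ∀ c, 0 < c → c ≤ R → ∀ x, |Ah c g x - g x| ≤ C * c ^ (1 - (m + 1) / p) * B := by
  have hm : (0:ℝ) ≤ m := Nat.cast_nonneg m
  have hp1 : 1 < p := by linarith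
  obtain ⟨C, hC, hK⟩ := Nu (m := m) hp1 (R := 2 * R) byl
  set θ : ℝ := (m + 1) / p with hθ
  have hθ0 : 0 < θ := by positivity
  have hθ1 : θ < 1 := by rw [hθ, div_lt_one byl]; exact hp
  have h1θ : 0 < 1 - θ := by linarith
  refine ⟨(m + 1) * (C * 4) / (1 - θ), by positivity, fun g hg hd B hB hgB c hc hcR x => ?_⟩
  have hgPL : PL g := PL.of_cont hg hd.continuous
  have hpm : ∀ v : OF m, Measurable (pdv v g) := fun v => measurable_fderiv_apply_const ℝ g _
  have hpPL : ∀ v : OF m, PL (pdv v g) := fun v =>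
    PL.of_LpN hp1.le (Ql hg _) (hpm v) ((hgB v).trans_lt ofReal_lt_top)
  have key : ∀ ε, 0 < ε → ε ≤ R → |Ah ε (Ah c g) x - Ah ε g x| ≤ (m + 1) * (C * 4 * B) / (1 - θ) * c ^ (1 - θ) := by
    intro ε hε hεR
    have hsw : Ah ε (Ah c g) x = Ah c (Ah ε g) x := by
      have hs : 0 < Real.sqrt (c ^ 2 + ε ^ 2) := Real.sqrt_pos.2 byp
      have hsq : Real.sqrt (c ^ 2 + ε ^ 2) ^ 2 = c ^ 2 + ε ^ 2 := Real.sq_sqrt byp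
      rw [Qb hgPL hε hc hs (by rw [hsq]; ring), Qb hgPL hc hε hs (by rw [hsq])]
    rw [hsw]
    have e0 : Ah ε g x = Ah 0 (Ah ε g) x := by rw [Qq]
    conv_lhs => rw [e0]
    have hder := Qo (Td hε hgPL) (Tg hg ε) x
    refine Tc (h := fun c => Ah c (Ah ε g) x) hc.le hθ1 (fun s _ => (hder s).continuousAt.continuousWithinAt) (fun s _ => hder s) ?_
    intro s hs
    have : ((m:ℝ) + 1) * (C * 4 * B) * s ^ (-θ) = ∑ v : OF m, (C * 4 * B) * s ^ (-θ) := by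
      simp; ring
    rw [this]
    refine (Finset.abs_sum_le_sum_abs _ _).trans (sum_le_sum fun v _ => ?_)
    have e1 : pdv v (Ah ε g) = Ah ε (pdv v g) := by
      rw [Tf hε hgPL]; ext y; exact Qm hd hgPL v (hpPL v) hε y
    set r := Real.sqrt (s ^ 2 + ε ^ 2) with hr
    have hr0 : 0 < r := Real.sqrt_pos.2 (by have := hs.1; positivity)
    have hrsq : s ^ 2 + ε ^ 2 = r ^ 2 := (Real.sq_sqrt byp).symm
    have hsr : s ≤ r := by
      apply Real.le_sqrt_of_sq_le; nlinarith
    have hrR : r ≤ 2 * R := by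
      have h1 := hs.1; have h2 := hs.2
      nlinarith
    have e2 := Qd (hpPL v) hs.1 hε hr0 hrsq v x
    rw [e1]
    have e3 : Kop (fun z => co v z * rho z) s (Ah ε (pdv v g)) x = s / r * Kop (fun z => co v z * rho z) r (pdv v g) x := by
      have hs0 := hs.1
      unfold Dh at e2
      field_simp at e2 ⊢
      linarith
    rw [e3, abs_mul, abs_of_nonneg (by have := hs.1; positivity)]
    have h3 := hK 4 _ (Lz v) r hr0 hrR _ (hpPL v).1 (hpPL v).2.1 B hB (hgB v) x
    calc _ ≤ 1 * (C * 4 * r ^ (-θ) * B) := by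
          gcongr
          · rw [div_le_one hr0]; exact hsr
      _ ≤ C * 4 * s ^ (-θ) * B := by
          rw [one_mul]
          have h5 := Real.rpow_le_rpow_of_nonpos hs.1 hsr (show -θ ≤ 0 by linarith)
          gcongr
      _ = _ := by ring
  apply _root_.le_of_forall_pos_le_add
  intro η hv
  obtain ⟨δ1, hδ1, h1⟩ := Qx (Tg hg c) (Td hc hgPL).continuous (η := η / 2) byp
  obtain ⟨δ2, hδ2, h2⟩ := Qx hg hd.continuous (η := η / 2) byp
  set ε := min R (min δ1 δ2) with hε
  have hε0 : 0 < ε := by positivity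
  have a1 := h1 ε hε0.le ((min_le_right _ _).trans (min_le_left _ _)) x
  have a2 := h2 ε hε0.le ((min_le_right _ _).trans (min_le_right _ _)) x
  have a3 := key ε hε0 (min_le_left _ _)
  have a4 : (m + 1) * (C * 4) / (1 - θ) * c ^ (1 - θ) * B = (m + 1) * (C * 4 * B) / (1 - θ) * c ^ (1 - θ) := by ring
  rw [a4]
  rw [abs_le] at a1 a2 a3 ⊢
  constructor <;> linarith
lemma sobolev (hp : (m : ℝ) + 1 < p) : ∃ C : ℝ, 0 < C ∧
    ∀ g : FS m, Per g → Differentiable ℝ g → ∀ B : ℝ, 0 ≤ B → LpN p g ≤ oR B →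
    (∀ v, LpN p (pdv v g) ≤ oR B) → ∀ x, |g x| ≤ C * B := by
  have hm : (0:ℝ) ≤ m := Nat.cast_nonneg m
  obtain ⟨C, hC, h⟩ := morrey hp (R := 1) one_pos
  obtain ⟨C', hC', h'⟩ := Nu (m := m) (p := p) byl (R := 1) one_pos
  refine ⟨C + C' * 4, by positivity, fun g hg hd B hB hgB hgv x => ?_⟩
  have a1 := h g hg hd B hB hgv 1 one_pos le_rfl x
  have a2 := h' 4 _ Ly 1 one_pos le_rfl g hg hd.continuous.measurable B hB hgB x
  simp only [Real.one_rpow, mul_one] at a1 a2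
  change |Ah 1 g x| ≤ _ at a2
  rw [abs_le] at a1 a2 ⊢
  constructor <;> linarith
lemma Ker2.ker (h : Ker2 K k) : Ker K k :=
  ⟨h.1, fun z => le_trans (le_mul_of_one_le_left (anz _) (by linarith [norm_nonneg z])) (h.2 z)⟩

def kk (w v : OF m) (z : Spc m) : ℝ := (co w z * co v z - if w = v then 1 else 0) * rho z
lemma Th (w v : OF m) : kk (m := m) w v = kk v w := by
  ext z; unfold kk; rw [mul_comm (co w z)]; simp only [eq_comm]
lemma Ti (z : Spc m) : (1 + ‖z‖) ^ 3 * rho z ≤ 256 * gq z := by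
  have h1 : (1 : ℝ) ≤ Real.sqrt (2 * Real.pi) := by
    rw [Real.one_le_sqrt]; nlinarith [Real.pi_gt_three]
  have h2 : (Real.sqrt (2 * Real.pi) ^ (m + 1))⁻¹ ≤ 1 := inv_le_one_of_one_le₀ (one_le_pow₀ h1)
  have h3 : rho z ≤ gau (1 / 2) z := by
    unfold rho; exact mul_le_of_le_one_left (Kw _ _).le h2
  have h4 : gau (1 / 2) z = gq z * gq z := by
    unfold gau; rw [← Real.exp_add]; congr 1; ring
  have h5 : (1 + ‖z‖) ^ 3 * gq z ≤ 256 := by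
    have e : gq z = (Real.exp (1 / 4 * qd z))⁻¹ := by
      unfold gau; rw [← Real.exp_neg]; congr 1; ring
    rw [e, ← div_eq_mul_inv, div_le_iff₀ (Real.exp_pos _)]
    have hq := Kn z
    have hn := norm_nonneg z
    have h6 := Real.quadratic_le_exp_of_nonneg (x := 1 / 4 * qd z) (by nlinarith)
    have h7 : (‖z‖ ^ 2) ^ 2 ≤ qd z ^ 2 := by gcongr
    have h8 : (1 + ‖z‖) ^ 3 ≤ 8 + 8 * (‖z‖ ^ 2) ^ 2 := by
      rcases le_total ‖z‖ 1 with h | h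
      · have : (1 + ‖z‖) ^ 3 ≤ (1 + 1) ^ 3 := by gcongr
        nlinarith [sq_nonneg (‖z‖ ^ 2)]
      · have : (1 + ‖z‖) ^ 3 ≤ (‖z‖ + ‖z‖) ^ 3 := by gcongr
        have : ‖z‖ ^ 3 ≤ ‖z‖ ^ 4 := pow_le_pow_right₀ h byn
        nlinarith
    nlinarith
  calc (1 + ‖z‖) ^ 3 * rho z ≤ (1 + ‖z‖) ^ 3 * (gq z * gq z) := by rw [← h4]; gcongr
    _ = ((1 + ‖z‖) ^ 3 * gq z) * gq z := by ring
    _ ≤ _ := mlr h5 (Kw _ _).le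
lemma Tj (w v : OF m) : Ker2 256 (kk (m := m) w v) :=
  ⟨(((co w).continuous.mul (co v).continuous).sub continuous_const).mul Ld, fun z => by
  unfold kk
  rw [abs_mul, aop (Lb z)]
  refine le_trans ?_ (Ti z)
  have := Lb z
  have hn := norm_nonneg z
  have h1 := Ki v z
  have h2 := Ki w z
  have h3 : |co w z * co v z - if w = v then 1 else 0| ≤ (1 + ‖z‖) ^ 2 := by
    refine (abs_sub _ _).trans ?_
    rw [abs_mul]
    have : |co w z| * |co v z| ≤ ‖z‖ * ‖z‖ := by gcongr
    have : |(if w = v then (1:ℝ) else 0)| ≤ 1 := by split_ifs <;> simp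
    nlinarith
  calc (1 + ‖z‖) * (|co w z * co v z - if w = v then 1 else 0| * rho z)
      ≤ (1 + ‖z‖) * ((1 + ‖z‖) ^ 2 * rho z) := by gcongr
    _ = _ := by ring⟩
lemma Tk (v : OF m) (z : Spc m) :
    HasFDerivAt (fun z : Spc m => co v z * rho z) (-∑ w, kk w v z • co w) z := by
  refine ((co v).hasFDerivAt.mul (Ll z)).congr_fderiv ?_
  refine ContinuousLinearMap.ext fun y => ?_
  simp only [kk, add_apply, smul_apply, neg_apply, sum_apply, smul_eq_mul, sub_mul, sum_sub_distrib, mul_sum]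
  have : ∑ w : OF m, (if w = v then (1:ℝ) else 0) * rho z * co w y = rho z * co v y := by
    rw [Finset.sum_eq_single v]
    · simp
    · intro w _ hw; simp [hw]
    · simp
  rw [this, neg_sub, mul_neg, mul_sum]
  have : ∑ i : OF m, co v z * (co i z * rho z * co i y) = ∑ w : OF m, co w z * co v z * rho z * co w y :=
    sum_congr rfl fun w _ => by ring
  rw [this]; ring

def D2 (w v : OF m) (c : ℝ) (f : FS m) (x : Spc m) : ℝ :=
  c⁻¹ * (c⁻¹ * Kop (kk w v) c f x)
lemma Tl (w v : OF m) (c : ℝ) (f : FS m) : D2 w v c f = D2 v w c f := by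
  ext x; unfold D2; rw [Th]
lemma Tm (hc : 0 < c) (hf : PL f) (v : OF m) (x : Spc m) :
    HasFDerivAt (Dh v c f) (∑ w, D2 w v c f x • co w) x := by
  refine ((Nk (Lz v) (fun w => (Tj w v).ker) (Tk v) hc hf x).const_mul c⁻¹).congr_fderiv ?_
  rw [Finset.smul_sum]
  exact sum_congr rfl fun w _ => by rw [smul_smul]; rfl
lemma Tn (hc : 0 < c) (hf : PL f) (w v : OF m) :
    pdv w (Dh v c f) = D2 w v c f := by
  ext x; exact Te (Tm hc hf v x) w
lemma To (hc : 0 < c) (hf : PL f) (w v : OF m) : Continuous (D2 w v c f) :=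
  ccm (ccm (Qg (Tj w v).ker hf hc))
lemma Tq (hf : PL f) (hc : 0 < c) : PL (Ah c f) := Qi Ly hf hc
lemma Tr (hf : PL f) (ha : 0 < a) (hb : 0 < b) (hs : 0 < s) (h : a ^ 2 + b ^ 2 = s ^ 2)
    (w v : OF m) (x : Spc m) : D2 w v a (Ah b f) x = D2 w v s f x := by
  rw [← Tn ha (Tq hf hb), ← Tn hs hf]
  congr 1; ext y; exact Qd hf ha hb hs h v y
lemma Tt (hf : PL f) (ha : 0 < a) (hb : 0 < b) (hs : 0 < s) (h : a ^ 2 + b ^ 2 = s ^ 2)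
    (w v : OF m) (x : Spc m) : D2 w v s f x = Dh w a (Dh v b f) x := by
  rw [← Tn hs hf, ← Tf ha (Qj hf hb v)]
  congr 1; ext y; exact (Qe hf ha hb hs h v y).symm
lemma Tu (hB : ∀ x, |f x| ≤ B) (w v : OF m) (hc : 0 < c) (x : Spc m) :
    |D2 w v c f x| ≤ 256 * G4 m * B * (c⁻¹ * c⁻¹) := by
  rw [D2, abs_mul, abs_mul, aop byp, ← mul_assoc, mul_comm]
  gcongr
  exact No (Tj w v).ker c hB x
lemma PL.pd1 (hp : Per g) (hg : ContDiff ℝ 1 g) (v : OF m) : PL (pdv v g) :=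
  PL.of_cont (Ql hp _) ((hg.continuous_fderiv byn).clm_apply continuous_const)
lemma Tv (hp : Per g) (hg : ContDiff ℝ 1 g) (v : OF m) (hc : 0 < c) :
    Dh v c g = Ah c (pdv v g) := by
  ext x; exact Qm (hg.differentiable byn) (PL.of_cont hp hg.continuous) v (PL.pd1 hp hg v) hc x
lemma Tw (hp : Per g) (hg : ContDiff ℝ 1 g) (w v : OF m) (hc : 0 < c) :
    D2 w v c g = Dh w c (pdv v g) := by
  rw [← Tn hc (PL.of_cont hp hg.continuous), Tv hp hg v hc, Tf hc (PL.pd1 hp hg v)]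
lemma Tx (hp : Per g) (hg : ContDiff ℝ 1 g) {v : OF m} (hB : ∀ x, |pdv v g x| ≤ B)
    (w : OF m) (hc : 0 < c) (x : Spc m) : |D2 w v c g x| ≤ 4 * G4 m * B * c⁻¹ := by
  rw [Tw hp hg w v hc]; exact Tb hB w hc x
lemma Ty (f : FS m) (x : Spc m) : lap f x = ∑ v : OF m, pdv v (pdv v f) x := by
  rw [Fintype.sum_option]; rfl
lemma Tz (hf : PL f) (hc : 0 < c0) (x : Spc m) :
    HasDerivAt (fun c => Ah c f x) (c0 * ∑ v, D2 v v c0 f x) c0 := by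
  set b := c0 / 2 with hb
  have hb0 : 0 < b := by positivity
  have hpos : 0 < c0 ^ 2 - b ^ 2 := by rw [hb]; nlinarith
  set a := Real.sqrt (c0 ^ 2 - b ^ 2) with ha
  have ha0 : 0 < a := Real.sqrt_pos.2 hpos
  have hsq : a ^ 2 + b ^ 2 = c0 ^ 2 := by rw [ha, Real.sq_sqrt hpos.le]; ring
  have h1 := Qo (Td hb0 hf) (Tg hf.1 b) x a
  have h2 : HasDerivAt (fun c : ℝ => Real.sqrt (c ^ 2 - b ^ 2)) (c0 / a) c0 := by
    have := ((hasDerivAt_pow 2 c0).sub_const (b ^ 2)).sqrt hpos.ne'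
    refine this.congr_deriv ?_
    rw [← ha]; norm_num; field_simp
  have h3 := h1.comp c0 h2
  have h4 : (∑ v, Kop (fun z => co v z * rho z) a (pdv v (Ah b f)) x) * (c0 / a) = c0 * ∑ v, D2 v v c0 f x := by
    rw [sum_mul, mul_sum]
    refine sum_congr rfl fun v _ => ?_
    rw [Tt hf ha0 hb0 hc hsq, Tf hb0 hf, Dh]; field_simp
  rw [h4] at h3
  refine h3.congr_of_eventuallyEq ?_
  filter_upwards [lt_mem_nhds (show b < c0 by rw [hb]; linarith)] with c hcb
  have hpos' : 0 < c ^ 2 - b ^ 2 := by nlinarith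
  refine (Qb hf (Real.sqrt_pos.2 hpos') hb0 (hb0.trans hcb) ?_ x).symm
  rw [Real.sq_sqrt hpos'.le]; ring
lemma Wa (hp : Per g) (hg : ContDiff ℝ 1 g) (hg2 : ∀ v, ContDiff ℝ 1 (pdv v g)) (hc : 0 ≤ c)
    (x : Spc m) (h : ∀ s, 0 ≤ s → s ≤ c → |∑ v, Ah s (pdv v (pdv v g)) x - lap g x| ≤ η) :
    |Ah c g x - g x - c ^ 2 / 2 * lap g x| ≤ c ^ 2 * η := by
  have hv : 0 ≤ η := (anz _).trans (h 0 le_rfl hc)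
  have := Tc (h := fun c => Ah c g x - c ^ 2 / 2 * lap g x) (h' := fun s => s * (∑ v, Ah s (pdv v (pdv v g)) x - lap g x))
    (c := c) (M := c * η) (θ := 0) hc zero_lt_one ?_ ?_ ?_
  · simp only [Qq] at this
    norm_num at this
    have e : Ah c g x - g x - c ^ 2 / 2 * lap g x = Ah c g x - c ^ 2 / 2 * lap g x - g x := by ring
    rw [e]; refine this.trans (le_of_eq (by ring))
  · exact fun s _ => (((Qo hg hp x s).continuousAt).sub byf).continuousWithinAt
  · intro s hs
    have e1 := Tz (PL.of_cont hp hg.continuous) hs.1 x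
    have e2 := ((hasDerivAt_pow 2 s).div_const 2).mul_const (lap g x)
    refine (e1.sub e2).congr_deriv ?_
    have : ∀ v, D2 v v s g x = Ah s (pdv v (pdv v g)) x := fun v => by
      rw [Tw hp hg v v hs.1, Tv (Ql hp _) (hg2 v) v hs.1]
    simp only [this]; norm_num; ring
  · intro s hs
    rw [abs_mul, aop hs.1]; simp only [neg_zero, Real.rpow_zero, mul_one]
    have := h s hs.1.le hs.2.le
    have := hs.1; have := hs.2
    gcongr

def sc (β t : ℝ) : ℝ := Real.sqrt (2 * t / β)
lemma Wb (hj : 0 < β) (ht : 0 < t) : 0 < sc β t := Real.sqrt_pos.2 byp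
lemma Wc (β t : ℝ) : 0 ≤ sc β t := Real.sqrt_nonneg _
lemma Wd (hj : 0 < β) (ht : 0 ≤ t) : sc β t ^ 2 = 2 * t / β := Real.sq_sqrt byp
lemma We (β : ℝ) : sc β 0 = 0 := by simp [sc]
lemma Wf (β : ℝ) : Continuous (sc β) := by unfold sc; fun_prop
lemma Wg (hj : 0 < β) (h : s ≤ t) : sc β s ≤ sc β t := by unfold sc; gcongr
lemma Wh (hj : 0 < β) (hs : 0 ≤ s) (ht : 0 ≤ t) : sc β s ^ 2 + sc β t ^ 2 = sc β (s + t) ^ 2 := by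
  rw [Wd hj hs, Wd hj ht, Wd hj byl]; ring
lemma Wi (hj : 0 < β) (ht : 0 ≤ t) (e : ℝ) : sc β t ^ e = (2 / β) ^ (e / 2) * t ^ (e / 2) := by
  rw [sc, Real.sqrt_eq_rpow, ← Real.rpow_mul byp, ← Real.mul_rpow byp ht]; congr 1 <;> ring
lemma Wj (hj : 0 < β) (ht : 0 < t) : HasDerivAt (sc β) (1 / (β * sc β t)) t := by
  have h : HasDerivAt (fun t : ℝ => 2 * t / β) (2 / β) t := by
    simpa using ((hasDerivAt_id t).const_mul 2).div_const β
  have := h.sqrt byp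
  refine this.congr_deriv ?_
  change _ / (2 * sc β t) = _
  have := Wb hj ht
  field_simp
lemma Wk (hj : 0 < β) (hf : PL f) (ht : 0 < t) (x : Spc m) :
    HasDerivAt (fun t => Ah (sc β t) f x) (β⁻¹ * ∑ v, D2 v v (sc β t) f x) t := by
  have hs := Wb hj ht
  refine ((Tz hf hs x).comp t (Wj hj ht)).congr_deriv ?_
  field_simp
lemma Wl (hj : 0 < β) (t : ℝ) (f : FS m) (x : Spc m) : heatSG β t f x = Ah (sc β t) f x := by
  unfold heatSG
  split_ifs with ht
  · have : sc β t = 0 := Real.sqrt_eq_zero_of_nonpos (div_nonpos_of_nonpos_of_nonneg byl hj.le)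
    rw [this, Qq]
  · push Not at ht
    have hs := Wb hj ht
    have hq := Wd hj ht.le
    rw [Ah, Nf _ hs, ← icm]
    congr 1; ext y
    rw [← mul_assoc]; congr 1
    unfold rho
    rw [← mul_assoc]
    congr 1
    · have e : 4 * Real.pi * (t / β) = (Real.sqrt (2 * Real.pi) * sc β t) ^ 2 := by
        rw [mul_pow, Real.sq_sqrt byp, hq]; ring
      rw [e, ← Real.rpow_natCast _ 2, ← Real.rpow_mul byp, ← mul_inv, ← mul_pow, mul_comm (sc β t), ← Real.rpow_natCast, ← Real.rpow_neg byp]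
      congr 1; push_cast; ring
    · unfold gau
      congr 1
      rw [Kr, inv_pow, hq, ← neg_sub, Kt]; field_simp; ring

structure LC (p : ℝ) (S : Set ℝ) (B : ℝ) (f : ℝ → FS m) : Prop where
  per : ∀ s ∈ S, Per (f s)
  meas : ∀ s ∈ S, Measurable (f s)
  nn : 0 ≤ B
  bdd : ∀ s ∈ S, LpN p (f s) ≤ oR B
  cont : ∀ s ∈ S, ∀ ε > 0, ∃ δ > 0, ∀ s' ∈ S, |s' - s| < δ → LpN p (fun x => f s' x - f s x) ≤ oR ε
lemma LC.mono {S' : Set ℝ} {f : ℝ → FS m} (h : LC p S B f) (hS : S' ⊆ S) : LC p S' B f :=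
  ⟨fun s hs => h.per s (hS hs), fun s hs => h.meas s (hS hs), h.nn, fun s hs => h.bdd s (hS hs), fun s hs ε hε => by
    obtain ⟨δ, hδ, h'⟩ := h.cont s (hS hs) ε hε
    exact ⟨δ, hδ, fun s' ho => h' s' (hS ho)⟩⟩
lemma LC.pl (hp : 1 ≤ p) {f : ℝ → FS m} (h : LC p S B f) (hs : s ∈ S) : PL (f s) :=
  PL.of_LpN hp (h.per s hs) (h.meas s hs) ((h.bdd s hs).trans_lt ofReal_lt_top)
lemma Per.sub (hf : Per f) (hg : Per g) : Per (fun x => f x - g x) :=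
  fun x k j => by dsimp only; rw [hf x k j, hg x k j]
lemma Per.add (hf : Per f) (hg : Per g) : Per (fun x => f x + g x) :=
  fun x k j => by dsimp only; rw [hf x k j, hg x k j]
lemma Per.mul (hf : Per f) (hg : Per g) : Per (fun x => f x * g x) :=
  fun x k j => by dsimp only; rw [hf x k j, hg x k j]
lemma Wm (hk : Ker K k) (hc : 0 < c) (hf : PL f) (hg : PL g) (x : Spc m) :
    Kop k c (fun x => f x + g x) x = Kop k c f x + Kop k c g x := by
  unfold Kop; simp_rw [mul_add]
  exact integral_add (Ni hk hc hf x) (Ni hk hc hg x)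
lemma Wn (hk : Ker K k) (hc : 0 < c) (hf : PL f) (hg : PL g) (x : Spc m) :
    Kop k c (fun x => f x - g x) x = Kop k c f x - Kop k c g x := by
  unfold Kop; simp_rw [mul_sub]
  exact integral_sub (Ni hk hc hf x) (Ni hk hc hg x)
lemma Wo (hp : 1 < p) {f : ℝ → FS m} (hf : LC p S B f) (hk : Ker K k) :
    ContinuousOn (fun q : ℝ × ℝ × Spc m => Kop k q.2.1 (f q.1) q.2.2) (S ×ˢ {q | 0 < q.1}) := by
  rintro ⟨s0, c0, x0⟩ ⟨hs0 : s0 ∈ S, (hc0 : 0 < c0)⟩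
  obtain ⟨C, hC, hL⟩ := Nu (m := m) hp (R := 2 * c0) byp
  have h1 : ContinuousAt (fun q : ℝ × Spc m => Kop k q.1 (f s0) q.2) (c0, x0) :=
    (Nj hk (hf.pl hp.le hs0)).continuousAt ((isOpen_lt continuous_const continuous_fst).mem_nhds hc0)
  rw [Metric.continuousWithinAt_iff]
  intro ε hε
  obtain ⟨δ1, hδ1, h2⟩ := Metric.continuousAt_iff.1 h1 (ε / 2) byp
  set L : ℝ := C * K * (c0 / 2) ^ (-((m + 1) / p) : ℝ) with hLdef
  have hK := hk.nonneg
  have hL0 : 0 ≤ L := by positivity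
  obtain ⟨δ2, hδ2, h3⟩ := hf.cont s0 hs0 (ε / (4 * (L + 1))) byp
  refine ⟨min δ1 (min δ2 (c0 / 2)), by positivity, ?_⟩
  rintro ⟨s, c, x⟩ ⟨hs : s ∈ S, (hc : 0 < c)⟩ hd
  rw [Prod.dist_eq, max_lt_iff] at hd
  have hd1 : |s - s0| < δ2 := (dist_eq s s0 ▸ hd.1).trans_le ((min_le_right _ _).trans (min_le_left _ _))
  have hd2 : dist (c, x) (c0, x0) < δ1 := hd.2.trans_le (min_le_left _ _)
  have hd3 : |c - c0| < c0 / 2 := by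
    have := hd.2
    rw [Prod.dist_eq, max_lt_iff] at this
    exact (dist_eq c c0 ▸ this.1).trans_le ((min_le_right _ _).trans (min_le_right _ _))
  have a1 := h2 hd2
  have a2 := hL K k hk c hc (by linarith [(abs_lt.1 hd3).2]) _ ((hf.per s hs).sub (hf.per s0 hs0)) ((hf.meas s hs).sub (hf.meas s0 hs0)) _ byp (h3 s hs hd1) x
  rw [Wn hk hc (hf.pl hp.le hs) (hf.pl hp.le hs0)] at a2
  have a3 : C * K * c ^ (-((m + 1) / p) : ℝ) ≤ L := by
    have := Real.rpow_le_rpow_of_nonpos (show 0 < c0 / 2 by positivity) (show c0 / 2 ≤ c by linarith [(abs_lt.1 hd3).1])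
      (show (-((m + 1) / p) : ℝ) ≤ 0 by simp; positivity)
    rw [hLdef]; gcongr
  have a4 : L * (ε / (4 * (L + 1))) < ε / 2 := by
    rw [mul_div_assoc', div_lt_iff₀ byp]; nlinarith
  have a5 := a2.trans (mlr a3 byp)
  rw [dist_eq] at a1 ⊢
  dsimp only at a1 ⊢
  calc _ = |(Kop k c (f s) x - Kop k c (f s0) x) + (Kop k c (f s0) x - Kop k c0 (f s0) x0)| := by ring_nf
    _ ≤ _ := abs_add_le _ _
    _ < ε := by linarith
lemma Wq (hj : 0 < β) (hp : 1 < p) {f : ℝ → FS m} (hf : LC p S B f) (hk : Ker K k)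
    (t : ℝ) : ContinuousOn (fun q : ℝ × Spc m => Kop k (sc β (t - q.1)) (f q.1) q.2) ((S ∩ Iio t) ×ˢ univ) := by
  refine (Wo hp hf hk).comp (f := fun q : ℝ × Spc m => (q.1, sc β (t - q.1), q.2)) ?_ ?_
  · exact (continuous_fst.prodMk (((Wf β).comp byf).prodMk continuous_snd)).continuousOn
  · rintro ⟨s, x⟩ ⟨⟨hs, ho⟩, -⟩
    exact ⟨hs, Wb hj (sp2 ho)⟩
lemma Wr (hj : 0 < β) (hp : 1 < p) {f : ℝ → FS m} (hf : LC p S B f) (hk : Ker K k)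
    (t : ℝ) (x : Spc m) : ContinuousOn (fun s => Kop k (sc β (t - s)) (f s) x) (S ∩ Iio t) :=
  (Wq hj hp hf hk t).comp (f := fun s => (s, x)) byf fun s hs => ⟨hs, mem_univ _⟩
lemma Wt (hj : 0 < β) (S : Set ℝ) : ContinuousOn (fun s => (sc β (t - s))⁻¹) (S ∩ Iio t) :=
  ContinuousOn.inv₀ ((Wf β).comp byf).continuousOn fun s hs => (Wb hj (sp2 hs.2)).ne'
lemma Wu (hj : 0 < β) (hp : 1 < p) {f : ℝ → FS m} (hf : LC p S B f) (v : OF m)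
    (t : ℝ) (x : Spc m) : ContinuousOn (fun s => Dh v (sc β (t - s)) (f s) x) (S ∩ Iio t) :=
  (Wt hj S).mul (Wr hj hp hf (Lz v) t x)
lemma Wv (hj : 0 < β) (hp : 1 < p) {f : ℝ → FS m} (hf : LC p S B f) (w v : OF m)
    (t : ℝ) (x : Spc m) : ContinuousOn (fun s => D2 w v (sc β (t - s)) (f s) x) (S ∩ Iio t) :=
  (Wt hj S).mul ((Wt hj S).mul (Wr hj hp hf (Tj w v).ker t x))
lemma Ww (hj : 0 < β) (hp : 1 < p) (hb : 0 < b) : ∃ C : ℝ, 0 < C ∧ ∀ τ, 0 < τ → τ ≤ b →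
    ∀ f : FS m, Per f → Measurable f → ∀ B, 0 ≤ B → LpN p f ≤ oR B → ∀ x,
      |Ah (sc β τ) f x| ≤ C * τ ^ (-((m + 1) / p / 2) : ℝ) * B ∧ ∀ v, |Dh v (sc β τ) f x| ≤ C * τ ^ (-(1 / 2) - (m + 1) / p / 2 : ℝ) * B := by
  obtain ⟨C, hC, hL⟩ := Nu (m := m) hp (Wb hj hb)
  set θ : ℝ := (m + 1) / p
  have h2β : 0 < 2 / β := by positivity
  refine ⟨C * 4 * (2 / β) ^ (-θ / 2) + C * 4 * (2 / β) ^ ((-1 - θ) / 2), by positivity, fun τ hτ hτb f hf hfm B hB hfB x => ⟨?_, fun v => ?_⟩⟩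
  · refine (hL 4 rho Ly (sc β τ) (Wb hj hτ) (Wg hj hτb) f hf hfm B hB hfB x).trans ?_
    rw [Wi hj hτ.le, neg_div]
    have : 0 ≤ C * 4 * (2 / β) ^ ((-1 - θ) / 2) * τ ^ (-(θ / 2)) * B := by positivity
    rw [add_mul, add_mul]
    nlinarith
  · have h := hL 4 _ (Lz v) (sc β τ) (Wb hj hτ) (Wg hj hτb) f hf hfm B hB hfB x
    have hs := Wb hj hτ
    rw [Dh, abs_mul, aop byp]
    have e : (sc β τ)⁻¹ * (C * 4 * sc β τ ^ (-θ) * B) = C * 4 * (2 / β) ^ ((-1 - θ) / 2) * τ ^ (-(1/2) - θ / 2) * B := by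
      have e1 : (sc β τ)⁻¹ * sc β τ ^ (-θ) = (2 / β) ^ ((-1 - θ) / 2) * τ ^ (-(1/2) - θ / 2) := by
        rw [← Real.rpow_neg_one, ← Real.rpow_add hs, Wi hj hτ.le]
        congr 2 <;> ring
      linear_combination (C * 4 * B) * e1
    calc _ ≤ (sc β τ)⁻¹ * (C * 4 * sc β τ ^ (-θ) * B) := by gcongr
      _ = _ := e
      _ ≤ _ := by
        have : 0 ≤ C * 4 * (2 / β) ^ (-θ / 2) * τ ^ (-(1/2) - θ / 2) * B := by positivity
        rw [add_mul, add_mul]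
        nlinarith
lemma Wx (hat : a ≤ t) (he : -1 < e) : IntegrableOn (fun s => (t - s) ^ e) (Ioo a t) ∧
    ∫ s in Ioo a t, (t - s) ^ e = (t - a) ^ (e + 1) / (e + 1) := by
  have h1 : IntervalIntegrable (fun s => (t - s) ^ e) volume a t := by
    have := (intervalIntegral.intervalIntegrable_rpow' (a := t - a) (b := t - t) he).comp_sub_left t
    simpa using this
  have h2 : ∫ s in a..t, (t - s) ^ e = (t - a) ^ (e + 1) / (e + 1) := by
    rw [intervalIntegral.integral_comp_sub_left (fun s => s ^ e), integral_rpow (Or.inl he)]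
    rw [sub_self, Real.zero_rpow byl, sub_zero]
  rw [intervalIntegral.integral_of_le hat, integral_Ioc_eq_integral_Ioo] at h2
  exact ⟨((intervalIntegrable_iff_integrableOn_Ioo_of_le hat).1 h1), h2⟩
lemma Wy (hat : a ≤ t) (he : -1 < e) {g : ℝ → ℝ} (hg : ContinuousOn g (Ioo a t))
    (hb : ∀ s ∈ Ioo a t, |g s| ≤ C * (t - s) ^ e) : IntegrableOn g (Ioo a t) ∧ |∫ s in Ioo a t, g s| ≤ C * ((t - a) ^ (e + 1) / (e + 1)) := by
  obtain ⟨h1, h2⟩ := Wx hat he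
  have hb' : ∀ᵐ s ∂(volume.restrict (Ioo a t)), ‖g s‖ ≤ C * (t - s) ^ e := by
    filter_upwards [self_mem_ae_restrict measurableSet_Ioo] with s hs using hb s hs
  refine ⟨(h1.const_mul C).mono' (hg.aestronglyMeasurable measurableSet_Ioo) hb', ?_⟩
  rw [← h2, ← icm]
  exact norm_integral_le_of_norm_le (h1.const_mul C) hb'

def U (β a t : ℝ) (f : ℝ → FS m) (x : Spc m) : ℝ := ∫ s in Ioo a t, Ah (sc β (t - s)) (f s) x
def Uv (β a t : ℝ) (f : ℝ → FS m) (v : OF m) (x : Spc m) : ℝ := ∫ s in Ioo a t, Dh v (sc β (t - s)) (f s) x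
lemma Wz (ha : a ≤ a') (ht : t ≤ b) : Ioo a' t ⊆ Icc a b ∩ Iio t :=
  fun s hs => ⟨⟨ha.trans hs.1.le, hs.2.le.trans ht⟩, hs.2⟩

section
variable {f : ℝ → FS m}
lemma Xa (hp : (m : ℝ) + 1 < p) : (0:ℝ) < (m + 1) / p ∧ ((m:ℝ) + 1) / p < 1 ∧ 1 < p := by
  have hm : (0:ℝ) ≤ m := Nat.cast_nonneg m
  have : 0 < p := by linarith
  exact ⟨by positivity, by rw [div_lt_one this]; exact hp, by linarith⟩
lemma Xb (hf : LC p (Icc a b) B f) (har : a ≤ r) (ht : t ≤ b) : Per (U β r t f) := by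
  intro x k j
  refine setIntegral_congr_fun measurableSet_Ioo fun s hs => ?_
  exact Tg (hf.per s ⟨har.trans hs.1.le, hs.2.le.trans ht⟩) _ x k j
lemma Xc (hj : 0 < β) (hp : (m : ℝ) + 1 < p) (hb : 0 < b) : ∃ C : ℝ, 0 < C ∧ ∀ (a r t B : ℝ) (f : ℝ → FS m), 0 ≤ a →
    LC p (Icc a b) B f → a ≤ r → r ≤ t → t ≤ b → ∀ x, |U β r t f x| ≤ C * B ∧ ∀ v, |Uv β r t f v x| ≤ C * B := by
  obtain ⟨hθ0, hθ1, hp1⟩ := Xa hp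
  obtain ⟨C, hC, h⟩ := Ww (m := m) hj hp1 hb
  set θ : ℝ := (m + 1) / p
  have q1 : 0 < -(θ/2) + 1 := by linarith
  have q2 : 0 < -(1/2) - θ/2 + 1 := by linarith
  refine ⟨C * (b ^ (-(θ/2) + 1) / (-(θ/2) + 1)) + C * (b ^ (-(1/2) - θ/2 + 1) / (-(1/2) - θ/2 + 1)), by positivity, ?_⟩
  intro a r t B f ha hf har hrt htb x
  have hB := hf.nn
  have hs : ∀ s ∈ Ioo r t, s ∈ Icc a b ∧ 0 < t - s ∧ t - s ≤ b := fun s hs =>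
    ⟨⟨by linarith [hs.1], by linarith [hs.2]⟩, by linarith [hs.2], by linarith [hs.1]⟩
  have htr : t - r ≤ b := by linarith
  constructor
  · refine (Wy hrt (e := -(θ/2)) (C := C * B) byl ((Wr hj hp1 hf Ly t x).mono (Wz har htb)) ?_).2.trans ?_
    · intro s ho
      obtain ⟨h1, h2, h3⟩ := hs s ho
      refine ((h _ h2 h3 (f s) (hf.per s h1) (hf.meas s h1) B hB (hf.bdd s h1) x).1).trans (le_of_eq (by ring))
    · rw [add_mul]
      have : 0 ≤ C * (b ^ (-(1/2) - θ/2 + 1) / (-(1/2) - θ/2 + 1)) * B := by positivity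
      have : (t - r) ^ (-(θ/2) + 1) ≤ b ^ (-(θ/2) + 1) := Real.rpow_le_rpow byl htr q1.le
      calc _ ≤ C * B * (b ^ (-(θ/2) + 1) / (-(θ/2) + 1)) := by gcongr
        _ ≤ _ := by linarith
  · intro v
    refine (Wy hrt (e := -(1/2) - θ/2) (C := C * B) byl ((Wu hj hp1 hf v t x).mono (Wz har htb)) ?_).2.trans ?_
    · intro s ho
      obtain ⟨h1, h2, h3⟩ := hs s ho
      refine ((h _ h2 h3 (f s) (hf.per s h1) (hf.meas s h1) B hB (hf.bdd s h1) x).2 v).trans (le_of_eq (by ring))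
    · rw [add_mul]
      have : 0 ≤ C * (b ^ (-(θ/2) + 1) / (-(θ/2) + 1)) * B := by positivity
      have : (t - r) ^ (-(1/2) - θ/2 + 1) ≤ b ^ (-(1/2) - θ/2 + 1) := Real.rpow_le_rpow byl htr q2.le
      calc _ ≤ C * B * (b ^ (-(1/2) - θ/2 + 1) / (-(1/2) - θ/2 + 1)) := by gcongr
        _ ≤ _ := by linarith
lemma Xd (hj : 0 < β) (hp : (m : ℝ) + 1 < p) (ha : 0 ≤ a) (hf : LC p (Icc a b) B f) (har : a ≤ r) (hrt : r ≤ t) (htb : t ≤ b) (x : Spc m) :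
    IntegrableOn (fun s => Ah (sc β (t - s)) (f s) x) (Ioo r t) := by
  rcases hrt.eq_or_lt with rfl | hrt'
  · simp
  obtain ⟨hθ0, hθ1, hp1⟩ := Xa hp
  have hb : 0 < b := by linarith
  obtain ⟨C, hC, h⟩ := Ww (m := m) hj hp1 hb
  refine (Wy hrt (e := -((m + 1) / p / 2)) (C := C * B) byl ((Wr hj hp1 hf Ly t x).mono (Wz har htb)) ?_).1
  intro s hs
  have h1 : s ∈ Icc a b := ⟨by linarith [hs.1], by linarith [hs.2]⟩
  exact ((h (t - s) (by linarith [hs.2]) (by linarith [hs.1]) (f s) (hf.per s h1) (hf.meas s h1) B hf.nn (hf.bdd s h1) x).1).trans (le_of_eq (by ring))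
lemma Xe (hj : 0 < β) (hp : (m : ℝ) + 1 < p) (ha : 0 ≤ a) (hf : LC p (Icc a b) B f) (har : a ≤ r) (hrt : r ≤ t) (htb : t ≤ b) (x : Spc m) :
    HasFDerivAt (U β r t f) (∑ v, Uv β r t f v x • co v) x := by
  rcases hrt.eq_or_lt with rfl | hrt'
  · have : U β r r f = fun _ => 0 := by ext x; simp [U]
    rw [this]; simpa [Uv] using hasFDerivAt_const (0:ℝ) x
  obtain ⟨hθ0, hθ1, hp1⟩ := Xa hp
  have hb : 0 < b := by linarith
  obtain ⟨C, hC, h⟩ := Ww (m := m) hj hp1 hb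
  have hs : ∀ s ∈ Ioo r t, s ∈ Icc a b ∧ 0 < t - s ∧ t - s ≤ b := fun s hs =>
    ⟨⟨by linarith [hs.1], by linarith [hs.2]⟩, by linarith [hs.2], by linarith [hs.1]⟩
  have hbd : ∀ s ∈ Ioo r t, ∀ x v, |Dh v (sc β (t - s)) (f s) x| ≤ C * B * (t - s) ^ (-(1 / 2) - (m + 1) / p / 2 : ℝ) := by
    intro s ho x v
    obtain ⟨h1, h2, h3⟩ := hs s ho
    exact ((h _ h2 h3 (f s) (hf.per s h1) (hf.meas s h1) B hf.nn (hf.bdd s h1) x).2 v).trans (le_of_eq (by ring))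
  have hint : ∀ v, IntegrableOn (fun s => Dh v (sc β (t - s)) (f s) x) (Ioo r t) := fun v =>
    (Wy hrt byl ((Wu hj hp1 hf v t x).mono (Wz har htb)) (fun s hs => hbd s hs x v)).1
  have key := hasFDerivAt_integral_of_dominated_of_fderiv_le (μ := volume.restrict (Ioo r t)) (𝕜 := ℝ)
    (F := fun x s => Ah (sc β (t - s)) (f s) x)
    (F' := fun x s => ∑ v, Dh v (sc β (t - s)) (f s) x • co v)
    (x₀ := x) (s := Set.univ)
    (bound := fun s => ∑ v : OF m, C * B * (t - s) ^ (-(1 / 2) - (m + 1) / p / 2 : ℝ)) univ_mem ?_ ?_ ?_ ?_ ?_ ?_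
  · refine key.congr_fderiv ?_
    rw [integral_finsetSum]
    · exact sum_congr rfl fun v _ => integral_smul_const _ _
    · exact fun v _ => (hint v).smul_const _
  · exact evf fun x => (Xd hj hp ha hf har hrt htb x).aestronglyMeasurable
  · exact Xd hj hp ha hf har hrt htb x
  · exact Finset.aestronglyMeasurable_fun_sum _ fun v _ => ((hint v).smul_const _).aestronglyMeasurable
  · filter_upwards [self_mem_ae_restrict measurableSet_Ioo] with s hs x _
    refine norm_sum_le_of_le _ fun v _ => ?_
    rw [norm_smul]
    exact (mul_le_of_le_one_right (norm_nonneg _) (Kk v)).trans (hbd s hs x v)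
  · exact integrable_finsetSum _ fun v _ => (Wx hrt byl).1.const_mul _
  · filter_upwards [self_mem_ae_restrict measurableSet_Ioo] with s ho x _
    obtain ⟨h1, h2, h3⟩ := hs s ho
    exact Nl (Wb hj h2) (hf.pl hp1.le h1) x
lemma Xf (hj : 0 < β) (hp : (m : ℝ) + 1 < p) (ha : 0 ≤ a) (hf : LC p (Icc a b) B f) (har : a ≤ r) (hrt : r ≤ t) (htb : t ≤ b) :
    Continuous (U β r t f) :=
  continuous_iff_continuousAt.2 fun x => (Xe hj hp ha hf har hrt htb x).continuousAt
lemma Xg (hj : 0 < β) (hp : (m : ℝ) + 1 < p) (ha : 0 ≤ a) (hf : LC p (Icc a b) B f) (har : a ≤ r) (hrt : r ≤ t) (htb : t ≤ b) :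
    PL (U β r t f) := PL.of_cont (Xb hf har htb) (Xf hj hp ha hf har hrt htb)
lemma Xh (hj : 0 < β) (hp : (m : ℝ) + 1 < p) (ha : 0 ≤ a) (hf : LC p (Icc a b) B f) (har : a ≤ r) (hrt : r ≤ t) (htb : t ≤ b)
    (hk : Ker K k) (c : ℝ) (x : Spc m) :
    Kop k c (U β r t f) x = ∫ s in Ioo r t, Kop k c (Ah (sc β (t - s)) (f s)) x := by
  rcases hrt.eq_or_lt with rfl | hrt'
  · simp [Kop, U]
  obtain ⟨hθ0, hθ1, hp1⟩ := Xa hp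
  have hb : 0 < b := by linarith
  obtain ⟨C, hC, h⟩ := Ww (m := m) hj hp1 hb
  unfold Kop U
  simp_rw [← icm]
  refine integral_integral_swap (μ := volume) (ν := volume.restrict (Ioo r t)) (f := fun z s => k z * Ah (sc β (t - s)) (f s) (x + c • z)) ?_
  refine Integrable.mono' (hk.int.norm.mul_prod ((Wx (e := -((m + 1) / p / 2)) hrt byl).1.const_mul (C * B))) ?_ ?_
  · have : (volume : Measure (Spc m)).prod (volume.restrict (Ioo r t)) = (volume.prod volume).restrict (univ ×ˢ Ioo r t) := by
      rw [← Measure.prod_restrict, Measure.restrict_univ]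
    rw [this]
    refine ContinuousOn.aestronglyMeasurable ?_ (MeasurableSet.univ.prod measurableSet_Ioo)
    refine (hk.1.comp continuous_fst).continuousOn.mul ?_
    refine (Wq hj hp1 hf Ly t).comp (f := fun q : Spc m × ℝ => (q.2, x + c • q.1)) byf ?_
    rintro ⟨z, s⟩ ⟨-, hs⟩
    exact ⟨Wz har htb hs, mem_univ _⟩
  · have : ∀ᵐ q ∂((volume : Measure (Spc m)).prod (volume.restrict (Ioo r t))), q.2 ∈ Ioo r t :=
      Measure.quasiMeasurePreserving_snd.ae (self_mem_ae_restrict measurableSet_Ioo)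
    filter_upwards [this] with q hq
    have h1 : q.2 ∈ Icc a b := ⟨by linarith [hq.1], by linarith [hq.2]⟩
    have := ((h (t - q.2) (by linarith [hq.2]) (by linarith [hq.1]) (f q.2) (hf.per _ h1) (hf.meas _ h1) B hf.nn (hf.bdd _ h1) (x + c • q.1)).1)
    simp only [Function.uncurry]
    rw [norm_mul]
    refine mll (this.trans (le_of_eq (by ring))) (norm_nonneg _)
lemma Xi (hj : 0 < β) (hp : (m : ℝ) + 1 < p) (ha : 0 ≤ a) (hf : LC p (Icc a b) B f) (har : a ≤ r) (hrt : r ≤ t) (htb : t ≤ b)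
    (hτ : 0 < τ) (x : Spc m) : Ah (sc β τ) (U β r t f) x = ∫ s in Ioo r t, Ah (sc β (t + τ - s)) (f s) x := by
  rw [Ah, Xh hj hp ha hf har hrt htb Ly]
  refine setIntegral_congr_fun measurableSet_Ioo fun s hs => ?_
  have h1 : s ∈ Icc a b := ⟨by linarith [hs.1], by linarith [hs.2]⟩
  have h2 : 0 < t - s := by linarith [hs.2]
  refine Qb (hf.pl (Xa hp).2.2.le h1) (Wb hj hτ) (Wb hj h2) (Wb hj byl) ?_ x
  rw [Wh hj hτ.le h2.le]; congr 2; ring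
lemma Xj (hj : 0 < β) (hp : (m : ℝ) + 1 < p) (ha : 0 ≤ a) (hf : LC p (Icc a b) B f) (har : a ≤ r) (hrt : r ≤ t) (htb : t ≤ b)
    (hτ : 0 < τ) (w v : OF m) (x : Spc m) : D2 w v (sc β τ) (U β r t f) x = ∫ s in Ioo r t, D2 w v (sc β (t + τ - s)) (f s) x := by
  rw [D2, Xh hj hp ha hf har hrt htb (Tj w v).ker, ← icm, ← icm]
  refine setIntegral_congr_fun measurableSet_Ioo fun s hs => ?_
  have h1 : s ∈ Icc a b := ⟨by linarith [hs.1], by linarith [hs.2]⟩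
  have h2 : 0 < t - s := by linarith [hs.2]
  refine Tr (hf.pl (Xa hp).2.2.le h1) (Wb hj hτ) (Wb hj h2) (Wb hj byl) ?_ w v x
  rw [Wh hj hτ.le h2.le]; congr 2; ring
lemma restart (hj : 0 < β) (hp : (m : ℝ) + 1 < p) (ha : 0 ≤ a) (hf : LC p (Icc a b) B f) (h0 : PL (ψ a))
    (hm : ∀ t ∈ Icc a b, ∀ x, ψ t x = Ah (sc β (t - a)) (ψ a) x + U β a t f x) (har : a ≤ r) (hrt : r < t) (htb : t ≤ b) (x : Spc m) :
    ψ t x = Ah (sc β (t - r)) (ψ r) x + U β r t f x := by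
  rcases har.eq_or_lt with rfl | har'
  · exact hm t ⟨hrt.le, htb⟩ x
  have h1 : ψ r = fun x => Ah (sc β (r - a)) (ψ a) x + U β a r f x := by
    ext x; exact hm r ⟨har, by linarith⟩ x
  have hs1 := Wb hj (sp2 hrt)
  have hs2 := Wb hj (sp2 har')
  rw [hm t ⟨by linarith, htb⟩ x, h1]
  have e1 : Ah (sc β (t - r)) (fun x => Ah (sc β (r - a)) (ψ a) x + U β a r f x) x = Ah (sc β (t - r)) (Ah (sc β (r - a)) (ψ a)) x + Ah (sc β (t - r)) (U β a r f) x :=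
    Wm Ly hs1 (Tq h0 hs2) (Xg hj hp ha hf le_rfl har byl) x
  rw [e1, Qb h0 hs1 hs2 (Wb hj (show 0 < t - a by linarith)) (by rw [Wh hj byl byl]; congr 2; ring),
    Xi hj hp ha hf le_rfl har byl (sp2 hrt)]
  rw [add_assoc]; congr 1
  have e2 : r + (t - r) = t := by ring
  rw [e2]; unfold U
  have hi := Xd hj hp ha hf le_rfl (show a ≤ t by linarith) htb x
  have e3 : ∫ s in Ioo r t, Ah (sc β (t - s)) (f s) x = ∫ s in Ico r t, Ah (sc β (t - s)) (f s) x := (integral_Ico_eq_integral_Ioo).symm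
  rw [e3, ← Ioo_union_Ico_eq_Ioo har' hrt.le, setIntegral_union]
  · exact Set.disjoint_left.2 fun s hs ho => absurd ho.1 (not_le.2 hs.2)
  · exact measurableSet_Ico
  · exact hi.mono_set fun s hs => ⟨hs.1, hs.2.trans hrt⟩
  · exact hi.mono_set fun s hs => ⟨har'.trans_le hs.1, hs.2⟩
end

def avg (g : FS m) (x : Spc m) : ℝ := ∫ y in cube1 m, g (x.1, y)

instance prob_1 (m : ℕ) : IsProbabilityMeasure (volume.restrict (cube1 m)) := ⟨by
  rw [Measure.restrict_apply_univ, cube1, volume_pi_pi]; simp⟩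
lemma Xk (hg : Measurable g) : Measurable (avg g) := by
  have : Measurable fun x1 : ℝ => ∫ y in cube1 m, g (x1, y) :=
    (hg.stronglyMeasurable.integral_prod_right' (ν := volume.restrict (cube1 m))).measurable
  exact this.comp measurable_fst
lemma Xl (hg : Per g) : Per (avg g) := by
  intro x k j
  unfold avg
  congr 1; ext y
  have := hg (x.1, y) k 0
  simpa using this
lemma PL.intOn (hg : PL g) {s : Set (Spc m)} (hs : Bornology.IsBounded s) : IntegrableOn g s := by
  obtain ⟨R, hR⟩ := hs.subset_closedBall 0
  have h1 : IntegrableOn g (Metric.closedBall 0 R) := by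
    have h := Na hg one_pos 0
    simp only [zero_add] at h
    have hc : ContinuousOn (fun w : Spc m => (gau 1 w)⁻¹) (Metric.closedBall 0 R) :=
      (Continuous.inv₀ (Kx 1) fun w => (Kw 1 w).ne').continuousOn
    have := h.integrableOn.continuousOn_mul hc (isCompact_closedBall 0 R)
    refine this.congr_fun (fun w _ => ?_) measurableSet_closedBall
    dsimp only; rw [← mul_assoc, inv_mul_cancel₀ (Kw 1 w).ne', one_mul]
  exact h1.mono_set hR
lemma Xm (m : ℕ) (a b : ℝ) : Bornology.IsBounded (Ioc a b ×ˢ cube1 m) := by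
  refine Bornology.IsBounded.prod (Metric.isBounded_Ioc a b) (Bornology.IsBounded.pi fun i => Metric.isBounded_Ico 0 1)
lemma PL.strip (hg : PL g) (a b : ℝ) :
    Integrable g ((volume.restrict (Ioc a b)).prod (volume.restrict (cube1 m))) := by
  rw [Measure.prod_restrict]; exact hg.intOn (Xm m a b)
lemma PL.fiber (hg : PL g) : ∀ᵐ x : Spc m, IntegrableOn (fun y => g (x.1, y)) (cube1 m) := by
  have h1 : ∀ᵐ x1 : ℝ, IntegrableOn (fun y => g (x1, y)) (cube1 m) := by
    have h : ∀ n : ℕ, ∀ᵐ x1 : ℝ, x1 ∈ Ioc (-(n:ℝ)) n → IntegrableOn (fun y => g (x1, y)) (cube1 m) := fun n =>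
      (ae_restrict_iff' measurableSet_Ioc).1 (hg.strip (-n) n).prod_right_ae
    filter_upwards [ae_all_iff.2 h] with x hx
    obtain ⟨n, hn⟩ := exists_nat_gt |x|
    exact hx n ⟨by linarith [neg_abs_le x], by linarith [le_abs_self x]⟩
  exact Measure.quasiMeasurePreserving_fst.ae h1
lemma Xn (hp : Per h) (hd : Differentiable ℝ h) (hi : PL (pdo m h)) :
    ∀ᵐ x : Spc m, HasDerivAt (fun x1 => ∫ y in cube1 m, h (x1, y)) (avg (pdo m h) x) x.1 := by
  set g := pdo m h with hg
  set J : ℝ → ℝ := fun x1 => ∫ y in cube1 m, g (x1, y) with hJ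
  have hJi : ∀ a b, IntervalIntegrable J volume a b := fun a b => by
    rw [intervalIntegrable_iff, uIoc]; exact (hi.strip _ _).integral_prod_left
  have hpl : PL h := PL.of_cont hp hd.continuous
  have hfi : ∀ x1, IntegrableOn (fun y => h (x1, y)) (cube1 m) := fun x1 => by
    have : ContinuousOn (fun y => h (x1, y)) (Icc 0 1) := (hd.continuous.comp byf).continuousOn
    refine (this.integrableOn_compact isCompact_Icc).mono_set fun y hy => ?_
    exact ⟨fun i => (hy i (mem_univ i)).1, fun i => (hy i (mem_univ i)).2.le⟩
  have key : ∀ a b, a ≤ b → ∫ x1 in a..b, J x1 = (∫ y in cube1 m, h (b, y)) - ∫ y in cube1 m, h (a, y) := by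
    intro a b hab
    rw [intervalIntegral.integral_of_le hab, hJ, integral_integral_swap (f := fun x1 y => g (x1, y)) (hi.strip a b), ← integral_sub (hfi b) (hfi a)]
    refine integral_congr_ae ?_
    filter_upwards [(hi.strip a b).prod_left_ae] with y hy
    rw [← intervalIntegral.integral_of_le hab]
    refine intervalIntegral.integral_eq_sub_of_hasDerivAt (f := fun x1 => h (x1, y)) (fun x1 _ => ?_) ((intervalIntegrable_iff_integrableOn_Ioc_of_le hab).2 hy)
    exact (hd (x1, y)).hasFDerivAt.comp_hasDerivAt x1 ((hasDerivAt_id x1).prodMk (hasDerivAt_const x1 y))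
  have h1 : ∀ᵐ x1 : ℝ, HasDerivAt (fun x1 => ∫ y in cube1 m, h (x1, y)) (J x1) x1 := by
    have hloc : LocallyIntegrable J volume := by
      intro x
      refine ⟨Ioc (x - 1) (x + 1), Ioc_mem_nhds byl byl, (intervalIntegrable_iff_integrableOn_Ioc_of_le byl).1 (hJi _ _)⟩
    filter_upwards [LocallyIntegrable.ae_hasDerivAt_integral hloc] with x hx
    have := (hx 0).const_add (∫ y in cube1 m, h (0, y))
    refine this.congr_of_eventuallyEq (evf fun b => ?_)
    dsimp only
    rcases le_total 0 b with hb | hb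
    · rw [key 0 b hb]; ring
    · rw [intervalIntegral.integral_symm, key b 0 hb]; ring
  exact Measure.quasiMeasurePreserving_fst.ae h1

structure W1 (ψ : FS m) : Prop where
  per : Per ψ
  diff : Differentiable ℝ ψ
  pl : ∀ v, PL (pdv v ψ)

def Gop (V ψ : FS m) (x : Spc m) : ℝ :=
  gradDot V ψ x + lap V x * ψ x -
    (((avg ψ x)⁻¹ * ψ x) * avg (fun z => pdo m (pdo m V) z * ψ z + pdo m V z * pdo m ψ z) x
      - ((avg ψ x)⁻¹ * (avg ψ x)⁻¹ * (avg (fun z => pdo m V z * ψ z) x * ψ x)) * avg (pdo m ψ) x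
      + ((avg ψ x)⁻¹ * avg (fun z => pdo m V z * ψ z) x) * pdo m ψ x)

section
lemma Xo (hV : ContDiff ℝ 2 V) (v : Spc m) : ContDiff ℝ 1 (pd v V) :=
  (hV.fderiv_right (m := 1) byn).clm_apply contDiff_const
lemma Xq (hV : ContDiff ℝ 2 V) (v w : Spc m) : Continuous (pd w (pd v V)) :=
  ((Xo hV v).continuous_fderiv byn).clm_apply continuous_const
lemma Xr (hV : ContDiff ℝ 2 V) : Continuous (lap V) := by
  have : lap V = fun x => ∑ v : OF m, pdv v (pdv v V) x := by ext x; exact Ty V x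
  rw [this]; exact continuous_finsetSum _ fun v _ => Xq hV _ _
lemma Xt (hf : Per f) : Per (lap f) := by
  intro x k j
  simp only [Ty]
  exact sum_congr rfl fun v _ => Ql (Ql hf _) _ x k j
lemma Xu (f g : FS m) (x : Spc m) : gradDot f g x = ∑ v : OF m, pdv v f x * pdv v g x := by
  rw [Fintype.sum_option]; rfl
lemma Xv (hVp : Per V) {ψ : FS m} (hψ : Per ψ) : Per (Gop V ψ) := by
  have e1' := Ql hψ (e1 m)
  have v1 := Ql hVp (e1 m)
  have v2 := Ql v1 (e1 m)
  have hM := Xl hψ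
  have hA := Xl (v1.mul hψ)
  have hA1 := Xl ((v2.mul hψ).add (v1.mul e1'))
  have hM1 := Xl e1'
  have hg : Per (gradDot V ψ) := by
    intro x k j; simp only [Xu]
    exact sum_congr rfl fun v _ => ((Ql hVp (ev v)).mul (Ql hψ (ev v))) x k j
  have hl := Xt hVp
  intro x k j
  unfold Gop
  rw [hg x k j, hl x k j, hψ x k j, hM x k j, hA x k j, hA1 x k j, hM1 x k j, e1' x k j]
lemma Xw (f : FS m) (v : Spc m) : Measurable (pd v f) := measurable_fderiv_apply_const ℝ f v
lemma Xx (V ψ : FS m) (hm : Measurable ψ) : Measurable (Gop V ψ) := by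
  have h1 := Xw ψ (e1 m)
  have v1 := Xw V (e1 m)
  have v2 := Xw (pdo m V) (e1 m)
  have hM := Xk hm
  have hA := Xk (v1.mul hm)
  have hA1 := Xk ((v2.mul hm).add (v1.mul h1))
  have hM1 := Xk h1
  have hg : Measurable (gradDot V ψ) :=
    ((v1.mul h1).add (Finset.measurable_sum _ fun i _ => (Xw V _).mul (Xw ψ _)))
  have hl : Measurable (lap V) := v2.add (Finset.measurable_sum _ fun i _ => Xw _ _)
  exact (hg.add (hl.mul hm)).sub ((((hM.inv.mul hm).mul hA1).sub ((((hM.inv.mul hM.inv).mul (hA.mul hm))).mul hM1)).add ((hM.inv.mul hA).mul h1))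
lemma PL.mul_cont (hf : Continuous f) (hfp : Per f) (hg : PL g) : PL (fun x => f x * g x) := by
  obtain ⟨B, hB0, hB⟩ := Qh hfp hf
  refine ⟨hfp.mul hg.1, hf.measurable.mul hg.2.1, ?_⟩
  have : Integrable (fun x => f x * g x) (μT m) := hg.congr_int.bdd_mul hf.aestronglyMeasurable (evf hB)
  exact this.2
lemma PL.add' (hf : PL f) (hg : PL g) : PL (fun x => f x + g x) :=
  ⟨hf.1.add hg.1, hf.2.1.add hg.2.1, (hf.congr_int.add hg.congr_int).2⟩
lemma Xy (hV : ContDiff ℝ 2 V) (hVp : Per V) {ψ : FS m} (hψ : W1 ψ) (hM : ∀ x1, 0 < marg ψ x1) :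
    ∀ᵐ x, Fop V ψ x = Gop V ψ x := by
  have hV1 := Xo hV (e1 m)
  have hV1p := Ql hVp (e1 m)
  have hd : Differentiable ℝ (fun z => pdo m V z * ψ z) := (hV1.differentiable byn).mul hψ.diff
  have hpd : pdo m (fun z => pdo m V z * ψ z) = fun z => pdo m (pdo m V) z * ψ z + pdo m V z * pdo m ψ z := by
    ext z
    have := ((hV1.differentiable byn z).hasFDerivAt.mul (hψ.diff z).hasFDerivAt).fderiv
    unfold pd at this ⊢
    change fderiv ℝ ((fun x => fderiv ℝ V x (e1 m)) * ψ) z (e1 m) = _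
    rw [this]
    simp; ring
  have hpl : PL (pdo m (fun z => pdo m V z * ψ z)) := by
    rw [hpd]
    exact (PL.mul_cont (Xq hV _ _) (Ql hV1p _) (PL.of_cont hψ.per hψ.diff.continuous)).add' (PL.mul_cont hV1.continuous hV1p (hψ.pl none))
  filter_upwards [Xn (hV1p.mul hψ.per) hd hpl, Xn hψ.per hψ.diff (hψ.pl none)] with x h1 h2
  have hMx := (hM x.1).ne'
  rw [hpd] at h1
  have h3 := h1.div h2 hMx
  have h4 : HasFDerivAt (fun z : Spc m => phiF V ψ z.1) _ x := h3.comp_hasFDerivAt x (hasFDerivAt_fst (𝕜 := ℝ) (p := x))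
  have h5 := (h4.mul (hψ.diff x).hasFDerivAt).fderiv
  unfold Fop Gop
  congr 1
  have h6 : pdo m (fun z => phiF V ψ z.1 * ψ z) x = _ := congrArg (fun L => L (e1 m)) h5
  rw [h6]
  simp only [add_apply, smul_apply, smul_eq_mul, ContinuousLinearMap.coe_fst', e1]
  simp only [phiF, marg, avg, pd, ev, e1] at hMx ⊢
  field_simp
  ring
end

def Bp (R d a b : ℝ) : Prop := |a| ≤ R ∧ |b| ≤ R ∧ |a - b| ≤ R * d
lemma Bp.mul {S b' : ℝ} (h : Bp R d a b) (h' : Bp S d a' b') : Bp (2 * R * S) d (a * a') (b * b') := by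
  obtain ⟨h1, h2, h3⟩ := h
  obtain ⟨h4, h5, h6⟩ := h'
  have hR : 0 ≤ R := (anz _).trans h1
  have hS : 0 ≤ S := (anz _).trans h4
  have hRS : 0 ≤ R * S := by positivity
  refine ⟨?_, ?_, ?_⟩
  · rw [abs_mul]; nlinarith [mul_le_mul h1 h4 (anz _) hR]
  · rw [abs_mul]; nlinarith [mul_le_mul h2 h5 (anz _) hR]
  · calc |a * a' - b * b'| = |a * (a' - b') + (a - b) * b'| := by ring_nf
      _ ≤ |a * (a' - b')| + |(a - b) * b'| := abs_add_le _ _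
      _ = |a| * |a' - b'| + |a - b| * |b'| := by rw [abs_mul, abs_mul]
      _ ≤ R * (S * d) + (R * d) * S := by
          gcongr; exact (anz _).trans h3
      _ = _ := by ring
lemma Bp.mulU {u u' S : ℝ} (h : Bp R d a b) (h1 : |u'| ≤ S) (h2 : |u - u'| ≤ r) :
    |a * u - b * u'| ≤ R * (r + d * S) := by
  obtain ⟨h3, h4, h5⟩ := h
  have hR : 0 ≤ R := (anz _).trans h3
  calc |a * u - b * u'| = |a * (u - u') + (a - b) * u'| := by ring_nf
    _ ≤ |a * (u - u')| + |(a - b) * u'| := abs_add_le _ _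
    _ = |a| * |u - u'| + |a - b| * |u'| := by rw [abs_mul, abs_mul]
    _ ≤ R * r + (R * d) * S := by gcongr; exact (anz _).trans h5
    _ = _ := by ring

section
def gg (χ : FS m) (x : Spc m) : ℝ := (∑ v, |pdv v χ x|) + avg (fun z => |pdo m χ z|) x
lemma Xz (hK : ∀ x, |h x| ≤ K) (x : Spc m) : |avg h x| ≤ K := by
  have := norm_integral_le_of_norm_le_const (μ := volume.restrict (cube1 m)) (f := fun y => h (x.1, y)) (C := K) (evf fun y => hK _)
  rw [probReal_univ, mul_one] at this; exact this
lemma Ya (h : FS m) (x : Spc m) : |avg h x| ≤ avg (fun z => |h z|) x :=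
  abs_integral_le_integral_abs (f := fun y => h (x.1, y))
lemma Yb (x : Spc m) (hk : IntegrableOn (fun y => k (x.1, y)) (cube1 m)) (h0 : ∀ z, |h z| ≤ k z) : |avg h x| ≤ avg k x := by
  refine norm_integral_le_of_norm_le (f := fun y => h (x.1, y)) hk (evf fun y => h0 _)
lemma Yc (hc : Continuous h) (x : Spc m) : IntegrableOn (fun y => h (x.1, y)) (cube1 m) := by
  have : ContinuousOn (fun y => h (x.1, y)) (Icc 0 1) := (hc.comp byf).continuousOn
  refine (this.integrableOn_compact isCompact_Icc).mono_set fun y hy => ?_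
  exact ⟨fun i => (hy i (mem_univ i)).1, fun i => (hy i (mem_univ i)).2.le⟩
lemma Yd (x : Spc m) (hh : IntegrableOn (fun y => h (x.1, y)) (cube1 m)) (hk : IntegrableOn (fun y => k (x.1, y)) (cube1 m)) :
    avg (fun z => h z - k z) x = avg h x - avg k x := integral_sub hh hk
lemma Ye (x : Spc m) (hh : IntegrableOn (fun y => h (x.1, y)) (cube1 m)) (hk : IntegrableOn (fun y => k (x.1, y)) (cube1 m)) :
    avg (fun z => h z + k z) x = avg h x + avg k x := integral_add hh hk
lemma Yf (χ : FS m) (x : Spc m) : 0 ≤ gg χ x :=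
  add_nonneg (sum_nonneg fun _ _ => anz _) (integral_nonneg fun _ => anz _)
lemma Yg {ψ : FS m} (h1 : Differentiable ℝ ψ) (h2 : Differentiable ℝ χ) (v : Spc m) (x : Spc m) :
    pd v (fun x => ψ x - χ x) x = pd v ψ x - pd v χ x := by
  unfold pd; rw [fderiv_fun_sub (h1 x) (h2 x)]; rfl
lemma Yh (hV : ContDiff ℝ 2 V) (hVp : Per V) : ∃ K, 1 ≤ K ∧ ∀ x, (∀ v, |pdv v V x| ≤ K) ∧ (∀ v w, |pdv w (pdv v V) x| ≤ K) ∧ |lap V x| ≤ K := by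
  choose K1 h1 h1' using fun v : OF m => Qh (Ql hVp (ev v)) (Xo hV (ev v)).continuous
  choose K2 h2 h2' using fun v w : OF m => Qh (Ql (Ql hVp (ev v)) (ev w)) (Xq hV (ev v) (ev w))
  obtain ⟨K3, h3, h3'⟩ := Qh (Xt hVp) (Xr hV)
  have i1 : ∀ v, K1 v ≤ ∑ v, K1 v := fun v => single_le_sum (fun i _ => h1 i) (Finset.mem_univ v)
  have i2 : ∀ v w, K2 v w ≤ ∑ v, ∑ w, K2 v w := fun v w =>
    (single_le_sum (fun i _ => h2 v i) (Finset.mem_univ w)).trans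
      (single_le_sum (f := fun v => ∑ w, K2 v w) (fun i _ => sum_nonneg fun j _ => h2 i j) (Finset.mem_univ v))
  have n1 := sum_nonneg fun i (_ : i ∈ Finset.univ) => h1 i
  have n2 := sum_nonneg fun i (_ : i ∈ Finset.univ) => sum_nonneg fun j (_ : j ∈ Finset.univ) => h2 i j
  refine ⟨1 + ∑ v, K1 v + ∑ v, ∑ w, K2 v w + K3, by linarith, fun x => ⟨fun v => ?_, fun v w => ?_, ?_⟩⟩
  · linarith [h1' v x, i1 v]
  · linarith [h2' v w x, i2 v w]
  · linarith [h3' x]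

set_option maxHeartbeats 1000000 in
lemma Yi (hV : ContDiff ℝ 2 V) (hVp : Per V) {m0 : ℝ} (hB : 0 ≤ B) (hm0 : 0 < m0) : ∃ C : ℝ, 0 < C ∧
    ∀ ψ χ : FS m, W1 ψ → W1 χ → (∀ x, |ψ x| ≤ B) → (∀ x, |χ x| ≤ B) → (∀ x, m0 ≤ avg ψ x) → (∀ x, m0 ≤ avg χ x) →
    ∀ d, (∀ x, |ψ x - χ x| ≤ d) → ∀ x, IntegrableOn (fun y => pdo m ψ (x.1, y)) (cube1 m) → IntegrableOn (fun y => pdo m χ (x.1, y)) (cube1 m) →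
    |Gop V ψ x - Gop V χ x| ≤ C * (d * (1 + gg χ x) + gg (fun x => ψ x - χ x) x) := by
  obtain ⟨K, hK1, hK⟩ := Yh hV hVp
  set i0 := m0⁻¹ with hi0
  have hi : 0 < i0 := by positivity
  set R : ℝ := 1 + B + K * B + K + i0 + i0 * i0 with hR
  have hKB : 0 ≤ K * B := by positivity
  have hii : 0 < i0 * i0 := by positivity
  have hR1 : 1 ≤ R := by linarith
  refine ⟨2 * R + (2 * R * R) * (2 * R) + (2 * (2 * R * R) * (2 * R * R)) * (2 * R) + (2 * R * R) * (2 * R), by positivity, fun ψ χ hψ hχ hψB hχB hψM hχM d hd x hfψ hfχ => ?_⟩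
  have hd0 : 0 ≤ d := (anz _).trans (hd x)
  have cψ := hψ.diff.continuous
  have cχ := hχ.diff.continuous
  have cV1 : Continuous (pdo m V) := (Xo hV (e1 m)).continuous
  have cV2 : Continuous (pdo m (pdo m V)) := Xq hV _ _
  have hV1 : ∀ z, |pdo m V z| ≤ K := fun z => (hK z).1 none
  have hV2 : ∀ z, |pdo m (pdo m V) z| ≤ K := fun z => (hK z).2.1 none none
  set g := gg χ x with hg
  set e := gg (fun x => ψ x - χ x) x with he
  have g0 : 0 ≤ g := Yf _ _
  have e0 : 0 ≤ e := Yf _ _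
  have hee : (∑ v, |pdv v ψ x - pdv v χ x|) + avg (fun z => |pdo m ψ z - pdo m χ z|) x = e := by
    rw [he, gg]; simp only [Yg hψ.diff hχ.diff]
  have hav0 : 0 ≤ avg (fun z => |pdo m ψ z - pdo m χ z|) x := integral_nonneg fun _ => anz _
  have hav1 : 0 ≤ avg (fun z => |pdo m χ z|) x := integral_nonneg fun _ => anz _
  have hs0 : 0 ≤ ∑ v, |pdv v ψ x - pdv v χ x| := sum_nonneg fun _ _ => anz _
  have hs1 : 0 ≤ ∑ v, |pdv v χ x| := sum_nonneg fun _ _ => anz _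
  have hgd : (∑ v, |pdv v χ x|) + avg (fun z => |pdo m χ z|) x = g := rfl
  set E := d * (1 + g) + e with hE
  have hdE : d ≤ E := by nlinarith
  have heE : e ≤ E := by nlinarith
  have hE0 : 0 ≤ E := hd0.trans hdE
  have b1 : Bp R d (ψ x) (χ x) := ⟨by linarith [hψB x], by linarith [hχB x], (hd x).trans (le_mul_of_one_le_left hd0 hR1)⟩
  have dM : |avg ψ x - avg χ x| ≤ d := by
    rw [← Yd x (Yc cψ x) (Yc cχ x)]; exact Xz hd x
  have Mp : 0 < avg ψ x := hm0.trans_le (hψM x)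
  have Mc : 0 < avg χ x := hm0.trans_le (hχM x)
  have iψ : (avg ψ x)⁻¹ ≤ i0 := inv_anti₀ hm0 (hψM x)
  have iχ : (avg χ x)⁻¹ ≤ i0 := inv_anti₀ hm0 (hχM x)
  have b2 : Bp R d (avg ψ x)⁻¹ (avg χ x)⁻¹ := by
    refine ⟨by rw [aop byp]; linarith, by rw [aop byp]; linarith, ?_⟩
    have : (avg ψ x)⁻¹ - (avg χ x)⁻¹ = (avg ψ x)⁻¹ * (avg χ x)⁻¹ * (avg χ x - avg ψ x) := by field_simp
    rw [this, abs_mul, aop byp, abs_sub_comm]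
    have h1 : (avg ψ x)⁻¹ * (avg χ x)⁻¹ ≤ R := (mul_le_mul iψ iχ byp hi.le).trans byl
    exact mul_le_mul h1 dM (anz _) byl
  have hprod : ∀ {χ' : FS m} {D : ℝ}, (∀ x, |χ' x| ≤ D) → ∀ z, |pdo m V z * χ' z| ≤ K * D := fun h z => by
    rw [abs_mul]; exact mul_le_mul (hV1 z) (h z) (anz _) byl
  have b3 : Bp R d (avg (fun z => pdo m V z * ψ z) x) (avg (fun z => pdo m V z * χ z) x) := by
    refine ⟨(Xz (hprod hψB) x).trans byl, (Xz (hprod hχB) x).trans byl, ?_⟩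
    rw [← Yd (h := fun z => pdo m V z * ψ z) (k := fun z => pdo m V z * χ z) x (Yc (cV1.mul cψ) x) (Yc (cV1.mul cχ) x)]
    refine (Xz (K := K * d) (fun z => ?_) x).trans (mlr byl hd0)
    rw [← mul_sub]; exact hprod hd z
  have u1 : |pdo m χ x| ≤ 1 + g := by
    have := single_le_sum (f := fun v => |pdv v χ x|) (fun i _ => anz _) (Finset.mem_univ none)
    have h2 : |pdo m χ x| ≤ ∑ v, |pdv v χ x| := this
    linarith
  have u1' : |pdo m ψ x - pdo m χ x| ≤ E := by
    have := single_le_sum (f := fun v => |pdv v ψ x - pdv v χ x|) (fun i _ => anz _) (Finset.mem_univ none)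
    have h2 : |pdo m ψ x - pdo m χ x| ≤ ∑ v, |pdv v ψ x - pdv v χ x| := this
    linarith
  have u2 : |avg (pdo m χ) x| ≤ 1 + g := (Ya _ x).trans byl
  have u2' : |avg (pdo m ψ) x - avg (pdo m χ) x| ≤ E := by
    rw [← Yd x hfψ hfχ]; exact (Ya _ x).trans byl
  have fV : ∀ {h : FS m}, IntegrableOn (fun y => h (x.1, y)) (cube1 m) → IntegrableOn (fun y => pdo m V (x.1, y) * h (x.1, y)) (cube1 m) := fun hh =>
    hh.bdd_mul (cV1.comp byf).aestronglyMeasurable (evf fun y => hV1 _)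
  have hd1 : ∀ z, |pdo m ψ z - pdo m χ z| ≤ |pdo m ψ z - pdo m χ z| := fun z => le_rfl
  have u3 : |avg (fun z => pdo m (pdo m V) z * χ z + pdo m V z * pdo m χ z) x| ≤ R * (1 + g) := by
    have h1 : |avg (fun z => pdo m (pdo m V) z * χ z) x| ≤ K * B := Xz (fun z => by
      rw [abs_mul]; exact mul_le_mul (hV2 z) (hχB z) (anz _) byl) x
    have h2 : |avg (fun z => pdo m V z * pdo m χ z) x| ≤ avg (fun z => K * |pdo m χ z|) x :=
      Yb x (hfχ.abs.const_mul K) (fun z => by rw [abs_mul]; exact mlr (hV1 z) (anz _))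
    have h3 : avg (fun z => K * |pdo m χ z|) x = K * avg (fun z => |pdo m χ z|) x := icm _ _
    rw [Ye (h := fun z => pdo m (pdo m V) z * χ z) (k := fun z => pdo m V z * pdo m χ z) x (Yc (cV2.mul cχ) x) (fV hfχ)]
    refine (abs_add_le _ _).trans ?_
    rw [h3] at h2
    have h4 : K * avg (fun z => |pdo m χ z|) x ≤ R * g := mul_le_mul byl byl hav1 byl
    linarith
  have u3' : |avg (fun z => pdo m (pdo m V) z * ψ z + pdo m V z * pdo m ψ z) x - avg (fun z => pdo m (pdo m V) z * χ z + pdo m V z * pdo m χ z) x| ≤ R * E := by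
    rw [Ye (h := fun z => pdo m (pdo m V) z * χ z) (k := fun z => pdo m V z * pdo m χ z) x (Yc (cV2.mul cχ) x) (fV hfχ), Ye (h := fun z => pdo m (pdo m V) z * ψ z) (k := fun z => pdo m V z * pdo m ψ z) x (Yc (cV2.mul cψ) x) (fV hfψ), add_sub_add_comm,
      ← Yd (h := fun z => pdo m (pdo m V) z * ψ z) (k := fun z => pdo m (pdo m V) z * χ z) x (Yc (cV2.mul cψ) x) (Yc (cV2.mul cχ) x), ← Yd (h := fun z => pdo m V z * pdo m ψ z) (k := fun z => pdo m V z * pdo m χ z) x (fV hfψ) (fV hfχ)]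
    simp only [← mul_sub]
    have h1 : |avg (fun z => pdo m (pdo m V) z * (ψ z - χ z)) x| ≤ K * d := Xz (fun z => by
      rw [abs_mul]; exact mul_le_mul (hV2 z) (hd z) (anz _) byl) x
    have h2 : |avg (fun z => pdo m V z * (pdo m ψ z - pdo m χ z)) x| ≤ avg (fun z => K * |pdo m ψ z - pdo m χ z|) x :=
      Yb x ((hfψ.sub hfχ).abs.const_mul K) (fun z => by rw [abs_mul]; exact mlr (hV1 z) (anz _))
    have h3 : avg (fun z => K * |pdo m ψ z - pdo m χ z|) x = K * avg (fun z => |pdo m ψ z - pdo m χ z|) x := icm _ _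
    refine (abs_add_le _ _).trans ?_
    rw [h3] at h2
    have h4 : K * (d + e) ≤ R * E := mul_le_mul byl (by nlinarith) byp byl
    nlinarith
  have T1 := (b2.mul b1).mulU u3 u3'
  have T2 := ((b2.mul b2).mul (b3.mul b1)).mulU u2 u2'
  have T3 := (b2.mul b3).mulU u1 u1'
  have hdw : d * (1 + g) ≤ E := by linarith
  have T4 : |gradDot V ψ x - gradDot V χ x| ≤ R * E := by
    rw [Xu, Xu, ← sum_sub_distrib]
    refine (Finset.abs_sum_le_sum_abs _ _).trans ?_
    calc _ ≤ ∑ v, K * |pdv v ψ x - pdv v χ x| := sum_le_sum fun v _ => by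
          rw [← mul_sub, abs_mul]; exact mlr ((hK x).1 v) (anz _)
      _ = K * ∑ v, |pdv v ψ x - pdv v χ x| := by rw [mul_sum]
      _ ≤ R * E := mul_le_mul byl byl hs0 byl
  have T5 : |lap V x * ψ x - lap V x * χ x| ≤ R * E := by
    rw [← mul_sub, abs_mul]
    exact mul_le_mul ((hK x).2.2.trans byl) ((hd x).trans hdE) (anz _) byl
  clear_value R E g e
  have hRE : E ≤ R * E := le_mul_of_one_le_left hE0 hR1
  have hRw := mll hdw (by linarith : 0 ≤ R)
  have q1 : (2 * R * R) * (R * E + d * (R * (1 + g))) ≤ (2 * R * R) * (2 * R) * E := by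
    rw [mul_assoc (2 * R * R)]; refine mll ?_ byp; linarith
  have q2 : (2 * (2 * R * R) * (2 * R * R)) * (E + d * (1 + g)) ≤ (2 * (2 * R * R) * (2 * R * R)) * (2 * R) * E := by
    rw [mul_assoc (2 * (2 * R * R) * (2 * R * R))]; refine mll ?_ byp; linarith
  have q3 : (2 * R * R) * (E + d * (1 + g)) ≤ (2 * R * R) * (2 * R) * E := by
    rw [mul_assoc (2 * R * R)]; refine mll ?_ byp; linarith
  have hsplit : ∀ a b c u1 u2 u3 a' b' c' w1 w2 w3 : ℝ, |a + b - (c - u1 + u2) - (a' + b' - (c' - w1 + w2))| ≤ |a - a'| + |b - b'| + |c - c'| + |u1 - w1| + |u2 - w2| := by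
    intro a b c u1 u2 u3 a' b' c' w1 w2 w3
    have e1 : a + b - (c - u1 + u2) - (a' + b' - (c' - w1 + w2)) = (a - a') + (b - b') - (c - c') + (u1 - w1) - (u2 - w2) := by ring
    rw [e1]
    exact (abs_sub _ _).trans (by gcongr; exact (abs_add_le _ _).trans (by gcongr; exact (abs_sub _ _).trans (by gcongr; exact abs_add_le _ _)))
  unfold Gop
  refine (hsplit _ _ _ _ _ 0 _ _ _ _ _ 0).trans ?_
  linarith [T1, T2, T3, T4, T5, q1, q2, q3]
lemma Yj (hp : 1 ≤ p) (hm : Measurable h) : LpN p (avg (fun z => |h z|)) ≤ LpN p h := by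
  have hp0 : 0 < p := by linarith
  rw [Nt hp0, Nt hp0]
  refine ENNReal.rpow_le_rpow ?_ byp
  have hc : (volume.restrict (cube m) : Measure (Spc m)) = (volume.restrict (Ico (0:ℝ) 1)).prod (volume.restrict (cube1 m)) := by
    rw [Measure.prod_restrict]; rfl
  rw [hc, lintegral_prod _ ((Xk hm.abs).enorm.pow_const p).aemeasurable, lintegral_prod _ (hm.enorm.pow_const p).aemeasurable]
  refine lintegral_mono fun x1 => ?_
  have h1 : ∀ y : Fin m → ℝ, ‖avg (fun z => |h z|) (x1, y)‖ₑ ^ p ≤ ∫⁻ y in cube1 m, ‖h (x1, y)‖ₑ ^ p := fun y => by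
    have h2 : ‖avg (fun z => |h z|) (x1, y)‖ₑ ≤ eLpNorm (fun y => h (x1, y)) 1 (volume.restrict (cube1 m)) := by
      rw [eLpNorm_one_eq_lintegral_enorm]
      refine (enorm_integral_le_lintegral_enorm _).trans (le_of_eq ?_)
      simp only [← norm_eq_abs, enorm_norm]
    have h3 := h2.trans (eLpNorm_le_eLpNorm_of_exponent_le (q := oR p) (by simpa using hp) (hm.comp measurable_prodMk_left).aestronglyMeasurable)
    rw [eLpNorm_eq_lintegral_rpow_enorm_toReal (by simpa using hp0) ofReal_ne_top, ENNReal.toReal_ofReal hp0.le] at h3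
    refine (ENNReal.rpow_le_rpow h3 hp0.le).trans (le_of_eq ?_)
    rw [← ENNReal.rpow_mul, one_div, inv_mul_cancel₀ hp0.ne', ENNReal.rpow_one]
  refine (lintegral_mono h1).trans ?_
  simp
lemma Yk (hp : 1 ≤ p) (hB : 0 ≤ B) (h : ∀ v, LpN p (pdv v χ) ≤ oR B) :
    LpN p (gg χ) ≤ oR ((m + 2) * B) := by
  have hp' : (1 : ℝ≥0∞) ≤ oR p := by simpa using hp
  have h1 : LpN p (fun x => ∑ v, |pdv v χ x|) ≤ ∑ v : OF m, oR B := by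
    have := eLpNorm_sum_le (μ := μT m) (s := Finset.univ) (f := fun (v : OF m) x => |pdv v χ x|) (fun v _ => (Xw χ (ev v)).abs.aestronglyMeasurable) hp'
    refine (le_of_eq ?_).trans (this.trans (sum_le_sum fun v _ => ?_))
    · unfold LpN; congr 1; ext x; rw [Finset.sum_apply]
    · refine (le_of_eq ?_).trans (h v)
      unfold LpN; exact eLpNorm_congr_norm_ae (evf fun x => abs_abs _)
  have h2 := (Yj hp (Xw χ (e1 m))).trans (h none)
  have h3 : LpN p (gg χ) ≤ LpN p (fun x => ∑ v, |pdv v χ x|) + LpN p (avg fun z => |pdo m χ z|) :=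
    eLpNorm_add_le (Finset.measurable_sum _ fun v _ => (Xw χ (ev v)).abs).aestronglyMeasurable (Xk (Xw χ _).abs).aestronglyMeasurable hp'
  refine h3.trans ((add_le_add h1 h2).trans (le_of_eq ?_))
  rw [Finset.sum_const, Finset.card_univ, Fintype.card_option, Fintype.card_fin, nsmul_eq_mul, ← ofReal_natCast, ← ofReal_mul byp, ← ofReal_add byp hB]
  congr 1; push_cast; ring
end
lemma Yl (hp : 1 ≤ p) {e : FS m} {G E : ℝ} (hc : 0 ≤ c) (hC : 0 ≤ C) (hd : 0 ≤ d) (hG : 0 ≤ G) (hE : 0 ≤ E)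
    (hgm : Measurable g) (hem : Measurable e) (hg : LpN p g ≤ oR G) (he : LpN p e ≤ oR E)
    (hh : ∀ᵐ x, |h x| ≤ c + C * (d * (1 + g x) + e x)) : LpN p h ≤ oR (c + C * (d * (1 + G) + E)) := by
  have hp' : (1 : ℝ≥0∞) ≤ oR p := by simpa using hp
  have h1 : LpN p h ≤ LpN p (fun x => (c + C * d) + ((C * d) * g x + C * e x)) := by
    refine eLpNorm_mono_ae_real ((ae_restrict_of_ae hh).mono fun x hx => hx.trans (le_of_eq (by ring)))
  have s1 : ∀ (k : ℝ) (u : FS m), 0 ≤ k → LpN p (fun x => k * u x) = oR k * LpN p u := fun k u hk => by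
    have := eLpNorm_const_smul (μ := μT m) (p := oR p) k u
    rw [Real.enorm_eq_ofReal hk] at this; exact this
  have h2 : LpN p (fun x => (c + C * d) + ((C * d) * g x + C * e x)) ≤ LpN p (fun _ : Spc m => c + C * d) + (LpN p (fun x => (C * d) * g x) + LpN p (fun x => C * e x)) := by
    refine (eLpNorm_add_le aestronglyMeasurable_const ((hgm.const_mul _).add (hem.const_mul _)).aestronglyMeasurable hp').trans ?_
    exact add_le_add le_rfl (eLpNorm_add_le (hgm.const_mul _).aestronglyMeasurable (hem.const_mul _).aestronglyMeasurable hp')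
  have hCd : 0 ≤ C * d := by positivity
  have h3 : LpN p (fun _ : Spc m => c + C * d) ≤ oR (c + C * d) := Qf fun x => by rw [abs_of_nonneg byp]
  refine h1.trans (h2.trans ?_)
  rw [s1 _ _ hCd, s1 _ _ hC]
  refine (add_le_add h3 (add_le_add (mul_le_mul_right hg _) (mul_le_mul_right he _))).trans (le_of_eq ?_)
  rw [← ofReal_mul hCd, ← ofReal_mul hC, ← ofReal_add byp byp, ← ofReal_add byp byp]
  congr 1; ring
lemma cpt {P : ℝ → ℝ → Prop} (mono : ∀ s B B', B ≤ B' → P s B → P s B')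
    (loc : ∀ s ∈ Icc 0 b, ∃ δ > 0, ∃ B, ∀ s' ∈ Icc 0 b, |s' - s| < δ → P s' B) : ∃ B, 0 ≤ B ∧ ∀ s ∈ Icc 0 b, P s B := by
  refine (isCompact_Icc (a := (0:ℝ)) (b := b)).induction_on (p := fun S => ∃ B, 0 ≤ B ∧ ∀ s ∈ S, P s B) ⟨0, le_rfl, by simp⟩ ?_ ?_ ?_
  · rintro s t hst ⟨B, h0, h⟩; exact ⟨B, h0, fun x hx => h x (hst hx)⟩
  · rintro s t ⟨B, h0, h⟩ ⟨B', h0', h'⟩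
    refine ⟨max B B', h0.trans (le_max_left _ _), fun x hx => ?_⟩
    rcases hx with hx | hx
    · exact mono _ _ _ (le_max_left _ _) (h x hx)
    · exact mono _ _ _ (le_max_right _ _) (h' x hx)
  · intro s hs
    obtain ⟨δ, hδ, B, h⟩ := loc s hs
    refine ⟨Icc 0 b ∩ Metric.ball s δ, inter_mem_nhdsWithin _ (Metric.ball_mem_nhds s hδ), max B 0, le_max_right _ _, fun x hx => ?_⟩
    exact mono _ _ _ (le_max_left _ _) (h x hx.1 (by simpa [dist_eq] using hx.2))
lemma Ym (hp : Per f) (hc : Continuous f) : Continuous (avg f) := by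
  rw [Metric.continuous_iff]
  intro x ε hε
  obtain ⟨δ, hδ, h⟩ := Qk hp hc (half_pos hε)
  refine ⟨δ, hδ, fun y hy => ?_⟩
  rw [dist_eq, avg, avg, ← integral_sub (Yc hc y) (Yc hc x)]
  have hxy : |y.1 - x.1| < δ := by
    have := (norm_fst_le (y - x)).trans_lt (by rwa [dist_eq_norm] at hy); simpa using this
  have : |∫ z in cube1 m, (f (y.1, z) - f (x.1, z))| ≤ ε / 2 := by
    refine Xz (h := fun w => f (y.1, w.2) - f (x.1, w.2)) (fun w => ?_) x
    have := h (x.1, w.2) (y.1 - x.1, 0) (by simpa [Prod.norm_def] using hxy)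
    simpa using this.le
  linarith

structure Sol (V : FS m) (β p b : ℝ) (ψ : ℝ → FS m) : Prop where
  hV : ContDiff ℝ 2 V
  hVp : Per V
  hj : 0 < β
  hp : (m : ℝ) + 1 < p
  hb : 0 < b
  w : ∀ s ∈ Icc 0 b, W1 (ψ s)
  M : ∀ s ∈ Icc 0 b, ∀ x1, 0 < marg (ψ s) x1
  lp : ∀ s ∈ Icc 0 b, ∀ v, LpN p (pdv v (ψ s)) < ⊤
  cont : ∀ s ∈ Icc 0 b, ∀ ε > 0, ∃ δ > 0, ∀ s' ∈ Icc 0 b, |s' - s| < δ → LpN p (fun x => ψ s' x - ψ s x) ≤ oR ε ∧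
    ∀ v, LpN p (pdv v (fun x => ψ s' x - ψ s x)) ≤ oR ε
  mild : ∀ t ∈ Icc 0 b, ∀ᵐ x, ψ t x = heatSG β t (ψ 0) x + ∫ s in Set.Ioc (0 : ℝ) t, heatSG β (t - s) (Fop V (ψ s)) x

section
lemma Sol.p1 (h : Sol V β p b ψ) : 1 < p := (Xa h.hp).2.2
lemma Sol.contS (h : Sol V β p b ψ) (hs : s ∈ Icc 0 b) (hε : 0 < ε) : ∃ δ > 0, ∀ s' ∈ Icc 0 b, |s' - s| < δ →
    (∀ x, |ψ s' x - ψ s x| ≤ ε) ∧ ∀ v, LpN p (pdv v (fun x => ψ s' x - ψ s x)) ≤ oR ε := by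
  obtain ⟨C, hC, hS⟩ := sobolev h.hp
  obtain ⟨δ, hδ, hd⟩ := h.cont s hs (min ε (ε / C)) byp
  refine ⟨δ, hδ, fun s' ho hss => ?_⟩
  obtain ⟨h1, h2⟩ := hd s' ho hss
  refine ⟨fun x => ?_, fun v => (h2 v).trans (oRm (min_le_left _ _))⟩
  have := hS _ ((h.w s' ho).per.sub (h.w s hs).per) ((h.w s' ho).diff.sub (h.w s hs).diff) (ε / C) byp
    (h1.trans (oRm (min_le_right _ _))) (fun v => (h2 v).trans (oRm (min_le_right _ _))) x
  rwa [mul_div_cancel₀ _ hC.ne'] at this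
lemma Yn {ψ : FS m} (h1 : Differentiable ℝ ψ) (h2 : Differentiable ℝ χ) (v : Spc m) : pd v ψ = fun x => pd v (fun x => ψ x - χ x) x + pd v χ x := by
  ext x; rw [Yg h1 h2]; ring
lemma Sol.bd (h : Sol V β p b ψ) : ∃ B, 1 ≤ B ∧ ∀ s ∈ Icc 0 b, (∀ x, |ψ s x| ≤ B) ∧ (∀ v, LpN p (pdv v (ψ s)) ≤ oR B) ∧ ∀ x, B⁻¹ ≤ avg (ψ s) x := by
  have hp' : (1 : ℝ≥0∞) ≤ oR p := by simpa using h.p1.le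
  obtain ⟨B, hB0, hB⟩ := cpt (b := b) (P := fun s B => 0 < B ∧ (∀ x, |ψ s x| ≤ B) ∧ (∀ v, LpN p (pdv v (ψ s)) ≤ oR B) ∧ ∀ x, B⁻¹ ≤ avg (ψ s) x)
    (by
      rintro s B B' hBB ⟨h0, h1, h2, h3⟩
      exact ⟨h0.trans_le hBB, fun x => (h1 x).trans hBB, fun v => (h2 v).trans (oRm hBB), fun x => (inv_anti₀ h0 hBB).trans (h3 x)⟩)
    (by
      intro s hs
      have w := h.w s hs
      obtain ⟨B1, hB1, hB1'⟩ := Qh w.per w.diff.continuous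
      have hM : ∀ x, 0 < avg (ψ s) x := fun x => h.M s hs x.1
      obtain ⟨B2, hB2, hB2'⟩ := Qh ((Xl w.per).comp fun t => t⁻¹) ((Ym w.per w.diff.continuous).inv₀ fun x => (hM x).ne')
      set B3 := B2 + 1
      have hM' : ∀ x, B3⁻¹ ≤ avg (ψ s) x := fun x => by
        rw [inv_le_comm₀ byp (hM x)]; linarith [le_abs_self (avg (ψ s) x)⁻¹, hB2' x]
      obtain ⟨δ, hδ, hc⟩ := h.contS hs (ε := min 1 ((2 * B3)⁻¹)) byp
      set L := ∑ v, (LpN p (pdv v (ψ s))).toReal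
      have hL : ∀ v, LpN p (pdv v (ψ s)) ≤ oR L := fun v => by
        rw [← ofReal_toReal (h.lp s hs v).ne]
        exact oRm (single_le_sum (f := fun v => (LpN p (pdv v (ψ s))).toReal) (fun i _ => ENNReal.toReal_nonneg) (Finset.mem_univ v))
      have hL0 : 0 ≤ L := sum_nonneg fun i _ => ENNReal.toReal_nonneg
      refine ⟨δ, hδ, B1 + 1 + L + 2 * B3, fun s' ho hss => ?_⟩
      have w' := h.w s' ho
      obtain ⟨h1, h2⟩ := hc s' ho hss
      have h1' : ∀ x, |ψ s' x - ψ s x| ≤ 1 := fun x => (h1 x).trans (min_le_left _ _)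
      refine ⟨by positivity, fun x => ?_, fun v => ?_, fun x => ?_⟩
      · have : 0 < B3 := by positivity
        have e : ψ s' x = (ψ s' x - ψ s x) + ψ s x := by ring
        rw [e]; linarith [abs_add_le (ψ s' x - ψ s x) (ψ s x), hB1' x, h1' x]
      · rw [Yn w'.diff w.diff]
        refine (eLpNorm_add_le (Xw _ _).aestronglyMeasurable (Xw _ _).aestronglyMeasurable hp').trans
          ((add_le_add ((h2 v).trans (oRm (min_le_left _ _))) (hL v)).trans ?_)
        rw [← ofReal_add zero_le_one hL0]
        refine oRm ?_
        have : 0 < B3 := by positivity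
        linarith
      · have hB3 : 0 < B3 := by positivity
        have e : |avg (ψ s') x - avg (ψ s) x| ≤ (2 * B3)⁻¹ := by
          rw [← Yd x (Yc w'.diff.continuous x) (Yc w.diff.continuous x)]
          exact Xz (fun z => (h1 z).trans (min_le_right _ _)) x
        have e2 : (2 * B3)⁻¹ + (2 * B3)⁻¹ = B3⁻¹ := by field_simp; norm_num
        have e3 : (B1 + 1 + L + 2 * B3)⁻¹ ≤ (2 * B3)⁻¹ := inv_anti₀ byp byl
        linarith [hM' x, (abs_le.1 e).1])
  refine ⟨max B 1, le_max_right _ _, fun s hs => ?_⟩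
  obtain ⟨h0, h1, h2, h3⟩ := hB s hs
  exact ⟨fun x => (h1 x).trans (le_max_left _ _), fun v => (h2 v).trans (oRm (le_max_left _ _)), fun x => (inv_anti₀ h0 (le_max_left _ _)).trans (h3 x)⟩
lemma Yo (χ : FS m) : Measurable (gg χ) :=
  (Finset.measurable_sum _ fun v _ => (Xw χ (ev v)).abs).add (Xk (Xw χ _).abs)
lemma Yq (hV : ContDiff ℝ 2 V) (hVp : Per V) : ∃ K, 0 ≤ K ∧ ∀ x, |Gop V (fun _ => 1) x| ≤ K := by
  obtain ⟨K, hK1, hK⟩ := Yh hV hVp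
  refine ⟨2 * K, by linarith, fun x => ?_⟩
  have h0 : ∀ v : Spc m, pd v (fun _ => (1:ℝ)) = fun _ => 0 := fun v => by ext; simp [pd]
  have h1 : avg (fun _ : Spc m => (1:ℝ)) x = 1 := by simp [avg]
  have h2 : avg (fun _ : Spc m => (0:ℝ)) x = 0 := by simp [avg]
  unfold Gop gradDot
  simp only [h0, h1, h2, mul_zero, mul_one, inv_one, one_mul, add_zero, Finset.sum_const_zero, zero_add, sub_zero]
  have := (hK x).2.2
  have h3 : |avg (fun z => pdo m (pdo m V) z) x| ≤ K := Xz (fun z => (hK z).2.1 none none) x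
  linarith [abs_sub (lap V x) (avg (fun z => pdo m (pdo m V) z) x)]
lemma Sol.lc (h : Sol V β p b ψ) : ∃ B, LC p (Icc 0 b) B (fun s => Gop V (ψ s)) := by
  obtain ⟨B, hB1, hB⟩ := h.bd
  have hp1 := h.p1.le
  obtain ⟨C, hC, hl⟩ := Yi h.hV h.hVp (by linarith : 0 ≤ B) (by positivity : 0 < B⁻¹)
  obtain ⟨K, hK0, hK⟩ := Yq h.hV h.hVp
  have h0 : ∀ v : Spc m, pd v (fun _ => (1:ℝ)) = fun _ => 0 := fun v => by ext; simp [pd]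
  have w1 : W1 (fun _ : Spc m => (1:ℝ)) := ⟨fun _ _ _ => rfl, differentiable_const _, fun v => by rw [h0]; exact PL.of_cont (fun _ _ _ => rfl) continuous_const⟩
  have hm0 : (0:ℝ) ≤ m + 2 := by positivity
  refine ⟨K + C * ((B + 1) * (1 + 0) + (m + 2) * B), fun s hs => Xv h.hVp (h.w s hs).per, fun s hs => Xx _ _ (h.w s hs).diff.continuous.measurable, by positivity, fun s hs => ?_, fun s hs ε hε => ?_⟩
  · obtain ⟨b1, b2, b3⟩ := hB s hs
    have w := h.w s hs
    have hg0 : gg (fun _ : Spc m => (1:ℝ)) = fun _ => 0 := by ext x; simp [gg, h0, avg]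
    have hgg : ∀ v, LpN p (pdv v (fun x => ψ s x - 1)) ≤ oR B := fun v => by
      have : pdv v (fun x => ψ s x - 1) = pdv v (ψ s) := by
        ext x; rw [Yg w.diff (differentiable_const _), h0]; simp
      rw [this]; exact b2 v
    refine Yl hp1 hK0 hC.le byp le_rfl byp (Yo (fun _ => (1:ℝ))) (Yo (fun x => ψ s x - 1)) ?_ (Yk hp1 byl hgg) ?_
    · rw [hg0]; exact Qf fun x => by simp
    · filter_upwards [(w.pl none).fiber] with x hx
      have := hl (ψ s) (fun _ => 1) w w1 b1 (fun x => by simpa using hB1) b3 (fun x => by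
        have : avg (fun _ : Spc m => (1:ℝ)) x = 1 := by simp [avg]
        rw [this]; exact inv_le_one_of_one_le₀ hB1) (B + 1) (fun x => (abs_sub _ _).trans (by linarith [b1 x, abs_one (α := ℝ)])) x hx (by rw [h0]; exact integrable_const (μ := volume.restrict (cube1 m)) (0:ℝ))
      have e := abs_sub_abs_le_abs_sub (Gop V (ψ s) x) (Gop V (fun _ => 1) x)
      linarith [hK x]
  · set D := C * (1 * (1 + (m + 2) * B) + (m + 2) * 1) with hD
    have hD0 : 0 < D := by positivity
    obtain ⟨δ, hδ, hc⟩ := h.contS hs (ε := ε / D) byp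
    refine ⟨δ, hδ, fun s' ho hss => ?_⟩
    obtain ⟨c1, c2⟩ := hc s' ho hss
    obtain ⟨b1, b2, b3⟩ := hB s hs
    obtain ⟨b1', b2', b3'⟩ := hB s' ho
    have w := h.w s hs
    have w' := h.w s' ho
    have hεD : 0 < ε / D := by positivity
    have := Yl (h := fun x => Gop V (ψ s') x - Gop V (ψ s) x) hp1 le_rfl hC.le hεD.le byp byp (Yo (ψ s)) (Yo (fun x => ψ s' x - ψ s x)) (Yk hp1 byl b2) (Yk hp1 hεD.le c2)
      (by
        filter_upwards [(w.pl none).fiber, (w'.pl none).fiber] with x hx hx'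
        rw [zero_add]
        exact hl (ψ s') (ψ s) w' w b1' b1 b3' b3 (ε / D) c1 x hx' hx)
    refine this.trans (le_of_eq ?_)
    congr 1
    rw [zero_add]
    calc _ = D * (ε / D) := by rw [hD]; ring
      _ = ε := mul_div_cancel₀ _ hD0.ne'
end

section
lemma Yr (hc : 0 < c) (h : ∀ᵐ x, f x = g x) (x : Spc m) : Kop k c f x = Kop k c g x := by
  rw [Nf k hc, Nf k hc]
  congr 1
  exact integral_congr_ae (by filter_upwards [h] with y hy; simp only [hy])
lemma Sol.rep (h : Sol V β p b ψ) (ht : t ∈ Icc 0 b) (x : Spc m) :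
    ψ t x = Ah (sc β (t - 0)) (ψ 0) x + U β 0 t (fun s => Gop V (ψ s)) x := by
  obtain ⟨B, hL⟩ := h.lc
  rw [sub_zero]
  have h0 : (0:ℝ) ∈ Icc 0 b := ⟨le_rfl, h.hb.le⟩
  have w0 := h.w 0 h0
  have P0 := PL.of_cont w0.per w0.diff.continuous
  rcases ht.1.eq_or_lt with rfl | ht0
  · simp [We, Qq, U]
  have hc : Continuous (fun x => Ah (sc β t) (ψ 0) x + U β 0 t (fun s => Gop V (ψ s)) x) :=
    (Qg Ly P0 (Wb h.hj ht0)).add (Xf h.hj h.hp le_rfl hL le_rfl ht.1 ht.2)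
  refine congrFun ((Continuous.ae_eq_iff_eq volume (h.w t ht).diff.continuous hc).1 ?_) x
  filter_upwards [h.mild t ht] with x hx
  rw [hx, Wl h.hj, U, integral_Ioc_eq_integral_Ioo]
  congr 1
  refine setIntegral_congr_fun measurableSet_Ioo fun s hs => ?_
  have ho : s ∈ Icc 0 b := ⟨hs.1.le, hs.2.le.trans ht.2⟩
  rw [Wl h.hj]
  exact Yr (Wb h.hj (sp2 hs.2)) (Xy h.hV h.hVp (h.w s ho) (h.M s ho)) x

structure Seg (V : FS m) (β p a b B : ℝ) (ψ : ℝ → FS m) : Prop where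
  hV : ContDiff ℝ 2 V
  hVp : Per V
  hj : 0 < β
  hp : (m : ℝ) + 1 < p
  ha : 0 ≤ a
  hab : a < b
  hB : 1 ≤ B
  per : ∀ s ∈ Icc a b, Per (ψ s)
  diff : ∀ s ∈ Icc a b, Differentiable ℝ (ψ s)
  bd : ∀ s ∈ Icc a b, ∀ x, |ψ s x| ≤ B
  bd1 : ∀ s ∈ Icc a b, ∀ v x, |pdv v (ψ s) x| ≤ B
  low : ∀ s ∈ Icc a b, ∀ x, B⁻¹ ≤ avg (ψ s) x
  lc : LC p (Icc a b) B (fun s => Gop V (ψ s))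
  fb : ∀ s ∈ Icc a b, ∀ x, |Gop V (ψ s) x| ≤ B
  rep : ∀ t ∈ Icc a b, ∀ x, ψ t x = Ah (sc β (t - a)) (ψ a) x + U β a t (fun s => Gop V (ψ s)) x
lemma Yt (hj : 0 < β) (hp : (m : ℝ) + 1 < p) (ha : 0 ≤ a) {f : ℝ → FS m} (hf : LC p (Icc a b) B f) (h0 : PL (ψ a))
    (hat : a < t) (htb : t ≤ b) (hm : ∀ x, ψ t x = Ah (sc β (t - a)) (ψ a) x + U β a t f x) (v : OF m) (x : Spc m) :
    pdv v (ψ t) x = Dh v (sc β (t - a)) (ψ a) x + Uv β a t f v x := by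
  have e : ψ t = fun x => Ah (sc β (t - a)) (ψ a) x + U β a t f x := funext hm
  refine Te (a := fun v => Dh v (sc β (t - a)) (ψ a) x + Uv β a t f v x) ?_ v
  rw [e]
  simp only [add_smul, sum_add_distrib]
  exact (Nl (Wb hj (sp2 hat)) h0 x).fun_add (Xe hj hp ha hf le_rfl hat.le htb x)
lemma Yu (h : ∀ v x, |pdv v χ x| ≤ M) (x : Spc m) : gg χ x ≤ (m + 2) * M := by
  have s1 : ∑ v : OF m, |pdv v χ x| ≤ ∑ v : OF m, M := sum_le_sum fun v _ => h v x
  have s2 := le_of_abs_le (Xz (h := fun z => |pdo m χ z|) (fun x => by rw [abs_abs]; exact h none x) x)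
  simp only [Finset.sum_const, Finset.card_univ, Fintype.card_option, Fintype.card_fin, nsmul_eq_mul, Nat.cast_add, Nat.cast_one] at s1
  rw [gg]; linarith
lemma Yv (hV : ContDiff ℝ 2 V) (hVp : Per V) (hB : 1 ≤ B) : ∃ C, 0 < C ∧ ∀ χ : FS m, Per χ → Differentiable ℝ χ →
    (∀ x, |χ x| ≤ B) → (∀ v x, |pdv v χ x| ≤ B) → (∀ x, B⁻¹ ≤ avg χ x) → ∀ x, |Gop V χ x| ≤ C := by
  obtain ⟨C, hC, hl⟩ := Yi hV hVp (B := B) (m0 := B⁻¹) byl byp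
  have h0 : ∀ v : Spc m, pd v (fun _ : Spc m => (1:ℝ)) = fun _ => 0 := fun v => by ext x; simp [pd]
  have w1 : W1 (fun _ : Spc m => (1:ℝ)) := ⟨fun _ _ _ => rfl, differentiable_const _, fun v => by rw [h0]; exact PL.of_cont (fun _ _ _ => rfl) continuous_const⟩
  obtain ⟨K', hK'0, hK'⟩ := Yq hV hVp
  refine ⟨K' + C * ((B + 1) * (1 + 0) + (m + 2) * B), by positivity, fun χ hp hd h1 h2 h3 x => ?_⟩
  have w : W1 χ := ⟨hp, hd, fun v => PL.of_bdd (Ql hp _) (Xw _ _) (h2 v)⟩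
  have g0 : gg (fun _ : Spc m => (1:ℝ)) x = 0 := by simp [gg, h0, avg]
  have g1 : gg (fun x => χ x - 1) x ≤ (m + 2) * B := Yu (fun v x => by
    rw [Yg hd (differentiable_const _), h0, sub_zero]; exact h2 v x) x
  have I : ∀ x : Spc m, IntegrableOn (fun y => pdo m χ (x.1, y)) (cube1 m) := fun x => by
    refine Integrable.of_bound (((Xw χ (e1 m)).comp (measurable_prodMk_left)).aestronglyMeasurable) B (ae_of_all _ fun y => h2 none (x.1, y))
  have := hl χ (fun _ => 1) w w1 h1 (fun x => by simpa using hB) h3 (fun x => by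
        have : avg (fun _ : Spc m => (1:ℝ)) x = 1 := by simp [avg]
        rw [this]; exact inv_le_one_of_one_le₀ hB) (B + 1) (fun x => (abs_sub _ _).trans (by linarith [h1 x, abs_one (α := ℝ)])) x (I x) (by rw [h0]; exact integrable_const (μ := volume.restrict (cube1 m)) (0:ℝ))
  rw [g0] at this
  have e := abs_sub_abs_le_abs_sub (Gop V χ x) (Gop V (fun _ => 1) x)
  have e2 : C * ((B + 1) * (1 + 0) + gg (fun x => χ x - 1) x) ≤ C * ((B + 1) * (1 + 0) + (m + 2) * B) := by gcongr
  linarith [hK' x]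
lemma Sol.seg (h : Sol V β p b ψ) (ha : 0 ≤ a) (hab : a < b) (hg : ∃ B, ∀ s ∈ Icc a b, ∀ v x, |pdv v (ψ s) x| ≤ B) : ∃ B, Seg V β p a b B ψ := by
  obtain ⟨B1, hB1, h1⟩ := h.bd
  obtain ⟨B2, h2⟩ := hg
  obtain ⟨B3, h3⟩ := h.lc
  have hs : Icc a b ⊆ Icc 0 b := Icc_subset_Icc_left ha
  set B4 := max B1 B2
  have hB4 : 1 ≤ B4 := hB1.trans (le_max_left _ _)
  have low : ∀ s ∈ Icc a b, ∀ x, B4⁻¹ ≤ avg (ψ s) x := fun s ho x => (inv_anti₀ byl (le_max_left _ _)).trans ((h1 s (hs ho)).2.2 x)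
  have b1 : ∀ s ∈ Icc a b, ∀ x, |ψ s x| ≤ B4 := fun s ho x => ((h1 s (hs ho)).1 x).trans (le_max_left _ _)
  have b2 : ∀ s ∈ Icc a b, ∀ v x, |pdv v (ψ s) x| ≤ B4 := fun s ho v x => (h2 s ho v x).trans (le_max_right _ _)
  obtain ⟨C, hC, h4⟩ := Yv h.hV h.hVp hB4
  set B5 := max B4 (max B3 C)
  have l1 : B4 ≤ B5 := le_max_left _ _
  have l2 : B3 ≤ B5 := (le_max_left _ _).trans (le_max_right _ _)
  have l3 : C ≤ B5 := (le_max_right _ _).trans (le_max_right _ _)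
  have L := h3.mono hs
  have a0 : a ∈ Icc 0 b := ⟨ha, hab.le⟩
  have w0 := h.w 0 ⟨le_rfl, h.hb.le⟩
  refine ⟨B5, h.hV, h.hVp, h.hj, h.hp, ha, hab, by linarith, fun s ho => (h.w s (hs ho)).per, fun s ho => (h.w s (hs ho)).diff,
    fun s ho x => (b1 s ho x).trans l1, fun s ho v x => (b2 s ho v x).trans l1,
    fun s ho x => (inv_anti₀ byl l1).trans (low s ho x), ⟨L.per, L.meas, by linarith [L.nn], fun s ho => (L.bdd s ho).trans (oRm l2), L.cont⟩,
    fun s ho x => (h4 _ (h.w s (hs ho)).per (h.w s (hs ho)).diff (b1 s ho) (b2 s ho) (low s ho) x).trans l3, fun t ht x => ?_⟩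
  rcases ht.1.eq_or_lt with rfl | hat
  · simp [We, Qq, U]
  exact restart h.hj h.hp le_rfl h3 (PL.of_cont w0.per w0.diff.continuous) (fun t ht => h.rep ht) ha hat ht.2 x
lemma Sol.grad (h : Sol V β p b ψ) (ha : 0 < a) : ∃ B, ∀ s ∈ Icc a b, ∀ v x, |pdv v (ψ s) x| ≤ B := by
  obtain ⟨B1, hB1, h1⟩ := h.bd
  obtain ⟨B3, h3⟩ := h.lc
  obtain ⟨C, hC, hU⟩ := Xc (m := m) h.hj h.hp h.hb
  have z0 : (0:ℝ) ∈ Icc 0 b := ⟨le_rfl, h.hb.le⟩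
  have w0 := h.w 0 z0
  refine ⟨4 * G4 m * B1 * (sc β a)⁻¹ + C * B3, fun s hs v x => ?_⟩
  have hs0 := ha.trans_le hs.1
  rw [Yt h.hj h.hp le_rfl h3 (PL.of_cont w0.per w0.diff.continuous) hs0 hs.2 (h.rep ⟨hs0.le, hs.2⟩), sub_zero]
  refine (abs_add_le _ _).trans (add_le_add ((Tb (h1 0 z0).1 v (Wb h.hj hs0) x).trans ?_) ((hU 0 0 s B3 _ le_rfl h3 le_rfl hs0.le hs.2 x).2 v))
  have := Nn m
  exact mll (inv_anti₀ (Wb h.hj ha) (Wg h.hj hs.1)) byp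
lemma Sol.grad0 (h : Sol V β p b ψ) (h0 : ContDiff ℝ 1 (ψ 0)) : ∃ B, ∀ s ∈ Icc 0 b, ∀ v x, |pdv v (ψ s) x| ≤ B := by
  obtain ⟨B3, h3⟩ := h.lc
  obtain ⟨C, hC, hU⟩ := Xc (m := m) h.hj h.hp h.hb
  have z0 : (0:ℝ) ∈ Icc 0 b := ⟨le_rfl, h.hb.le⟩
  have w0 := h.w 0 z0
  have hbv := fun v => Qh (Ql w0.per (ev v)) ((h0.continuous_fderiv one_ne_zero).clm_apply continuous_const)
  choose Bv hBv hBv' using hbv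
  have hle : ∀ v x, |pdv v (ψ 0) x| ≤ ∑ v, Bv v := fun v x => (hBv' v x).trans (single_le_sum (fun i _ => hBv i) (Finset.mem_univ v))
  have hS : 0 ≤ ∑ v, Bv v := sum_nonneg fun i _ => hBv i
  have := Nn m
  refine ⟨∑ v, Bv v + 4 * G4 m * (∑ v, Bv v) + C * B3, fun s hs v x => ?_⟩
  have hCB : 0 ≤ C * B3 := mul_nonneg hC.le h3.nn
  rcases hs.1.eq_or_lt with rfl | hs0
  · have : 0 ≤ 4 * G4 m * (∑ v, Bv v) := by positivity
    linarith [hle v x]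
  rw [Yt h.hj h.hp le_rfl h3 (PL.of_cont w0.per w0.diff.continuous) hs0 hs.2 (h.rep ⟨hs0.le, hs.2⟩), sub_zero, Tv w0.per h0 v (Wb h.hj hs0)]
  have e1 := Ta (hle v) (sc β s) x
  have e2 := (hU 0 0 s B3 _ le_rfl h3 le_rfl hs0.le hs.2 x).2 v
  have := abs_add_le (Ah (sc β s) (pdv v (ψ 0)) x) (Uv β 0 s (fun s => Gop V (ψ s)) v x)
  linarith
end

section
lemma Yw (hd : Differentiable ℝ g) (hc : ∀ v, Continuous (pdv v g)) : ContDiff ℝ 1 g := by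
  rw [contDiff_one_iff_fderiv]
  refine ⟨hd, ?_⟩
  have : fderiv ℝ g = fun x => ∑ v, pdv v g x • co v := by ext1 x; exact Kh _
  rw [this]
  exact continuous_finsetSum _ fun v _ => (hc v).smul continuous_const
lemma hol1 (hd : Differentiable ℝ g) (h : ∀ v x, |pdv v g x| ≤ M) : Hol 1 ((m + 1) * M) g := fun x y => by
  have hM : 0 ≤ M := (anz _).trans (h none 0)
  have := Convex.norm_image_sub_le_of_norm_fderiv_le (𝕜 := ℝ) (f := g) (C := (m + 1) * M) (s := univ) (fun x _ => hd x) (fun x _ => ?_) convex_univ (mem_univ x) (mem_univ (x + y))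
  · simpa using this
  · refine ContinuousLinearMap.opNorm_le_bound _ byp fun z => ?_
    rw [Qn]
    refine (Finset.abs_sum_le_sum_abs _ _).trans ((sum_le_sum (g := fun _ => ‖z‖ * M) fun v _ => ?_).trans_eq ?_)
    · rw [abs_mul]; exact mul_le_mul (Ki v z) (h v x) (anz _) (norm_nonneg _)
    · simp; ring
lemma interp {X A : ℝ} (hA : 0 ≤ A) (hr : 0 ≤ r) (h0 : 0 ≤ γ) (h1 : γ ≤ 1) (ha : X ≤ A) (hb : X ≤ A * r) : X ≤ A * r ^ γ := by
  rcases le_total r 1 with h | h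
  · refine hb.trans (mll ?_ hA)
    rcases hr.eq_or_lt with rfl | hr
    · exact Real.rpow_nonneg le_rfl _
    · simpa using Real.rpow_le_rpow_of_exponent_ge hr h h1
  · exact ha.trans (le_mul_of_one_le_right hA (Real.one_le_rpow h h0))
lemma Yx (hg : PL g) (hB : ∀ x, |g x| ≤ B) (h0 : 0 ≤ γ) (h1 : γ ≤ 1) (v : OF m) (hc : 0 < c) :
    Hol γ (256 * (m + 1) * G4 m * B * c ^ (-1 - γ)) (Dh v c g) := fun x y => by
  have hB0 : 0 ≤ B := (anz _).trans (hB 0)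
  have hG := Nn m
  have hd : Differentiable ℝ (Dh v c g) := fun x => (Tm hc hg v x).differentiableAt
  have b1 := Tb hB v hc
  have b2 := hol1 hd (fun w x => by rw [Tn hc hg]; exact Tu hB w v hc x) x y
  have hm : (0:ℝ) ≤ m := Nat.cast_nonneg m
  have P : 0 ≤ G4 m * B * c⁻¹ := by positivity
  have Q : 0 ≤ m * (G4 m * B * c⁻¹) := by positivity
  have := interp (X := |Dh v c g (x + y) - Dh v c g x|) (A := 256 * (m + 1) * G4 m * B * c⁻¹) (r := ‖y‖ * c⁻¹) byp byp h0 h1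
    ((abs_sub _ _).trans (by linarith [b1 (x + y), b1 x])) (b2.trans_eq (by rw [Real.rpow_one]; ring))
  refine this.trans_eq ?_
  rw [Real.mul_rpow (norm_nonneg _) byp, Real.inv_rpow hc.le, Real.rpow_sub hc, Real.rpow_neg_one]
  ring
lemma Hol.cont (hγ : 0 < γ) (h : Hol γ H g) : Continuous g := by
  rw [continuous_iff_continuousAt]
  intro x
  rw [ContinuousAt, tendsto_iff_norm_sub_tendsto_zero]
  refine squeeze_zero (fun _ => norm_nonneg _) (fun y => ?_) (g := fun y => H * ‖y - x‖ ^ γ) ?_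
  · have := h x (y - x); rwa [add_sub_cancel] at this
  · have : Continuous fun y : Spc m => H * ‖y - x‖ ^ γ := ccm ((continuous_id.sub continuous_const).norm.rpow_const fun _ => Or.inr hγ.le)
    simpa [hγ.ne'] using this.tendsto x
lemma Hol.add {H' : ℝ} {g' : FS m} (h : Hol γ H g) (h' : Hol γ H' g') : Hol γ (H + H') (fun x => g x + g' x) := fun x y => by
  have e : g (x + y) + g' (x + y) - (g x + g' x) = (g (x + y) - g x) + (g' (x + y) - g' x) := by ring
  rw [e, add_mul]
  exact (abs_add_le _ _).trans (add_le_add (h x y) (h' x y))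
lemma Yy {f : ℝ → FS m} (hj : 0 < β) (hp : 1 < p) (hf : LC p (Icc a b) B f) (fb : ∀ s ∈ Icc a b, ∀ x, |f s x| ≤ B) (har : a ≤ r) (hrt : r ≤ t) (htb : t ≤ b)
    (v : OF m) (x : Spc m) : IntegrableOn (fun s => Dh v (sc β (t - s)) (f s) x) (Ioo r t) ∧
      |Uv β r t f v x| ≤ 4 * G4 m * B * (2 / β) ^ (-1 / 2 : ℝ) * ((t - r) ^ (-1 / 2 + 1 : ℝ) / (-1 / 2 + 1)) := by
  refine Wy hrt byn ((Wu hj hp hf v t x).mono (Wz har htb)) fun s hs => ?_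
  have := Tb (fb s ⟨har.trans hs.1.le, hs.2.le.trans htb⟩) v (Wb hj (sp2 hs.2)) x
  rw [← Real.rpow_neg_one, Wi hj (sp2 hs.2).le] at this
  linarith
lemma Yz {f : ℝ → FS m} (hj : 0 < β) (hp : 1 < p) (hf : LC p (Icc a b) B f) (fb : ∀ s ∈ Icc a b, ∀ x, |f s x| ≤ B) (hat : a ≤ t) (htb : t ≤ b)
    (h0 : 0 ≤ γ) (h1 : γ < 1) (v : OF m) :
    Hol γ (256 * (m + 1) * G4 m * B * (2 / β) ^ ((-1 - γ) / 2) * ((b - a) ^ ((-1 - γ) / 2 + 1) / ((-1 - γ) / 2 + 1))) (Uv β a t f v) := fun x y => by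
  have I := fun x => (Yy hj hp hf fb le_rfl hat htb v x).1
  have e : -1 < (-1 - γ) / 2 := by linarith
  have e' : 0 < (-1 - γ) / 2 + 1 := by linarith
  rw [Uv, Uv, ← integral_sub (I _) (I _)]
  have hG := Nn m
  have hB := hf.nn
  refine (Wy (C := 256 * (m + 1) * G4 m * B * (2 / β) ^ ((-1 - γ) / 2) * ‖y‖ ^ γ) hat e
    (((Wu hj hp hf v t (x + y)).sub (Wu hj hp hf v t x)).mono (Wz le_rfl htb)) fun s hs => ?_).2.trans ?_
  · have ho : s ∈ Icc a b := ⟨hs.1.le, hs.2.le.trans htb⟩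
    have := Yx (PL.of_bdd (hf.per s ho) (hf.meas s ho) (fb s ho)) (fb s ho) h0 h1.le v (Wb hj (sp2 hs.2)) x y
    rw [Wi hj (sp2 hs.2).le] at this
    refine this.trans_eq (by ring)
  · have : (t - a) ^ ((-1 - γ) / 2 + 1) ≤ (b - a) ^ ((-1 - γ) / 2 + 1) := Real.rpow_le_rpow byl byl e'.le
    have : (t - a) ^ ((-1 - γ) / 2 + 1) / ((-1 - γ) / 2 + 1) ≤ (b - a) ^ ((-1 - γ) / 2 + 1) / ((-1 - γ) / 2 + 1) := by gcongr
    rw [mul_right_comm _ (_ / _)]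
    gcongr
lemma Seg.pl (h : Seg V β p a b B ψ) (hs : s ∈ Icc a b) : PL (ψ s) := PL.of_cont (h.per s hs) (h.diff s hs).continuous
lemma Seg.hol (h : Seg V β p a b B ψ) (h0 : 0 ≤ γ) (h1 : γ < 1) (haa : a < a') : ∃ H, 0 ≤ H ∧ ∀ t ∈ Icc a' b, ∀ v, Hol γ H (pdv v (ψ t)) := by
  have hp1 := (Xa h.hp).2.2
  have hG := Nn m
  have hB := h.hB
  have hj := h.hj
  have hab := sp2 h.hab
  have e' : 0 < (-1 - γ) / 2 + 1 := by linarith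
  have c0 := Wb h.hj (sp2 haa)
  refine ⟨256 * (m + 1) * G4 m * B * (sc β (a' - a)) ^ (-1 - γ) + 256 * (m + 1) * G4 m * B * (2 / β) ^ ((-1 - γ) / 2) * ((b - a) ^ ((-1 - γ) / 2 + 1) / ((-1 - γ) / 2 + 1)),
    by positivity, fun t ht v => ?_⟩
  have a0 : a ∈ Icc a b := ⟨le_rfl, h.hab.le⟩
  have hat := haa.trans_le ht.1
  have e : pdv v (ψ t) = fun x => Dh v (sc β (t - a)) (ψ a) x + Uv β a t (fun s => Gop V (ψ s)) v x :=
    funext fun x => Yt h.hj h.hp h.ha h.lc (h.pl a0) hat ht.2 (h.rep t ⟨hat.le, ht.2⟩) v x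
  rw [e]
  refine Hol.add (fun x y => (Yx (h.pl a0) (h.bd a a0) h0 h1.le v (Wb h.hj (sp2 hat)) x y).trans ?_) (Yz h.hj hp1 h.lc h.fb hat.le ht.2 h0 h1 v)
  have := Real.rpow_le_rpow_of_nonpos c0 (Wg h.hj (sub_le_sub_right ht.1 a)) (z := -1 - γ) byl
  gcongr

structure Seg2 (V : FS m) (β p a b B α H : ℝ) (ψ : ℝ → FS m) : Prop extends Seg V β p a b B ψ where
  hα : 0 < α
  hH : 0 ≤ H
  c1 : ∀ s ∈ Icc a b, ContDiff ℝ 1 (ψ s)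
  tp : ∀ s ∈ Icc a b, ∀ t ∈ Icc a b, s < t → ∀ x, |ψ t x - ψ s x| ≤ H * (t - s) ^ α
  tg : ∀ s ∈ Icc a b, ∀ t ∈ Icc a b, s < t → ∀ v x, |pdv v (ψ t) x - pdv v (ψ s) x| ≤ H * (t - s) ^ α
  tf : ∀ s ∈ Icc a b, ∀ t ∈ Icc a b, s < t → ∀ x, |Gop V (ψ t) x - Gop V (ψ s) x| ≤ H * (t - s) ^ α
lemma Za {h : ℝ} (h0 : 0 < h) (hb : h ≤ b) (he : α ≤ e) : h ^ e ≤ b ^ (e - α) * h ^ α := by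
  have : h ^ e = h ^ (e - α) * h ^ α := by rw [← Real.rpow_add h0]; ring_nf
  rw [this]
  gcongr
lemma Seg.restart (h : Seg V β p a b B ψ) (hs : a ≤ s) (hst : s < t) (ht : t ≤ b) (x : Spc m) :
    ψ t x = Ah (sc β (t - s)) (ψ s) x + U β s t (fun s => Gop V (ψ s)) x :=
  _root_.restart h.hj h.hp h.ha h.lc (h.pl ⟨le_rfl, h.hab.le⟩) h.rep hs hst ht x
lemma Seg.sub (h : Seg V β p a b B ψ) (h1 : a ≤ a') (h2 : a' < b) : Seg V β p a' b B ψ := by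
  have hs : Icc a' b ⊆ Icc a b := Icc_subset_Icc_left h1
  refine ⟨h.hV, h.hVp, h.hj, h.hp, h.ha.trans h1, h2, h.hB, fun s q => h.per s (hs q), fun s q => h.diff s (hs q), fun s q => h.bd s (hs q), fun s q => h.bd1 s (hs q),
    fun s q => h.low s (hs q), h.lc.mono hs, fun s q => h.fb s (hs q), fun t q x => ?_⟩
  rcases q.1.eq_or_lt with rfl | hat
  · simp [We, Qq, U]
  exact h.restart h1 hat q.2 x
lemma Seg.time (h : Seg V β p a b B ψ) (c1 : ∀ s ∈ Icc a b, ContDiff ℝ 1 (ψ s)) {H0 : ℝ} (hα : 0 < α) (hα1 : α ≤ 1 / 2) (hH0 : 0 ≤ H0)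
    (TH : ∀ t ∈ Icc a b, ∀ h, 0 < h → h ≤ b → ∀ v x, |Ah (sc β h) (pdv v (ψ t)) x - pdv v (ψ t) x| ≤ H0 * h ^ α) : ∃ H, Seg2 V β p a b B α H ψ := by
  have hp1 := (Xa h.hp).2.2
  have hG := Nn m
  have hB := h.hB
  have hj := h.hj
  have hb : 0 < b := h.ha.trans_lt h.hab
  set K1 := H0 + 4 * G4 m * B * (2 / β) ^ (-1 / 2 : ℝ) * (b ^ (-1 / 2 + 1 - α) / (-1 / 2 + 1)) with hK1
  set K2 := 16 * G4 m * ((m + 1) * B * (2 / β) ^ (1 / 2 : ℝ)) * b ^ (1 / 2 - α) + 4 * G4 m * B * (b ^ (0 + 1 - α) / (0 + 1)) with hK2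
  have hK1' : 0 ≤ K1 := add_nonneg hH0 (mul_nonneg byp (div_nonneg byp byn))
  have hK2' : 0 ≤ K2 := by positivity
  have G1 : ∀ s ∈ Icc a b, ∀ t ∈ Icc a b, s < t → ∀ v x, |pdv v (ψ t) x - pdv v (ψ s) x| ≤ K1 * (t - s) ^ α := fun s hs t ht hst v x => by
    have hd := sp2 hst
    have hdb : t - s ≤ b := by linarith [hs.1, ht.2, h.ha]
    rw [Yt (a := s) h.hj h.hp (h.ha.trans hs.1) (h.lc.mono (Icc_subset_Icc_left hs.1)) (h.pl hs) hst ht.2 (fun x => h.restart hs.1 hst ht.2 x),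
      Tv (h.per s hs) (c1 s hs) v (Wb h.hj hd)]
    have e1 := TH s hs (t - s) hd hdb v x
    have e2 := (Yy h.hj hp1 h.lc h.fb hs.1 hst.le ht.2 v x).2
    have e3 : (t - s) ^ (-1 / 2 + 1 : ℝ) ≤ b ^ (-1 / 2 + 1 - α) * (t - s) ^ α := Za hd hdb byl
    have e4 : 4 * G4 m * B * (2 / β) ^ (-1 / 2 : ℝ) * ((t - s) ^ (-1 / 2 + 1 : ℝ) / (-1 / 2 + 1)) ≤
        4 * G4 m * B * (2 / β) ^ (-1 / 2 : ℝ) * (b ^ (-1 / 2 + 1 - α) * (t - s) ^ α / (-1 / 2 + 1)) :=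
      mll (div_le_div_of_nonneg_right e3 byn) byp
    have e5 : K1 * (t - s) ^ α = H0 * (t - s) ^ α + 4 * G4 m * B * (2 / β) ^ (-1 / 2 : ℝ) * (b ^ (-1 / 2 + 1 - α) * (t - s) ^ α / (-1 / 2 + 1)) := by rw [hK1]; ring
    rw [e5, add_sub_right_comm]
    exact (abs_add_le _ _).trans (add_le_add e1 (e2.trans e4))
  have G2 : ∀ s ∈ Icc a b, ∀ t ∈ Icc a b, s < t → ∀ x, |ψ t x - ψ s x| ≤ K2 * (t - s) ^ α := fun s hs t ht hst x => by
    have hd := sp2 hst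
    have hdb : t - s ≤ b := by linarith [hs.1, ht.2, h.ha]
    rw [h.restart hs.1 hst ht.2 x]
    have e1 := Qz (h.pl hs).2.1 (h.bd s hs) byp zero_le_one le_rfl (hol1 (h.diff s hs) (h.bd1 s hs)) (Wc β (t - s)) x
    rw [Wi h.hj hd.le] at e1
    have e2 : |U β s t (fun s => Gop V (ψ s)) x| ≤ 4 * G4 m * B * ((t - s) ^ (0 + 1 : ℝ) / (0 + 1)) := (Wy (e := 0) (C := 4 * G4 m * B) hst.le byn ((Wr h.hj hp1 h.lc Ly t x).mono (Wz hs.1 ht.2)) fun τ hτ => by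
      rw [Real.rpow_zero, mul_one]; exact Ta (h.fb τ ⟨hs.1.trans hτ.1.le, hτ.2.le.trans ht.2⟩) _ x).2
    have e3 : (t - s) ^ (1 / 2 : ℝ) ≤ b ^ (1 / 2 - α) * (t - s) ^ α := Za hd hdb byl
    have e4 : (t - s) ^ (0 + 1 : ℝ) ≤ b ^ (0 + 1 - α) * (t - s) ^ α := Za hd hdb byl
    rw [add_sub_right_comm]
    refine (abs_add_le _ _).trans ((add_le_add (e1.trans (c := 16 * G4 m * ((m + 1) * B * ((2 / β) ^ (1 / 2 : ℝ) * (b ^ (1 / 2 - α) * (t - s) ^ α)))) (by gcongr))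
      (e2.trans (c := 4 * G4 m * B * (b ^ (0 + 1 - α) * (t - s) ^ α / (0 + 1))) (by gcongr))).trans_eq ?_)
    rw [hK2]; ring
  clear_value K1 K2
  obtain ⟨C, hC, hl⟩ := Yi h.hV h.hVp (B := B) (m0 := B⁻¹) byl byp
  have W : ∀ s ∈ Icc a b, W1 (ψ s) := fun s hs => ⟨h.per s hs, h.diff s hs, fun v => PL.pd1 (h.per s hs) (c1 s hs) v⟩
  have cf : ∀ s ∈ Icc a b, ∀ x : Spc m, IntegrableOn (fun y => pdo m (ψ s) (x.1, y)) (cube1 m) := fun s hs =>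
    Yc (((c1 s hs).continuous_fderiv one_ne_zero).clm_apply continuous_const)
  set K3 := C * (K2 * (1 + (m + 2) * B) + (m + 2) * K1) with hK3
  have hK3' : 0 ≤ K3 := by positivity
  have mono : ∀ {K s t X : ℝ}, s < t → X ≤ K * (t - s) ^ α → K ≤ K1 + K2 + K3 → X ≤ (K1 + K2 + K3) * (t - s) ^ α := fun hst hX hK =>
    hX.trans (mlr hK (Real.rpow_nonneg (sp2 hst).le _))
  refine ⟨K1 + K2 + K3, h, hα, by positivity, c1, fun s hs t ht hst x => mono hst (G2 s hs t ht hst x) byl, fun s hs t ht hst v x => mono hst (G1 s hs t ht hst v x) byl,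
    fun s hs t ht hst x => mono hst ?_ (show K3 ≤ _ by linarith)⟩
  have hd := Real.rpow_nonneg (sp2 hst).le α
  refine (hl (ψ t) (ψ s) (W t ht) (W s hs) (h.bd t ht) (h.bd s hs) (h.low t ht) (h.low s hs) _ (G2 s hs t ht hst) x (cf t ht x) (cf s hs x)).trans ?_
  have g1 := Yu (h.bd1 s hs) x
  have g2 := Yu (χ := fun x => ψ t x - ψ s x) (M := K1 * (t - s) ^ α) (fun v x => by rw [Yg (h.diff t ht) (h.diff s hs)]; exact G1 s hs t ht hst v x) x
  calc _ ≤ C * (K2 * (t - s) ^ α * (1 + (m + 2) * B) + (m + 2) * (K1 * (t - s) ^ α)) := by gcongr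
    _ = _ := by rw [hK3]; ring
end

section
structure Good (β : ℝ) (g : FS m) : Prop where
  per : Per g
  cont : Continuous g
  sm : ∀ η > 0, ∃ δ0 > 0, ∀ ε δ, 0 < ε → ε ≤ δ → δ ≤ δ0 → ∀ w v x, |∫ τ in ε..δ, D2 w v (sc β τ) g x| ≤ η
lemma Good.pl (h : Good β g) : PL g := PL.of_cont h.per h.cont
lemma Zb (hj : 0 < β) (hg : PL g) (w v : OF m) (x : Spc m) (hε : 0 < ε) (h : ε ≤ δ) :
    ContinuousOn (fun τ => D2 w v (sc β τ) g x) (uIcc ε δ) := by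
  rw [uIcc_of_le h]
  have pos : ∀ τ ∈ Icc ε δ, 0 < sc β τ := fun τ hτ => Wb hj (hε.trans_le hτ.1)
  have ci : ContinuousOn (fun τ => (sc β τ)⁻¹) (Icc ε δ) := (Wf β).continuousOn.inv₀ fun τ hτ => (pos τ hτ).ne'
  exact ci.mul (ci.mul ((Nj (Tj w v).ker hg).comp (f := fun τ => (sc β τ, x)) ((Wf β).continuousOn.prodMk continuousOn_const) pos))
lemma Zc (hj : 0 < β) (hg : PL g) (w v : OF m) (x : Spc m) (hε : 0 < ε) (h : ε ≤ δ) :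
    IntervalIntegrable (fun τ => D2 w v (sc β τ) g x) volume ε δ := (Zb hj hg w v x hε h).intervalIntegrable
lemma Zd (hj : 0 < β) (hg : PL g) (x : Spc m) (hε : 0 < ε) (h : ε ≤ δ) :
    ∫ τ in ε..δ, ∑ v, D2 v v (sc β τ) g x = β * (Ah (sc β δ) g x - Ah (sc β ε) g x) := by
  have hc : ContinuousOn (fun τ => β⁻¹ * ∑ v, D2 v v (sc β τ) g x) (uIcc ε δ) :=
    continuousOn_const.mul (continuousOn_finsetSum _ fun v _ => Zb hj hg v v x hε h)
  have := intervalIntegral.integral_eq_sub_of_hasDerivAt (a := ε) (b := δ) (fun τ hτ => Wk hj hg (by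
    rw [uIcc_of_le h] at hτ; exact hε.trans_le hτ.1) x) hc.intervalIntegrable
  rw [← this, intervalIntegral.integral_const_mul, mul_inv_cancel_left₀ hj.ne']
lemma Ze (β : ℝ) (hr : 0 < r) : ∃ δ0 > 0, ∀ τ, 0 ≤ τ → τ ≤ δ0 → sc β τ ≤ r := by
  obtain ⟨δ, hδ, h⟩ := Metric.continuousAt_iff.1 ((Wf β).continuousAt (x := 0)) r hr
  refine ⟨δ / 2, by positivity, fun τ h0 h1 => ?_⟩
  have := @h τ (by rw [dist_eq, sub_zero, abs_of_nonneg h0]; linarith)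
  rw [dist_eq, We, sub_zero] at this
  exact (le_abs_self _).trans this.le
lemma Zf (hj : 0 < β) (hp : Per g) (hg : Continuous g) (hv : 0 < η) : ∃ δ0 > 0, ∀ ε, 0 ≤ ε → ε ≤ δ0 → ∀ x, |Ah (sc β ε) g x - g x| ≤ η := by
  obtain ⟨r, hr, h⟩ := Qx hp hg hv
  obtain ⟨δ, hδ, h'⟩ := Ze β hr
  exact ⟨δ, hδ, fun ε h0 h1 => h _ (Wc _ _) (h' ε h0 h1)⟩
lemma Zg (hj : 0 < β) (hp : Per g) (hg : Continuous g) (hv : 0 < η) : ∃ δ0 > 0, ∀ ε δ, 0 < ε → ε ≤ δ → δ ≤ δ0 → ∀ x,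
    |∫ τ in ε..δ, ∑ v, D2 v v (sc β τ) g x| ≤ η := by
  obtain ⟨δ0, h0, h⟩ := Zf hj hp hg (η := η / (2 * β)) byp
  refine ⟨δ0, h0, fun ε δ hε hεδ hδ x => ?_⟩
  rw [Zd hj (PL.of_cont hp hg) x hε hεδ, abs_mul, aop hj]
  have e1 := abs_le.1 (h ε hε.le (hεδ.trans hδ) x)
  have e2 := abs_le.1 (h δ (hε.le.trans hεδ) hδ x)
  have : |Ah (sc β δ) g x - Ah (sc β ε) g x| ≤ η / β := by
    have e3 : η / (2 * β) + η / (2 * β) = η / β := by field_simp; ring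
    rw [abs_le]; constructor <;> linarith
  calc _ ≤ β * (η / β) := by gcongr
    _ = η := mul_div_cancel₀ _ hj.ne'
lemma Good.x1 (hj : 0 < β) (hp : Per g) (hg : Continuous g) (h1 : ∀ x y : Spc m, x.1 = y.1 → g x = g y) : Good β g := by
  refine ⟨hp, hg, fun η hv => ?_⟩
  have P := PL.of_cont hp hg
  have z1 : ∀ c, 0 < c → ∀ i, Dh (some i) c g = fun _ => 0 := fun c hc i => by
    rw [← Tf hc P]
    ext x
    have hd := (Td hc P).differentiable one_ne_zero x
    have e : (fun t : ℝ => Ah c g (x + t • ev (some i))) = fun _ => Ah c g x := by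
      ext t
      refine integral_congr_ae (ae_of_all _ fun z => ?_)
      dsimp only
      rw [h1 (x + t • ev (some i) + c • z) (x + c • z) (by simp [ev, eC])]
    have := hd.hasFDerivAt.hasLineDerivAt (ev (some i))
    rw [HasLineDerivAt, e] at this
    exact (this.unique (hasDerivAt_const _ _))
  have z2 : ∀ c, 0 < c → ∀ w i x, D2 w (some i) c g x = 0 := fun c hc w i x => by
    rw [← Tn hc P, z1 c hc i]; simp [pd]
  obtain ⟨δ0, h0, h⟩ := Zg hj hp hg hv
  refine ⟨δ0, h0, fun ε δ hε hεδ hδ w v x => ?_⟩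
  have pos : ∀ τ ∈ uIcc ε δ, 0 < sc β τ := fun τ hτ => by rw [uIcc_of_le hεδ] at hτ; exact Wb hj (hε.trans_le hτ.1)
  match w, v with
  | w, some i => rw [intervalIntegral.integral_congr (g := fun _ => 0) (fun τ hτ => z2 _ (pos τ hτ) w i x)]; simpa using hv.le
  | some i, none =>
    rw [intervalIntegral.integral_congr (g := fun _ => 0) (fun τ hτ => by dsimp only; rw [Tl]; exact z2 _ (pos τ hτ) none i x)]; simpa using hv.le
  | none, none =>
    rw [intervalIntegral.integral_congr (g := fun τ => ∑ v, D2 v v (sc β τ) g x) (fun τ hτ => by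
      dsimp only
      rw [Fintype.sum_option, Finset.sum_eq_zero (fun i _ => z2 _ (pos τ hτ) _ i x), add_zero])]
    exact h ε δ hε hεδ hδ x
lemma Zh (hp : Per h) (hh : ContDiff ℝ 1 h) (w v u : OF m) (hs : 0 < s) :
    D2 w v s (pdv u h) = D2 w u s (pdv v h) := by
  have hb : 0 < s / Real.sqrt 2 := by positivity
  have e : (s / Real.sqrt 2) ^ 2 + (s / Real.sqrt 2) ^ 2 = s ^ 2 := by rw [div_pow, Real.sq_sqrt byn]; ring
  ext x
  rw [Tt (PL.pd1 hp hh u) hb hb hs e, Tt (PL.pd1 hp hh v) hb hb hs e, ← Tw hp hh v u hb, ← Tw hp hh u v hb, Tl]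
lemma Zi (hV : ContDiff ℝ 2 V) (u v : Spc m) : pd u (pd v V) = pd v (pd u V) := by
  ext x
  have hd : DifferentiableAt ℝ (fderiv ℝ V) x := (hV.fderiv_right (m := 1) byn).differentiable one_ne_zero x
  have e : ∀ u v, pd u (pd v V) x = fderiv ℝ (fderiv ℝ V) x u v := fun u v => by
    unfold pd
    rw [fderiv_clm_apply hd (differentiableAt_const _)]
    simp
  rw [e, e]
  exact (hV.contDiffAt.isSymmSndFDerivAt (by simp)) u v
lemma Zj (hc : 0 < c) (hf : PL f) (hg : PL g) (w v : OF m) (x : Spc m) :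
    D2 w v c (fun x => f x + g x) x = D2 w v c f x + D2 w v c g x := by
  unfold D2
  rw [Wm (Tj w v).ker hc hf hg]; ring
lemma Good.add (hj : 0 < β) (hf : Good β f) (hg : Good β g) : Good β (fun x => f x + g x) := by
  refine ⟨hf.per.add hg.per, hf.cont.add hg.cont, fun η hv => ?_⟩
  obtain ⟨δ1, h1, h1'⟩ := hf.sm (η / 2) byp
  obtain ⟨δ2, h2, h2'⟩ := hg.sm (η / 2) byp
  refine ⟨min δ1 δ2, lt_min h1 h2, fun ε δ hε hεδ hδ w v x => ?_⟩
  rw [intervalIntegral.integral_congr (g := fun τ => D2 w v (sc β τ) f x + D2 w v (sc β τ) g x) (fun τ hτ => by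
    rw [uIcc_of_le hεδ] at hτ; exact Zj (Wb hj (hε.trans_le hτ.1)) hf.pl hg.pl w v x),
    intervalIntegral.integral_add (Zc hj hf.pl w v x hε hεδ) (Zc hj hg.pl w v x hε hεδ)]
  refine (abs_add_le _ _).trans ?_
  linarith [h1' ε δ hε hεδ (hδ.trans (min_le_left _ _)) w v x, h2' ε δ hε hεδ (hδ.trans (min_le_right _ _)) w v x]
lemma Good.sum (hj : 0 < β) {ι : Type*} (s : Finset ι) {f : ι → FS m} (hf : ∀ i, Good β (f i)) : Good β (fun x => ∑ i ∈ s, f i x) := by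
  classical
  induction s using Finset.induction_on with
  | empty => simpa using Good.x1 hj (g := fun _ : Spc m => (0:ℝ)) (fun _ _ _ => rfl) continuous_const fun _ _ _ => rfl
  | insert i s hi ih => simp only [Finset.sum_insert hi]; exact (hf i).add hj ih
lemma Zk (hc : 0 < c) (s : Finset (OF m)) {f : OF m → FS m} (hf : ∀ i, Per (f i) ∧ Continuous (f i)) (w v : OF m) (x : Spc m) :
    D2 w v c (fun x => ∑ i ∈ s, f i x) x = ∑ i ∈ s, D2 w v c (f i) x := by
  unfold D2 Kop
  simp only [mul_sum]
  rw [integral_finsetSum _ fun i _ => Ni (Tj w v).ker hc (PL.of_cont (hf i).1 (hf i).2) x]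
  simp only [mul_sum]
lemma Good.lapV (hj : 0 < β) (hV : ContDiff ℝ 2 V) (hVp : Per V) : Good β (lap V) := by
  refine ⟨Xt hVp, Xr hV, fun η hv => ?_⟩
  have hh := fun w v : OF m => Zg hj (Ql (Ql hVp (ev v)) (ev w)) (Xq hV (ev v) (ev w)) hv
  choose δ0 h0 h using hh
  obtain ⟨δ1, hδ1, h1⟩ : ∃ δ1 > 0, ∀ w v, δ1 ≤ δ0 w v := by
    obtain ⟨q, -, hq⟩ := Finset.exists_min_image Finset.univ (fun q : OF m × OF m => δ0 q.1 q.2) ⟨(none, none), Finset.mem_univ _⟩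
    exact ⟨δ0 q.1 q.2, h0 _ _, fun w v => hq (w, v) (Finset.mem_univ _)⟩
  refine ⟨δ1, hδ1, fun ε δ hε hεδ hδ w v x => ?_⟩
  have e : lap V = fun x => ∑ u : OF m, pdv u (pdv u V) x := funext fun x => Ty V x
  have P := fun u : OF m => Ql hVp (ev u)
  have C := fun u : OF m => Xo hV (ev u)
  rw [intervalIntegral.integral_congr (g := fun τ => ∑ u, D2 u u (sc β τ) (pdv w (pdv v V)) x) (fun τ hτ => ?_)]
  · exact h w v ε δ hε hεδ (hδ.trans (h1 w v)) x
  · rw [uIcc_of_le hεδ] at hτ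
    have hc := Wb hj (hε.trans_le hτ.1)
    dsimp only
    rw [e, Zk hc Finset.univ (fun u => ⟨Ql (P u) _, Xq hV _ _⟩)]
    refine sum_congr rfl fun u _ => ?_
    rw [Zh (P u) (C u) w v u hc, Zi hV, Tl, Zh (P v) (C v) u w u hc]
lemma Good.mul (hj : 0 < β) (hfp : Per f) (h0 : 0 < γ) (h1 : γ ≤ 1) (hf : Hol γ H f) (hg : Good β g) : Good β (fun x => f x * g x) := by
  have fc := hf.cont h0
  have P : PL (fun x => f x * g x) := PL.of_cont (hfp.mul hg.per) (fc.mul hg.cont)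
  refine ⟨hfp.mul hg.per, fc.mul hg.cont, fun η hv => ?_⟩
  obtain ⟨A, hA, hA'⟩ := Qh hfp fc
  obtain ⟨B, hB, hB'⟩ := Qh hg.per hg.cont
  have hH : 0 ≤ H := by
    have := (anz _).trans (hf 0 (e1 m)); have e : ‖e1 m‖ = 1 := by simp [e1, Prod.norm_def]
    rwa [e, Real.one_rpow, mul_one] at this
  have hG := Nn m
  set K := 256 * G4 m * (H * B) * (2 / β) ^ ((γ - 2) / 2) with hK
  have hK0 : 0 ≤ K := by positivity
  have R : ∀ τ, 0 < τ → ∀ w v x, |D2 w v (sc β τ) (fun x => f x * g x) x - f x * D2 w v (sc β τ) g x| ≤ K * τ ^ ((γ - 2) / 2) := fun τ hτ w v x => by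
    set c := sc β τ with hc'
    have hc : 0 < c := Wb hj hτ
    have e : D2 w v c (fun x => f x * g x) x - f x * D2 w v c g x = c⁻¹ * (c⁻¹ * ∫ z, kk w v z * ((f (x + c • z) - f x) * g (x + c • z))) := by
      have i1 := Ni (Tj w v).ker hc P x
      have i2 := (Ni (Tj w v).ker hc hg.pl x).const_mul (f x)
      rw [D2, D2, Kop, Kop, show (fun z => kk w v z * ((f (x + c • z) - f x) * g (x + c • z))) = fun z => kk w v z * (f (x + c • z) * g (x + c • z)) - f x * (kk w v z * g (x + c • z)) by ext z; ring,
        integral_sub i1 i2, icm]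
      ring
    have i := Qu (Tj w v) (F := fun z => (f (x + c • z) - f x) * g (x + c • z)) (α := H * c ^ γ * B) byp fun z => by
      rw [abs_mul]
      calc _ ≤ (H * (c ^ γ * (1 + ‖z‖))) * B := mul_le_mul ((hf x (c • z)).trans (by gcongr; exact Qy hc.le h0.le h1 z)) (hB' _) (anz _) byp
        _ = _ := by ring
    rw [e, abs_mul, abs_mul, aop (inv_pos.2 hc)]
    calc _ ≤ c⁻¹ * (c⁻¹ * (256 * G4 m * (H * c ^ γ * B))) := by gcongr
      _ = 256 * G4 m * (H * B) * c ^ (γ - 2) := by rw [Real.rpow_sub hc, Real.rpow_ofNat]; field_simp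
      _ = _ := by rw [hc', Wi hj hτ.le, hK]; ring
  clear_value K
  obtain ⟨δ1, hδ1, hs⟩ := hg.sm (η / (2 * (A + 1))) byp
  have lim : Tendsto (fun δ : ℝ => K * (δ ^ (γ / 2) / (γ / 2))) (nhds 0) (nhds 0) := by
    have : Continuous (fun δ : ℝ => K * (δ ^ (γ / 2) / (γ / 2))) := ccm ((Real.continuous_rpow_const byp).div_const _)
    have := this.tendsto 0
    rwa [Real.zero_rpow byp, zero_div, mul_zero] at this
  obtain ⟨δ2, hδ2, hs2⟩ := Metric.eventually_nhds_iff.1 (lim.eventually (gt_mem_nhds (half_pos hv)))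
  refine ⟨min δ1 (δ2 / 2), by positivity, fun ε δ hε hεδ hδ w v x => ?_⟩
  have hδ' : 0 < δ := hε.trans_le hεδ
  have I1 := Zc hj P w v x hε hεδ
  have I2 := (Zc hj hg.pl w v x hε hεδ).const_mul (f x)
  have e := intervalIntegral.integral_sub I1 I2
  have b1 : |∫ τ in ε..δ, (D2 w v (sc β τ) (fun x => f x * g x) x - f x * D2 w v (sc β τ) g x)| ≤ η / 2 := by
    refine (intervalIntegral.norm_integral_le_of_norm_le (f := fun τ => D2 w v (sc β τ) (fun x => f x * g x) x - f x * D2 w v (sc β τ) g x) (g := fun τ => K * τ ^ ((γ - 2) / 2)) hεδ (ae_of_all _ fun τ hτ => R τ (hε.trans hτ.1) w v x)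
      ((intervalIntegral.intervalIntegrable_rpow' (r := (γ - 2) / 2) byl).const_mul K)).trans ?_
    rw [intervalIntegral.integral_const_mul, integral_rpow (Or.inl byl), show (γ - 2) / 2 + 1 = γ / 2 by ring]
    have q := hs2 (y := δ) (by rw [dist_eq, sub_zero, aop hδ']; linarith [hδ.trans (min_le_right _ _)])
    have q2 : K * ((δ ^ (γ / 2) - ε ^ (γ / 2)) / (γ / 2)) ≤ K * (δ ^ (γ / 2) / (γ / 2)) := by
      gcongr; linarith [Real.rpow_nonneg hε.le (γ / 2)]
    linarith
  have b2 : |∫ τ in ε..δ, f x * D2 w v (sc β τ) g x| ≤ η / 2 := by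
    rw [intervalIntegral.integral_const_mul, abs_mul]
    calc _ ≤ (A + 1) * (η / (2 * (A + 1))) := mul_le_mul ((hA' x).trans byl) (hs ε δ hε hεδ (hδ.trans (min_le_left _ _)) w v x) (anz _) byp
      _ = η / 2 := by field_simp
  have : ∫ τ in ε..δ, D2 w v (sc β τ) (fun x => f x * g x) x = (∫ τ in ε..δ, (D2 w v (sc β τ) (fun x => f x * g x) x - f x * D2 w v (sc β τ) g x)) + ∫ τ in ε..δ, f x * D2 w v (sc β τ) g x := by
    rw [e]; ring
  rw [this]
  refine (abs_add_le _ _).trans byl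
lemma Good.of_hol (hj : 0 < β) (hfp : Per f) (h0 : 0 < γ) (h1 : γ ≤ 1) (hf : Hol γ H f) : Good β f := by
  simpa using Good.mul hj hfp h0 h1 hf (Good.x1 hj (g := fun _ => (1:ℝ)) (fun _ _ _ => rfl) continuous_const fun _ _ _ => rfl)
lemma Good.Gop (hj : 0 < β) (hV : ContDiff ℝ 2 V) (hVp : Per V) (hp : Per χ) (hd : Differentiable ℝ χ) (hb : ∀ v x, |pdv v χ x| ≤ B)
    (h0 : 0 < γ) (h1 : γ ≤ 1) (hh : ∀ v, Hol γ H (pdv v χ)) (hM : ∀ x, avg χ x ≠ 0) : Good β (Gop V χ) := by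
  obtain ⟨K, -, hK⟩ := Yh hV hVp
  have c1 := fun v => (hh v).cont h0
  have cA := (Ym hp hd.continuous).inv₀ hM
  have pA := (Xl hp).comp fun t => t⁻¹
  have pV := Ql hVp (e1 m)
  have cV := (Xo hV (e1 m)).continuous
  have p1 : Per (avg fun z => pdo m V z * χ z) := Xl (pV.mul hp)
  have k1 : Continuous (avg fun z => pdo m V z * χ z) := Ym (pV.mul hp) (cV.mul hd.continuous)
  have p2 : Per (fun z => pdo m (pdo m V) z * χ z + pdo m V z * pdo m χ z) := ((Ql pV _).mul hp).add (pV.mul (Ql hp _))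
  have k2 : Continuous (fun z => pdo m (pdo m V) z * χ z + pdo m V z * pdo m χ z) := ((Xq hV _ _).mul hd.continuous).add (cV.mul (c1 none))
  have p3 : Per (avg (pdo m χ)) := Xl (Ql hp _)
  have k3 : Continuous (avg (pdo m χ)) := Ym (Ql hp _) (c1 none)
  have av : ∀ (g : FS m) (x y : Spc m), x.1 = y.1 → avg g x = avg g y := fun g x y h => by simp only [avg, h]
  have Q1 : Good β (fun x => (avg χ x)⁻¹ * (avg χ x)⁻¹ * avg (fun z => pdo m V z * χ z) x * avg (pdo m χ) x
      - (avg χ x)⁻¹ * avg (fun z => pdo m (pdo m V) z * χ z + pdo m V z * pdo m χ z) x) :=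
    Good.x1 hj ((((pA.mul pA).mul p1).mul p3).sub (pA.mul (Xl p2))) ((((cA.mul cA).mul k1).mul k3).sub (cA.mul (Ym p2 k2)))
      fun x y h => by simp only [av _ x y h]
  have Q2 : Good β (fun x => (0:ℝ) - (avg χ x)⁻¹ * avg (fun z => pdo m V z * χ z) x) :=
    Good.x1 hj (Per.sub (fun _ _ _ => rfl) (pA.mul p1)) (continuous_const.sub (cA.mul k1)) fun x y h => by simp only [av _ x y h]
  have G0 : Good β (fun x => ∑ v : OF m, pdv v χ x * pdv v V x) := Good.sum hj _ fun v => Good.mul hj (Ql hp _) h0 h1 (hh v)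
    (Good.of_hol hj (Ql hVp _) one_pos le_rfl (hol1 ((Xo hV (ev v)).differentiable one_ne_zero) fun w x => (hK x).2.1 v w))
  have hχ := hol1 hd hb
  have := ((G0.add hj (Good.mul hj hp one_pos le_rfl hχ (Good.lapV hj hV hVp))).add hj (Good.mul hj hp one_pos le_rfl hχ Q1)).add hj (Good.mul hj (Ql hp (ev none)) h0 h1 (hh none) Q2)
  convert this using 1
  ext x
  have e : gradDot V χ x = ∑ v : OF m, pdv v χ x * pdv v V x := by
    rw [Xu]; exact sum_congr rfl fun v _ => mul_comm _ _
  rw [_root_.Gop, e, show ev none = e1 m from rfl]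
  ring
end

section
lemma Zl (hc : 0 < c) (hf : PL f) (hg : PL g) (w v : OF m) (x : Spc m) :
    D2 w v c (fun x => f x - g x) x = D2 w v c f x - D2 w v c g x := by
  unfold D2; rw [Wn (Tj w v).ker hc hf hg]; ring
lemma Seg.step (h : Seg V β p a b B ψ) {t' : ℝ} (har : a ≤ r) (hrt : r < t') (htt : t' < t) (htb : t ≤ b) (w v : OF m) (x : Spc m) :
    D2 w v (sc β (t - t')) (ψ t') x = D2 w v (sc β (t - r)) (ψ r) x + ∫ s in Ioo r t', D2 w v (sc β (t - s)) (Gop V (ψ s)) x := by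
  have hj := h.hj
  have hr : r ∈ Icc a b := ⟨har, by linarith⟩
  have p1 := sp2 hrt
  have p2 := sp2 htt
  have e : ψ t' = fun x => Ah (sc β (t' - r)) (ψ r) x + U β r t' (fun s => Gop V (ψ s)) x := funext fun x => h.restart har hrt byl x
  rw [e, Zj (Wb hj p2) (Tq (h.pl hr) (Wb hj p1)) (Xg hj h.hp h.ha h.lc har hrt.le byl),
    Tr (h.pl hr) (Wb hj p2) (Wb hj p1) (Wb hj (by linarith : 0 < t - r)) (by rw [Wh hj p2.le p1.le]; congr 2; ring),
    Xj hj h.hp h.ha h.lc har hrt.le byl p2]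
  congr 2; ext s; congr 2; ring
lemma Seg2.dec (h : Seg2 V β p a b B α H ψ) : ∃ K, 0 ≤ K ∧ ∀ t ≤ b, ∀ r t', a ≤ r → r < t' → t' < t → ∀ w v x,
    |D2 w v (sc β (t - t')) (ψ t') x - D2 w v (sc β (t - r)) (ψ r) x - ∫ τ in (t - t')..(t - r), D2 w v (sc β τ) (Gop V (ψ t)) x| ≤ K * (t - r) ^ α := by
  have hj := h.hj
  have hp1 := (Xa h.hp).2.2
  have hG := Nn m
  have hH := h.hH
  have hα := h.hα
  set K0 := 256 * G4 m * H * (β / 2) with hK0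
  have hK0' : 0 ≤ K0 := by positivity
  refine ⟨K0 * (1 / (α - 1 + 1)), mul_nonneg hK0' (by norm_num; positivity), fun t htb r t' har hrt htt w v x => ?_⟩
  have ht : t ∈ Icc a b := ⟨by linarith, htb⟩
  have pt : PL (Gop V (ψ t)) := h.lc.pl hp1.le ht
  have sub : Ioo r t' ⊆ Ioo r t := Ioo_subset_Ioo_right htt.le
  have b1 : ∀ s ∈ Ioo r t, |D2 w v (sc β (t - s)) (Gop V (ψ s)) x - D2 w v (sc β (t - s)) (Gop V (ψ t)) x| ≤ K0 * (t - s) ^ (α - 1) := fun s hs => by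
    have q := sp2 hs.2
    have ho : s ∈ Icc a b := ⟨har.trans hs.1.le, hs.2.le.trans htb⟩
    rw [← Zl (Wb hj q) (h.lc.pl hp1.le ho) pt]
    refine (Tu (fun x => by rw [abs_sub_comm]; exact h.tf s ho t ht hs.2 x) w v (Wb hj q) x).trans_eq ?_
    rw [← mul_inv, ← sq, Wd hj q.le, Real.rpow_sub_one q.ne', hK0]; field_simp
  have c2 : ContinuousOn (fun s => D2 w v (sc β (t - s)) (Gop V (ψ t)) x) (Ioo r t) := fun s hs => by
    have q := sp2 hs.2
    have := (Zb hj pt w v x (ε := (t - s) / 2) (δ := t - s + 1) byl byl).continuousAt (x := t - s)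
      (by rw [uIcc_of_le byl]; exact Icc_mem_nhds byl byl)
    exact (ContinuousAt.comp (f := fun s => t - s) this byf).continuousWithinAt
  have c1 := (Wv hj hp1 h.lc w v t x).mono (Wz har htb)
  obtain ⟨I1, -⟩ := Wy byl (by linarith : -1 < α - 1) (c1.fun_sub c2) b1
  have I2 : IntegrableOn (fun s => D2 w v (sc β (t - s)) (Gop V (ψ t)) x) (Ioo r t') := by
    have : ContinuousOn (fun s => D2 w v (sc β (t - s)) (Gop V (ψ t)) x) (Icc r t') :=
      (Zb hj pt w v x (sp2 htt) (by linarith : t - t' ≤ t - r)).comp (f := fun s => t - s) byf fun s hs => by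
        rw [uIcc_of_le byl]; exact ⟨by linarith [hs.2], by linarith [hs.1]⟩
    exact this.integrableOn_Icc.mono_set Ioo_subset_Icc_self
  have e1 : ∫ s in Ioo r t', D2 w v (sc β (t - s)) (Gop V (ψ t)) x = ∫ τ in (t - t')..(t - r), D2 w v (sc β τ) (Gop V (ψ t)) x := by
    rw [← intervalIntegral.integral_comp_sub_left (fun τ => D2 w v (sc β τ) (Gop V (ψ t)) x) t, intervalIntegral.integral_of_le hrt.le, integral_Ioc_eq_integral_Ioo]
  have e2 : ∫ s in Ioo r t', D2 w v (sc β (t - s)) (Gop V (ψ s)) x = (∫ s in Ioo r t', (D2 w v (sc β (t - s)) (Gop V (ψ s)) x - D2 w v (sc β (t - s)) (Gop V (ψ t)) x)) +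
      ∫ s in Ioo r t', D2 w v (sc β (t - s)) (Gop V (ψ t)) x := by
    rw [← integral_add (I1.mono_set sub) I2]; simp
  obtain ⟨P1, P2⟩ := Wx (a := r) (t := t) (e := α - 1) byl byl
  rw [h.step har hrt htt htb, e2, ← e1, add_sub_cancel_left, add_sub_cancel_right]
  calc |∫ s in Ioo r t', (D2 w v (sc β (t - s)) (Gop V (ψ s)) x - D2 w v (sc β (t - s)) (Gop V (ψ t)) x)| ≤ ∫ s in Ioo r t', K0 * (t - s) ^ (α - 1) := norm_integral_le_of_norm_le (f := fun s => D2 w v (sc β (t - s)) (Gop V (ψ s)) x - D2 w v (sc β (t - s)) (Gop V (ψ t)) x) ((P1.mono_set sub).const_mul K0)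
        ((ae_restrict_iff' measurableSet_Ioo).2 (ae_of_all _ fun s hs => b1 s (sub hs)))
    _ ≤ ∫ s in Ioo r t, K0 * (t - s) ^ (α - 1) := setIntegral_mono_set (P1.const_mul K0) ((ae_restrict_iff' measurableSet_Ioo).2 (ae_of_all _ fun s hs =>
        mul_nonneg hK0' (Real.rpow_nonneg (sp2 hs.2).le _))) sub.eventuallyLE
    _ = K0 * (1 / (α - 1 + 1)) * (t - r) ^ α := by rw [icm, P2, sub_add_cancel]; ring
lemma ucauchy {X : Type*} {g : ℝ → X → ℝ} (h : ∀ η > 0, ∃ δ0 > 0, ∀ ε δ, 0 < ε → ε < δ → δ ≤ δ0 → ∀ x, |g ε x - g δ x| ≤ η) :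
    ∃ L : X → ℝ, ∀ η > 0, ∃ δ0 > 0, ∀ ε, 0 < ε → ε ≤ δ0 → ∀ x, |g ε x - L x| ≤ η := by
  have h' : ∀ η > 0, ∃ δ0 > 0, ∀ ε δ, 0 < ε → ε ≤ δ0 → 0 < δ → δ ≤ δ0 → ∀ x, |g ε x - g δ x| ≤ η := fun η hv => by
    obtain ⟨δ0, h0, k⟩ := h η hv
    refine ⟨δ0, h0, fun ε δ h1 h2 h3 h4 x => ?_⟩
    rcases lt_trichotomy ε δ with l | l | l
    · exact k ε δ h1 l h4 x
    · rw [l, sub_self, abs_zero]; exact hv.le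
    · rw [abs_sub_comm]; exact k δ ε h3 l h2 x
  have T : ∀ x, ∃ l, Tendsto (fun ε => g ε x) (nhdsWithin 0 (Ioi 0)) (nhds l) := fun x => by
    refine cauchy_map_iff_exists_tendsto.1 (Metric.cauchy_iff.2 ⟨inferInstance, fun η hv => ?_⟩)
    obtain ⟨δ0, h0, k⟩ := h' (η / 2) (half_pos hv)
    refine ⟨_, image_mem_map (Ioc_mem_nhdsGT h0), ?_⟩
    rintro _ ⟨ε, hε, rfl⟩ _ ⟨δ, hδ, rfl⟩
    exact (k ε δ hε.1 hε.2 hδ.1 hδ.2 x).trans_lt (half_lt_self hv)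
  choose L hL using T
  refine ⟨L, fun η hv => ?_⟩
  obtain ⟨δ0, h0, k⟩ := h' η hv
  refine ⟨δ0, h0, fun ε h1 h2 x => ?_⟩
  refine le_of_tendsto ((tendsto_const_nhds.sub (hL x)).abs) ?_
  filter_upwards [Ioc_mem_nhdsGT h0] with δ hδ using k ε δ h1 h2 hδ.1 hδ.2 x
lemma Seg2.c2 (h : Seg2 V β p a b B α H ψ) : ∃ K, 0 ≤ K ∧ ∀ t ≤ b, a < t → Good β (Gop V (ψ t)) → (∀ v, ContDiff ℝ 1 (pdv v (ψ t))) ∧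
    ∀ r, a ≤ r → r < t → ∀ x, |lap (ψ t) x + β * Gop V (ψ t) x - ∑ v, D2 v v (sc β (t - r)) (ψ r) x - β * Ah (sc β (t - r)) (Gop V (ψ t)) x| ≤ K * (t - r) ^ α := by
  obtain ⟨K, hK, dec⟩ := h.dec
  have hj := h.hj
  have hα := h.hα
  have hH := h.hH
  have hG := Nn m
  refine ⟨(m + 1) * K, by positivity, fun t htb hat hg => ?_⟩
  have ht : t ∈ Icc a b := ⟨hat.le, htb⟩
  have mem : ∀ ε, 0 < ε → ε ≤ t - a → t - ε ∈ Icc a b := fun ε h0 h1 => ⟨by linarith, by linarith⟩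
  have pw : ∀ C η : ℝ, 0 ≤ C → 0 < η → ∃ δ0 > 0, ∀ δ, 0 < δ → δ ≤ δ0 → C * δ ^ α ≤ η := fun C η hC hv => by
    have c : Continuous (fun δ : ℝ => C * δ ^ α) := ccm (Real.continuous_rpow_const hα.le)
    have lim := c.tendsto 0
    rw [Real.zero_rpow hα.ne', mul_zero] at lim
    obtain ⟨δ2, hδ2, hs2⟩ := Metric.eventually_nhds_iff.1 (lim.eventually (gt_mem_nhds hv))
    exact ⟨δ2 / 2, half_pos hδ2, fun δ h0 h1 => (hs2 (y := δ) (by rw [dist_eq, sub_zero, aop h0]; linarith)).le⟩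
  have UC : ∀ w v, ∃ L : FS m, ∀ η > 0, ∃ δ0 > 0, ∀ ε, 0 < ε → ε ≤ δ0 → ∀ x, |D2 w v (sc β ε) (ψ (t - ε)) x - L x| ≤ η := fun w v => by
    refine ucauchy (g := fun ε x => D2 w v (sc β ε) (ψ (t - ε)) x) fun η hv => ?_
    obtain ⟨δ1, hδ1, k1⟩ := hg.sm (η / 2) (half_pos hv)
    obtain ⟨δ2, hδ2, k2⟩ := pw K (η / 2) hK (half_pos hv)
    refine ⟨min (t - a) (min δ1 δ2), lt_min (sp2 hat) (lt_min hδ1 hδ2), fun ε δ h0 h1 h2 x => ?_⟩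
    have := dec t htb (t - δ) (t - ε) (by linarith [h2.trans (min_le_left _ _)]) byl byl w v x
    simp only [_root_.sub_sub_cancel] at this
    have e1 := k1 ε δ h0 h1.le (h2.trans ((min_le_right _ _).trans (min_le_left _ _))) w v x
    have e2 := k2 δ (h0.trans h1) (h2.trans ((min_le_right _ _).trans (min_le_right _ _)))
    rw [abs_le] at *; constructor <;> linarith
  choose L hL using UC
  have Lc : ∀ w v, Continuous (L w v) := fun w v => by
    refine (TendstoUniformly.continuous (F := fun ε x => D2 w v (sc β ε) (ψ (t - ε)) x) (p := nhdsWithin (0:ℝ) (Ioi 0)) ?_ ?_)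
    · refine Metric.tendstoUniformly_iff.2 fun η hv => ?_
      obtain ⟨δ0, h0, k⟩ := hL w v (η / 2) (half_pos hv)
      filter_upwards [Ioc_mem_nhdsGT h0] with ε hε x
      rw [dist_comm]; exact (k ε hε.1 hε.2 x).trans_lt (half_lt_self hv)
    · refine Eventually.frequently ?_
      filter_upwards [Ioc_mem_nhdsGT (sp2 hat)] with ε hε
      exact To (Wb hj hε.1) (h.pl (mem ε hε.1 hε.2)) w v
  have D : ∀ v x, HasFDerivAt (pdv v (ψ t)) (∑ w, L w v x • co w) x := fun v x0 => by
    refine hasFDerivAt_of_tendstoUniformlyOnFilter (g := pdv v (ψ t)) (g' := fun x => ∑ w, L w v x • co w) (l := nhdsWithin (0:ℝ) (Ioi 0)) (f := fun ε => Dh v (sc β ε) (ψ (t - ε))) (f' := fun ε x => ∑ w, D2 w v (sc β ε) (ψ (t - ε)) x • co w) (TendstoUniformly.tendstoUniformlyOnFilter ?_ |>.mono_right le_top) ?_ (evf fun x => ?_)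
    · refine Metric.tendstoUniformly_iff.2 fun η hv => ?_
      choose δ0 h0 k using fun w => hL w v (η / (2 * (m + 1))) byp
      have : ∀ᶠ ε in nhdsWithin (0:ℝ) (Ioi 0), ∀ w, ε ∈ Ioc 0 (δ0 w) := eventually_all.2 fun w => Ioc_mem_nhdsGT (h0 w)
      filter_upwards [this] with ε hε x
      rw [dist_comm, dist_eq_norm, ← sum_sub_distrib]
      calc _ ≤ ∑ w : OF m, η / (2 * (m + 1)) := norm_sum_le_of_le _ fun w _ => by
            rw [← sub_smul, norm_smul]
            exact (mul_le_mul (k w ε (hε w).1 (hε w).2 x) (Kk w) (norm_nonneg _) byp).trans_eq (mul_one _)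
        _ = η / 2 := by
          rw [Finset.sum_const, Finset.card_univ, Fintype.card_option, Fintype.card_fin, nsmul_eq_mul]; push_cast; field_simp
        _ < η := half_lt_self hv
    · refine (Eventually.prod_inl (p := fun ε => ε ∈ Ioc 0 (t - a)) (Ioc_mem_nhdsGT (sp2 hat)) _).mono ?_
      rintro ⟨ε, x⟩ hε
      exact Tm (Wb hj hε.1) (h.pl (mem ε hε.1 hε.2)) v x
    · refine Metric.tendsto_nhds.2 fun η hv => ?_
      have pc := PL.pd1 (h.per t ht) (h.c1 t ht) v
      obtain ⟨δ1, hδ1, k1⟩ := Zf hj (g := pdv v (ψ t)) pc.1 (((h.c1 t ht).continuous_fderiv one_ne_zero).clm_apply continuous_const) (η := η / 4) byp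
      obtain ⟨δ2, hδ2, k2⟩ := pw (4 * G4 m * H) (η / 4) byp byp
      filter_upwards [Ioc_mem_nhdsGT (sp2 hat), Ioc_mem_nhdsGT hδ1, Ioc_mem_nhdsGT hδ2] with ε hε e1 e2
      have hs := mem ε hε.1 hε.2
      have q1 := k1 ε e1.1.le e1.2 x
      have q2 := Ta (f := fun x => pdv v (ψ t) x - pdv v (ψ (t - ε)) x) (fun x => h.tg (t - ε) hs t ht (by linarith [hε.1]) v x) (sc β ε) x
      have q3 : Ah (sc β ε) (fun x => pdv v (ψ t) x - pdv v (ψ (t - ε)) x) x = _ := Wn Ly (Wb hj hε.1) pc (PL.pd1 (h.per _ hs) (h.c1 _ hs) v) x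
      rw [q3, _root_.sub_sub_cancel] at q2
      have q4 := k2 ε e2.1 e2.2
      rw [Tv (h.per _ hs) (h.c1 _ hs) v (Wb hj hε.1), dist_eq]
      change |Ah (sc β ε) (pdv v (ψ t)) x - Ah (sc β ε) (pdv v (ψ (t - ε))) x| ≤ _ at q2
      rw [abs_le] at q1 q2
      rw [abs_lt]; constructor <;> linarith
  have pdL : ∀ w v, pdv w (pdv v (ψ t)) = L w v := fun w v => funext fun x => Te (D v x) w
  refine ⟨fun v => Yw (fun x => (D v x).differentiableAt) fun w => by rw [pdL]; exact Lc w v, fun r har hrt x => ?_⟩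
  have lapL : lap (ψ t) x = ∑ v, L v v x := by rw [Ty]; exact sum_congr rfl fun v _ => by rw [pdL]
  have T1 : Tendsto (fun ε => ∑ v, D2 v v (sc β ε) (ψ (t - ε)) x) (nhdsWithin 0 (Ioi 0)) (nhds (lap (ψ t) x)) := by
    rw [lapL]
    refine tendsto_finsetSum _ fun v _ => Metric.tendsto_nhds.2 fun η hv => ?_
    obtain ⟨δ0, h0, k⟩ := hL v v (η / 2) (half_pos hv)
    filter_upwards [Ioc_mem_nhdsGT h0] with ε hε
    exact (k ε hε.1 hε.2 x).trans_lt (half_lt_self hv)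
  have T2 : Tendsto (fun ε => Ah (sc β ε) (Gop V (ψ t)) x) (nhdsWithin 0 (Ioi 0)) (nhds (Gop V (ψ t) x)) := by
    refine Metric.tendsto_nhds.2 fun η hv => ?_
    obtain ⟨δ0, h0, k⟩ := Zf hj hg.per hg.cont (half_pos hv)
    filter_upwards [Ioc_mem_nhdsGT h0] with ε hε
    exact (k ε hε.1.le hε.2 x).trans_lt (half_lt_self hv)
  have T3 := ((T1.sub_const (∑ v, D2 v v (sc β (t - r)) (ψ r) x)).sub ((T2.const_sub (Ah (sc β (t - r)) (Gop V (ψ t)) x)).const_mul β)).abs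
  have : lap (ψ t) x + β * Gop V (ψ t) x - ∑ v, D2 v v (sc β (t - r)) (ψ r) x - β * Ah (sc β (t - r)) (Gop V (ψ t)) x =
    lap (ψ t) x - ∑ v, D2 v v (sc β (t - r)) (ψ r) x - β * (Ah (sc β (t - r)) (Gop V (ψ t)) x - Gop V (ψ t) x) := by ring
  rw [this]
  refine le_of_tendsto T3 ?_
  have hr := sp2 hrt
  filter_upwards [Ioo_mem_nhdsGT hr] with ε hε
  rw [← Zd hj hg.pl x hε.1 hε.2.le, intervalIntegral.integral_finsetSum fun v _ => Zc hj hg.pl v v x hε.1 hε.2.le, ← sum_sub_distrib, ← sum_sub_distrib]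
  calc _ ≤ ∑ v : OF m, K * (t - r) ^ α := (Finset.abs_sum_le_sum_abs _ _).trans (sum_le_sum fun v _ => by
        have := dec t htb r (t - ε) har (by linarith [hε.2]) (by linarith [hε.1]) v v x
        rwa [_root_.sub_sub_cancel] at this)
    _ = _ := by
      rw [Finset.sum_const, Finset.card_univ, Fintype.card_option, Fintype.card_fin, nsmul_eq_mul]; push_cast; ring
end

def dd (V : FS m) (β : ℝ) (ψ : ℝ → FS m) (t : ℝ) (x : Spc m) : ℝ := β⁻¹ * lap (ψ t) x + Gop V (ψ t) x

section
lemma Seg2.incr (h : Seg2 V β p a b B α H ψ) (hg : ∀ t, a < t → t ≤ b → Good β (Gop V (ψ t))) : ∃ C, 0 ≤ C ∧ ∀ t1 t2 δ, t1 < t2 → t2 ≤ b → 0 < δ → δ ≤ t1 - a → δ ≤ b → ∀ x,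
    |dd V β ψ t2 x - dd V β ψ t1 x| ≤ C * (δ ^ α + (t2 - t1) ^ α * δ ^ (-1 / 2 : ℝ) + (t2 - t1) ^ α) := by
  obtain ⟨K, hK, E⟩ := h.c2
  have hj := h.hj
  have hG := Nn m
  have hH := h.hH
  have hp1 := (Xa h.hp).2.2
  set C1 := (m + 1) * (4 * G4 m * H * (2 / β) ^ (-1 / 2 : ℝ)) with hC1
  set C2 := β * (4 * G4 m * H) with hC2
  have h1 : 0 ≤ C1 := by positivity
  have h2 : 0 ≤ C2 := by positivity
  refine ⟨β⁻¹ * (2 * K + C1 + C2), by positivity, fun t1 t2 δ h12 h2b hδ hδa hδb x => ?_⟩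
  have m1 : t1 ∈ Icc a b := ⟨by linarith, by linarith⟩
  have m2 : t2 ∈ Icc a b := ⟨by linarith, by linarith⟩
  have r1 : t1 - δ ∈ Icc a b := ⟨by linarith, by linarith⟩
  have r2 : t2 - δ ∈ Icc a b := ⟨by linarith, by linarith⟩
  have e1 := (E t1 m1.2 byl (hg t1 byl m1.2)).2 (t1 - δ) r1.1 byl x
  have e2 := (E t2 m2.2 byl (hg t2 byl m2.2)).2 (t2 - δ) r2.1 byl x
  rw [_root_.sub_sub_cancel] at e1 e2
  have sp := Wb hj hδ
  have e3 : |∑ v, D2 v v (sc β δ) (ψ (t2 - δ)) x - ∑ v, D2 v v (sc β δ) (ψ (t1 - δ)) x| ≤ C1 * ((t2 - t1) ^ α * δ ^ (-1 / 2 : ℝ)) := by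
    rw [← sum_sub_distrib]
    calc _ ≤ ∑ v : OF m, 4 * G4 m * (H * (t2 - t1) ^ α) * ((2 / β) ^ (-1 / 2 : ℝ) * δ ^ (-1 / 2 : ℝ)) := (Finset.abs_sum_le_sum_abs _ _).trans (sum_le_sum fun v _ => by
          rw [← Zl sp (h.pl r2) (h.pl r1)]
          refine (Tx (B := H * (t2 - t1) ^ α) ((h.per _ r2).sub (h.per _ r1)) ((h.c1 _ r2).sub (h.c1 _ r1)) (fun x => ?_) v sp x).trans_eq ?_
          · rw [Yg (h.diff _ r2) (h.diff _ r1)]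
            have := h.tg _ r1 _ r2 byl v x
            rwa [show t2 - δ - (t1 - δ) = t2 - t1 by ring] at this
          · rw [← Real.rpow_neg_one (sc β δ), Wi hj hδ.le])
      _ = _ := by
        rw [Finset.sum_const, Finset.card_univ, Fintype.card_option, Fintype.card_fin, nsmul_eq_mul, hC1]; push_cast; ring
  have e4 : |β * Ah (sc β δ) (Gop V (ψ t2)) x - β * Ah (sc β δ) (Gop V (ψ t1)) x| ≤ C2 * (t2 - t1) ^ α := by
    have q3 : Ah (sc β δ) (fun x => Gop V (ψ t2) x - Gop V (ψ t1) x) x = _ := Wn Ly sp (h.lc.pl hp1.le m2) (h.lc.pl hp1.le m1) x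
    have q2 := Ta (h.tf t1 m1 t2 m2 h12) (sc β δ) x
    rw [q3] at q2
    rw [← mul_sub, abs_mul, aop hj, hC2, mul_assoc]
    exact mll (q2.trans_eq (by ring)) hj.le
  have e5 : dd V β ψ t2 x - dd V β ψ t1 x = β⁻¹ * ((lap (ψ t2) x + β * Gop V (ψ t2) x) - (lap (ψ t1) x + β * Gop V (ψ t1) x)) := by unfold dd; field_simp
  rw [e5, abs_mul, aop (inv_pos.2 hj), mul_assoc]
  refine mll ?_ (inv_pos.2 hj).le
  have p1 : 0 ≤ δ ^ α := by positivity
  have p2 : 0 ≤ (t2 - t1) ^ α := Real.rpow_nonneg byl _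
  have p3 : 0 ≤ (t2 - t1) ^ α * δ ^ (-1 / 2 : ℝ) := by positivity
  clear_value C1 C2
  have e6 : 2 * (K * δ ^ α) + C1 * ((t2 - t1) ^ α * δ ^ (-1 / 2 : ℝ)) + C2 * (t2 - t1) ^ α ≤ (2 * K + C1 + C2) * (δ ^ α + (t2 - t1) ^ α * δ ^ (-1 / 2 : ℝ) + (t2 - t1) ^ α) := by
    generalize (t2 - t1) ^ α * δ ^ (-1 / 2 : ℝ) = X at *
    generalize (t2 - t1) ^ α = Y at *
    nlinarith [mul_nonneg hK p1, mul_nonneg hK p2, mul_nonneg hK p3, mul_nonneg h1 p1, mul_nonneg h1 p2, mul_nonneg h1 p3, mul_nonneg h2 p1, mul_nonneg h2 p2, mul_nonneg h2 p3]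
  refine le_trans ?_ e6
  rw [abs_le] at *; constructor <;> linarith
lemma Zm {X : Type*} {g : ℝ → X → ℝ} (hμ : 0 < μ) (hC : ∀ s ∈ Icc a b, ∀ t ∈ Icc a b, s < t → ∀ x, |g t x - g s x| ≤ C * (t - s) ^ μ) :
    ∀ s ∈ Icc a b, ∀ t ∈ Icc a b, ∀ x, |g t x - g s x| ≤ C * |t - s| ^ μ := fun s hs t ht x => by
  rcases lt_trichotomy s t with l | l | l
  · rw [aop (sp2 l)]; exact hC s hs t ht l x
  · rw [l, sub_self, sub_self, abs_zero, Real.zero_rpow hμ.ne', mul_zero]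
  · rw [abs_sub_comm, abs_sub_comm t, aop (sp2 l)]; exact hC t ht s hs l x
lemma Seg2.dh (h : Seg2 V β p a b B (μ + 1 / 4) H ψ) (hg : ∀ t, a < t → t ≤ b → Good β (Gop V (ψ t))) (hμ : 0 < μ) (hμ1 : μ < 1 / 4) (haa : a < a') :
    ∃ C, 0 ≤ C ∧ ∀ s ∈ Icc a' b, ∀ t ∈ Icc a' b, ∀ x, |dd V β ψ t x - dd V β ψ s x| ≤ C * |t - s| ^ μ ∧ |lap (ψ t) x - lap (ψ s) x| ≤ C * |t - s| ^ μ := by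
  obtain ⟨C, hC, I⟩ := h.incr hg
  have hb : 0 < b := h.ha.trans_lt h.hab
  have hj := h.hj
  have hH := h.hH
  set l := min (a' - a) b with hl
  have l0 : 0 < l := lt_min (sp2 haa) hb
  set C' := C * (l ^ (μ + 1 / 4) + b ^ (μ + 1 / 4) * l ^ (-1 / 2 : ℝ) + b ^ (μ + 1 / 4)) / b ^ μ with hC'
  have D : ∀ s ∈ Icc a' b, ∀ t ∈ Icc a' b, s < t → ∀ x, |dd V β ψ t x - dd V β ψ s x| ≤ C' * (t - s) ^ μ := fun s hs t ht hst x => by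
    have h0 := sp2 hst
    set u := (t - s) / b with hu
    have u0 : 0 < u := by positivity
    have u1 : u ≤ 1 := by rw [hu, div_le_one hb]; linarith [hs.1, ht.2, h.ha]
    have hts : t - s = b * u := by rw [hu]; field_simp
    have su : u ^ (1 / 2 : ℝ) ≤ 1 := Real.rpow_le_one u0.le u1 byn
    have d1 : l * u ^ (1 / 2 : ℝ) ≤ l := mul_le_of_le_one_right l0.le su
    have := I s t (l * u ^ (1 / 2 : ℝ)) hst ht.2 byp (d1.trans ((min_le_left _ _).trans (by linarith [hs.1]))) (d1.trans (min_le_right _ _)) x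
    refine this.trans ?_
    rw [hts, Real.mul_rpow l0.le byp, Real.mul_rpow l0.le byp, Real.mul_rpow hb.le u0.le, Real.mul_rpow hb.le u0.le, ← Real.rpow_mul u0.le, ← Real.rpow_mul u0.le]
    have f1 : u ^ (1 / 2 * (μ + 1 / 4)) ≤ u ^ μ := Real.rpow_le_rpow_of_exponent_ge u0 u1 byl
    have f2 : u ^ (μ + 1 / 4) * u ^ (1 / 2 * (-1 / 2) : ℝ) = u ^ μ := by rw [← Real.rpow_add u0]; congr 1; ring
    have f3 : u ^ (μ + 1 / 4) ≤ u ^ μ := Real.rpow_le_rpow_of_exponent_ge u0 u1 byl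
    calc _ = C * (l ^ (μ + 1 / 4) * u ^ (1 / 2 * (μ + 1 / 4)) + b ^ (μ + 1 / 4) * l ^ (-1 / 2 : ℝ) * (u ^ (μ + 1 / 4) * u ^ (1 / 2 * (-1 / 2) : ℝ)) + b ^ (μ + 1 / 4) * u ^ (μ + 1 / 4)) := by ring
      _ ≤ C * (l ^ (μ + 1 / 4) * u ^ μ + b ^ (μ + 1 / 4) * l ^ (-1 / 2 : ℝ) * u ^ μ + b ^ (μ + 1 / 4) * u ^ μ) := by rw [f2]; gcongr
      _ = _ := by rw [hC']; field_simp
  have C0 : 0 ≤ C' := by positivity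
  have D' := Zm hμ D
  have F := Zm (X := Spc m) (g := fun t => Gop V (ψ t)) (C := H * b ^ (μ + 1 / 4 - μ)) (a := a') (b := b) hμ fun s hs t ht hst x => by
    refine (h.tf s ⟨haa.le.trans hs.1, hs.2⟩ t ⟨haa.le.trans ht.1, ht.2⟩ hst x).trans ?_
    rw [mul_assoc]
    exact mll (Za (sp2 hst) (by linarith [hs.1, ht.2, h.ha]) byl) hH
  clear_value C'
  refine ⟨C' + β * (C' + H * b ^ (μ + 1 / 4 - μ)), by positivity, fun s hs t ht x => ?_⟩
  have q1 := D' s hs t ht x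
  have q2 := F s hs t ht x
  have q3 : 0 ≤ |t - s| ^ μ := by positivity
  have q4 : lap (ψ t) x - lap (ψ s) x = β * ((dd V β ψ t x - dd V β ψ s x) - (Gop V (ψ t) x - Gop V (ψ s) x)) := by unfold dd; field_simp; ring
  have q5 : |lap (ψ t) x - lap (ψ s) x| ≤ β * (C' * |t - s| ^ μ + H * b ^ (μ + 1 / 4 - μ) * |t - s| ^ μ) := by
    rw [q4, abs_mul, aop hj]; exact mll ((abs_sub _ _).trans (add_le_add q1 q2)) hj.le
  have q6 : 0 ≤ β * (C' + H * b ^ (μ + 1 / 4 - μ)) * |t - s| ^ μ := by positivity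
  have q7 : 0 ≤ C' * |t - s| ^ μ := by positivity
  constructor
  · rw [add_mul]; linarith
  · rw [add_mul]; refine q5.trans ?_; rw [← add_mul, ← mul_assoc]; linarith
lemma Sol.seg2 (h : Sol V β p b ψ) (ha : 0 < a) (hab : a < b) (hα : 0 < α) (hα1 : α < 1 / 2) : ∃ B H, Seg2 V β p a b B α H ψ ∧ ∀ t, a ≤ t → t ≤ b → Good β (Gop V (ψ t)) := by
  obtain ⟨B, S⟩ := h.seg (half_pos ha).le byl (h.grad (half_pos ha))
  obtain ⟨H, hH, hh⟩ := S.hol (γ := 2 * α) byl byl (half_lt_self ha)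
  have S' := S.sub (half_le_self ha.le) hab
  have hG := Nn m
  have hj := h.hj
  have c1 : ∀ s ∈ Icc a b, ContDiff ℝ 1 (ψ s) := fun s hs => Yw (S'.diff s hs) fun v => (hh s hs v).cont byl
  obtain ⟨H', S2⟩ := S'.time c1 hα hα1.le (H0 := 16 * G4 m * (H * (2 / β) ^ α)) byp fun t ht h0 hh0 hhb v x => by
    have := Qz (PL.pd1 (S'.per t ht) (c1 t ht) v).2.1 (S'.bd1 t ht v) hH byl byl (hh t ht v) (Wc β h0) x
    rw [Wi hj hh0.le, mul_div_cancel_left₀ _ (two_ne_zero)] at this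
    exact this.trans_eq (by ring)
  refine ⟨B, H', S2, fun t h1 h2 => ?_⟩
  have ht : t ∈ Icc a b := ⟨h1, h2⟩
  exact Good.Gop hj h.hV h.hVp (S'.per t ht) (S'.diff t ht) (S'.bd1 t ht) byl byl (hh t ht) fun x =>
    ((inv_pos.2 (by linarith [S'.hB])).trans_le (S'.low t ht x)).ne'
end

section
lemma Zn {g : ℝ → ℝ} (hμ : 0 < μ) (h : ∀ s ∈ S, ∀ t ∈ S, |g t - g s| ≤ C * |t - s| ^ μ) : ContinuousOn g S := fun s hs => by
  refine tendsto_iff_dist_tendsto_zero.2 (squeeze_zero' (evf fun _ => dist_nonneg) (eventually_mem_nhdsWithin.mono fun t ht => h s hs t ht) ?_)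
  have c : Continuous (fun t : ℝ => C * |t - s| ^ μ) := ccm ((by fun_prop : Continuous fun t : ℝ => |t - s|).rpow_const fun _ => Or.inr hμ.le)
  have := c.tendsto s
  rw [sub_self, abs_zero, Real.zero_rpow hμ.ne', mul_zero] at this
  exact this.mono_left nhdsWithin_le_nhds
lemma Seg2.rderiv (h : Seg2 V β p a b B α H ψ) (hs : a < s) (hsb : s < b) (hg : Good β (Gop V (ψ s))) (x : Spc m) :
    HasDerivWithinAt (fun t => ψ t x) (dd V β ψ s x) (Ioi s) s := by
  obtain ⟨K, hK, E⟩ := h.c2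
  have hc2 := (E s hsb.le hs hg).1
  have hj := h.hj
  have hG := Nn m
  have hH := h.hH
  have hα := h.hα
  have hp1 := (Xa h.hp).2.2
  have ms : s ∈ Icc a b := ⟨hs.le, hsb.le⟩
  rw [hasDerivWithinAt_iff_isLittleO, Asymptotics.isLittleO_iff]
  intro η hv
  obtain ⟨δ1, hδ1, k1⟩ := Zf hj hg.per hg.cont (η := η / 4) byp
  choose δ2 hδ2 k2 using fun v => Qx (Ql (Ql (h.per s ms) (ev v)) (ev v)) (((hc2 v).continuous_fderiv one_ne_zero).clm_apply continuous_const) (η := β * η / (4 * (m + 1))) byp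
  have L1 : Tendsto (fun t => 4 * G4 m * (H * (t - s) ^ α)) (nhdsWithin s (Ioi s)) (nhds 0) := by
    have c : Continuous (fun t : ℝ => 4 * G4 m * (H * (t - s) ^ α)) := ccm (ccm ((by fun_prop : Continuous fun t : ℝ => t - s).rpow_const fun _ => Or.inr hα.le))
    have := c.tendsto s
    rw [sub_self, Real.zero_rpow hα.ne', mul_zero, mul_zero] at this
    exact this.mono_left nhdsWithin_le_nhds
  have L2 : ∀ v, ∀ᶠ t in nhdsWithin s (Ioi s), sc β (t - s) ≤ δ2 v := fun v => by
    have c : Continuous (fun t : ℝ => sc β (t - s)) := (Wf β).comp byf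
    have := c.tendsto s
    rw [sub_self, We] at this
    exact (this.mono_left nhdsWithin_le_nhds).eventually (ge_mem_nhds (hδ2 v))
  filter_upwards [Ioc_mem_nhdsGT hsb, Ioc_mem_nhdsGT (show s < s + δ1 by linarith), L1.eventually (ge_mem_nhds (show 0 < η / 4 by positivity)), eventually_all.2 L2] with t h1 h2 h3 h4
  have hh : 0 < t - s := sp2 h1.1
  have sp := Wb hj hh
  have mt : t ∈ Icc a b := ⟨by linarith, h1.2⟩
  have T := Wa (h.per s ms) (h.c1 s ms) hc2 (c := sc β (t - s)) (η := β * η / 4) sp.le x fun τ t0 t1 => by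
    rw [Ty, ← sum_sub_distrib]
    calc _ ≤ ∑ v : OF m, β * η / (4 * (m + 1)) := (Finset.abs_sum_le_sum_abs _ _).trans (sum_le_sum fun v _ => k2 v τ t0 (t1.trans (h4 v)) x)
      _ = _ := by rw [Finset.sum_const, Finset.card_univ, Fintype.card_option, Fintype.card_fin, nsmul_eq_mul]; push_cast; field_simp
  rw [Wd hj hh.le] at T
  have c1 := (Wr hj hp1 h.lc Ly t x).mono (Wz (a' := s) ms.1 mt.2)
  have I := Xd hj h.hp h.ha h.lc ms.1 h1.1.le mt.2 x
  have W : |∫ τ in Ioo s t, (Ah (sc β (t - τ)) (Gop V (ψ τ)) x - Gop V (ψ s) x)| ≤ η / 2 * ((t - s) ^ (0 + 1 : ℝ) / (0 + 1)) := by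
    refine (Wy h1.1.le (e := 0) byn (c1.fun_sub continuousOn_const) fun τ hτ => ?_).2
    have mτ : τ ∈ Icc a b := ⟨by linarith [hτ.1], by linarith [hτ.2, h1.2]⟩
    have z := sp2 hτ.2
    have q3 : Ah (sc β (t - τ)) (fun x => Gop V (ψ τ) x - Gop V (ψ s) x) x = _ := Wn Ly (Wb hj z) (h.lc.pl hp1.le mτ) (h.lc.pl hp1.le ms) x
    have q2 := Ta (h.tf s ms τ mτ hτ.1) (sc β (t - τ)) x
    rw [q3] at q2
    have q4 : 4 * G4 m * (H * (τ - s) ^ α) ≤ 4 * G4 m * (H * (t - s) ^ α) := by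
      gcongr
      · linarith [hτ.1]
      · exact hτ.2.le
    have q5 := k1 (t - τ) z.le (by linarith [h2.2, hτ.1]) x
    change |Ah (sc β (t - τ)) (Gop V (ψ τ)) x - Ah (sc β (t - τ)) (Gop V (ψ s)) x| ≤ _ at q2
    change |Ah (sc β (t - τ)) (Gop V (ψ τ)) x - _| ≤ _
    rw [Real.rpow_zero, mul_one]
    rw [abs_le] at *; constructor <;> linarith
  rw [integral_sub I (integrable_const _)] at W
  simp only [integral_const, smul_eq_mul, measureReal_restrict_apply_univ, Real.volume_real_Ioo_of_le h1.1.le] at W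
  rw [zero_add, Real.rpow_one, div_one] at W
  rw [h.restart ms.1 h1.1 mt.2 x, norm_eq_abs, norm_eq_abs, aop hh, smul_eq_mul]
  unfold dd U
  have z1 : 2 * (t - s) / β / 2 * lap (ψ s) x = (t - s) * (β⁻¹ * lap (ψ s) x) := by field_simp
  have z2 : 2 * (t - s) / β * (β * η / 4) = η / 2 * (t - s) := by field_simp; ring
  rw [z1, z2] at T
  rw [mul_add]
  rw [abs_le] at *; constructor <;> linarith
lemma Sol.deriv (h : Sol V β p b ψ) (ht : 0 < t) (htb : t < b) : ∃ C, ∀ᶠ k in nhdsWithin (0:ℝ) {k | k ≠ 0}, ∀ x, |(ψ (t + k) x - ψ t x) / k - dd V β ψ t x| ≤ C * |k| ^ (1 / 8 : ℝ) := by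
  obtain ⟨B, H, S, hg⟩ := h.seg2 (a := t / 4) (α := 1 / 8 + 1 / 4) byl byl byn byn
  obtain ⟨C, hC, hd⟩ := S.dh (fun t h1 h2 => hg t h1.le h2) byn byn (a' := t / 2) byl
  refine ⟨C, ?_⟩
  have hr : 0 < min (t / 2) ((b - t) / 2) := lt_min byl byl
  filter_upwards [eventually_mem_nhdsWithin, mem_nhdsWithin_of_mem_nhds (Metric.ball_mem_nhds (0:ℝ) hr)] with k hk0 hk x
  rw [mem_ball_zero_iff, norm_eq_abs, abs_lt] at hk
  have k1 : -(t / 2) < k := by linarith [min_le_left (t / 2) ((b - t) / 2), hk.1]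
  have k2 : k < (b - t) / 2 := by linarith [min_le_right (t / 2) ((b - t) / 2), hk.2]
  have sub : uIcc t (t + k) ⊆ Ioo (t / 2) b := (ordConnected_Ioo).uIcc_subset ⟨by linarith, htb⟩ ⟨by linarith, by linarith⟩
  have sub' : uIcc t (t + k) ⊆ Icc (t / 2) b := sub.trans Ioo_subset_Icc_self
  have tm : t ∈ Icc (t / 2) b := ⟨by linarith, htb.le⟩
  have cd : ContinuousOn (fun s => dd V β ψ s x) (uIcc t (t + k)) := (Zn (μ := 1 / 8) (C := C) byn fun s hs t ht => (hd s hs t ht x).1).mono sub'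
  have cψ : ContinuousOn (fun s => ψ s x) (uIcc t (t + k)) := (Zn (S := Icc (t / 4) b) byn fun s hs t ht => Zm byn S.tp s hs t ht x).mono
    (sub'.trans (Icc_subset_Icc_left byl))
  have F := intervalIntegral.integral_eq_sub_of_hasDeriv_right cψ (fun s hs => S.rderiv (by linarith [(sub (Ioo_subset_Icc_self hs)).1]) (sub (Ioo_subset_Icc_self hs)).2
    (hg s (by linarith [(sub (Ioo_subset_Icc_self hs)).1]) (sub (Ioo_subset_Icc_self hs)).2.le) x) cd.intervalIntegrable
  have G : |∫ s in t..t + k, (dd V β ψ s x - dd V β ψ t x)| ≤ C * |k| ^ (1 / 8 : ℝ) * |t + k - t| := by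
    refine intervalIntegral.norm_integral_le_of_norm_le_const (f := fun s => dd V β ψ s x - dd V β ψ t x) fun s hs => ?_
    have ho := uIoc_subset_uIcc hs
    refine (hd t tm s (sub' ho) x).1.trans ?_
    have := abs_sub_left_of_mem_uIcc ho
    rw [add_sub_cancel_left] at this
    exact mll (Real.rpow_le_rpow (anz _) this byn) hC
  rw [intervalIntegral.integral_sub cd.intervalIntegrable intervalIntegrable_const, F, intervalIntegral.integral_const, smul_eq_mul, add_sub_cancel_left] at G
  have : (ψ (t + k) x - ψ t x) / k - dd V β ψ t x = (ψ (t + k) x - ψ t x - k * dd V β ψ t x) / k := by field_simp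
  rw [this, abs_div, div_le_iff₀ (abs_pos.2 hk0)]
  exact G
end
lemma Zo (hp : 1 ≤ p) (hP : Per g) (hm : Measurable g) (hL : LpN p g < ⊤) (hv : 0 < η) :
    ∃ δ > 0, ∀ y : Spc m, ‖y‖ < δ → LpN p (fun u => g (u + y) - g u) ≤ oR η := by
  have p0 : 0 < p := by linarith
  have q1 : 1 ≤ oR p := by rw [← ofReal_one]; exact oRm hp
  have pl : PL (fun x => |g x| ^ p) := by
    refine ⟨hP.comp fun a => |a| ^ p, (measurable_abs.comp hm).pow_const p, ?_⟩
    rw [Nt p0] at hL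
    have := (ENNReal.rpow_lt_top_iff_of_pos (by positivity : 0 < 1 / p)).1 hL
    refine lt_of_le_of_lt (lintegral_mono fun u => ?_) this
    rw [Real.enorm_rpow_of_nonneg (anz _) p0.le, Real.enorm_abs]
  set S : Set (Spc m) := Metric.closedBall 0 2 with hS
  have mS : MeasurableSet S := Metric.isClosed_closedBall.measurableSet
  have hGl : MemLp (S.indicator g) (oR p) volume := by
    rw [memLp_indicator_iff_restrict mS, ← integrable_norm_rpow_iff hm.aestronglyMeasurable (by simpa using p0) ofReal_ne_top, ENNReal.toReal_ofReal p0.le]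
    exact pl.intOn Metric.isBounded_closedBall
  obtain ⟨φ, cs, hφ, φc, φL⟩ := hGl.exists_hasCompactSupport_eLpNorm_sub_le ofReal_ne_top (ε := oR (η / 3)) (by simpa using hv)
  obtain ⟨δ, δ0, hδ⟩ := Metric.uniformContinuous_iff.1 (cs.uniformContinuous_of_continuous φc) (η / 3) byp
  refine ⟨min δ 1, by positivity, fun y hy => ?_⟩
  have e : (fun u => g (u + y) - g u) =ᵐ[μT m] fun u => (S.indicator g - φ) (u + y) + ((φ (u + y) - φ u) + -(S.indicator g - φ) u) := by
    filter_upwards [ae_restrict_mem (Lt m)] with u hu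
    have h1 := Lw hu
    have h2 : u ∈ S := by rw [hS, mem_closedBall_zero_iff]; linarith
    have h3 : u + y ∈ S := by rw [hS, mem_closedBall_zero_iff]; linarith [norm_add_le u y, min_le_right δ 1]
    simp only [Pi.sub_apply, indicator_of_mem h2, indicator_of_mem h3]; ring
  have sm : AEStronglyMeasurable (S.indicator g - φ) volume := (hGl.sub φL).1
  have mp := measurePreserving_add_right (volume : Measure (Spc m)) y
  have t1 : eLpNorm (fun u => (S.indicator g - φ) (u + y)) (oR p) (μT m) ≤ oR (η / 3) :=
    (eLpNorm_mono_measure _ Measure.restrict_le_self).trans ((eLpNorm_comp_measurePreserving sm mp).trans_le hφ)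
  have t3 : eLpNorm (fun u => -(S.indicator g - φ) u) (oR p) (μT m) ≤ oR (η / 3) :=
    (eLpNorm_mono_measure _ Measure.restrict_le_self).trans ((eLpNorm_neg _ _ _).trans_le hφ)
  have t2 : LpN p (fun u => φ (u + y) - φ u) ≤ oR (η / 3) := Qf fun u => by
    have := @hδ (u + y) u (by rw [dist_eq_norm]; simpa using hy.trans_le (min_le_left _ _))
    rw [dist_eq] at this; exact this.le
  rw [LpN, eLpNorm_congr_ae e]
  have c2 : AEStronglyMeasurable (fun u => φ (u + y) - φ u) (μT m) := by
    refine Continuous.aestronglyMeasurable ?_; fun_prop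
  have c1 : AEStronglyMeasurable (fun u => (S.indicator g - φ) (u + y)) (μT m) := (sm.comp_measurePreserving mp).mono_measure Measure.restrict_le_self
  have c3 : AEStronglyMeasurable (fun u => -(S.indicator g - φ) u) (μT m) := sm.neg.mono_measure Measure.restrict_le_self
  refine (eLpNorm_add_le c1 (c2.add c3) q1).trans ((add_le_add t1 ((eLpNorm_add_le c2 c3 q1).trans (add_le_add t2 t3))).trans ?_)
  rw [← ofReal_add byp byp, ← ofReal_add byp byp]
  exact oRm byl
lemma Zq (hp : 1 < p) (hP : Per g) (hm : Measurable g) (hL : LpN p g < ⊤) :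
    Tendsto (fun c => LpN p (fun x => Ah c g x - g x)) (nhdsWithin 0 (Ioi 0)) (nhds 0) := by
  have p0 : 0 < p := by linarith
  have q1 : 1 ≤ oR p := by rw [← ofReal_one]; exact oRm hp.le
  have hg : PL g := PL.of_LpN hp.le hP hm hL
  have rL : ∫⁻ z : Spc m, oR (rho z) = 1 := by
    rw [← ofReal_integral_eq_lintegral_ofReal Le (evf fun z => (Lb z).le), Lf, ofReal_one]
  have rm : Measurable fun z : Spc m => oR (rho z) := Ld.measurable.ennreal_ofReal
  set w : Spc m → ℝ≥0∞ := fun y => ∫⁻ u in cube m, ‖g (u + y) - g u‖ₑ ^ p with hw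
  have jm : Measurable fun q : Spc m × Spc m => ‖g (q.2 + q.1) - g q.2‖ₑ ^ p :=
    (((hm.comp (measurable_snd.add measurable_fst)).sub (hm.comp measurable_snd)).enorm).pow_const p
  have wm : Measurable w := jm.lintegral_prod_right'
  have wL : ∀ y, w y = LpN p (fun u => g (u + y) - g u) ^ p := fun y => by
    rw [Nt p0, ← ENNReal.rpow_mul, one_div_mul_cancel p0.ne', ENNReal.rpow_one]
  have wb : ∀ y, w y ≤ (LpN p g + LpN p g) ^ p := fun y => by
    rw [wL]
    refine ENNReal.rpow_le_rpow ?_ p0.le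
    refine (eLpNorm_sub_le (hm.comp (measurable_add_const y)).aestronglyMeasurable hm.aestronglyMeasurable q1).trans (add_le_add (le_of_eq ?_) le_rfl)
    show LpN p (fun u => g (u + y)) = LpN p g
    rw [Nt p0, Nt p0, ← Lu ((hP.comp (fun a => ‖a‖ₑ ^ p))) y]
    simp_rw [add_comm y]
  have key : ∀ c, 0 < c → LpN p (fun x => Ah c g x - g x) ≤ (∫⁻ z, oR (rho z) * w (c • z)) ^ (1 / p) := fun c hc => by
    rw [Nt p0]
    refine ENNReal.rpow_le_rpow ?_ byp
    have jc : Measurable fun q : Spc m × Spc m => ‖g (q.1 + c • q.2) - g q.1‖ₑ ^ p :=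
      (((hm.comp (measurable_fst.add (measurable_snd.const_smul c))).sub (hm.comp measurable_fst)).enorm).pow_const p
    have e1 : ∀ x, ‖Ah c g x - g x‖ₑ ^ p ≤ ∫⁻ z, oR (rho z) * ‖g (x + c • z) - g x‖ₑ ^ p := fun x => by
      have hx : Ah c g x - g x = ∫ z, rho z * (g (x + c • z) - g x) := by
        simp_rw [mul_sub]
        rw [integral_sub (Ni Ly hc hg x) (Le.mul_const _), integral_mul_const, Lf, one_mul]; rfl
      have mx : Measurable fun z : Spc m => g (x + c • z) - g x := (hm.comp (measurable_const.add (measurable_id.const_smul c))).sub_const _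
      set P : Measure (Spc m) := volume.withDensity fun z => oR (rho z) with hPd
      haveI : IsProbabilityMeasure P := ⟨by rw [hPd, withDensity_apply _ MeasurableSet.univ, Measure.restrict_univ, rL]⟩
      have h2 := eLpNorm_le_eLpNorm_of_exponent_le q1 (mx.aestronglyMeasurable (μ := P))
      rw [eLpNorm_one_eq_lintegral_enorm, eLpNorm_eq_lintegral_rpow_enorm_toReal (by simpa using p0) ofReal_ne_top, ENNReal.toReal_ofReal p0.le,
        hPd, lintegral_withDensity_eq_lintegral_mul _ rm mx.enorm, lintegral_withDensity_eq_lintegral_mul _ rm (mx.enorm.pow_const p)] at h2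
      have h1 : ‖Ah c g x - g x‖ₑ ≤ ∫⁻ z, ((fun z : Spc m => oR (rho z)) * fun z => ‖g (x + c • z) - g x‖ₑ) z := by
        rw [hx]
        refine (enorm_integral_le_lintegral_enorm _).trans (lintegral_mono fun z => ?_)
        rw [enorm_mul, Real.enorm_of_nonneg (Lb z).le]; rfl
      have := ENNReal.rpow_le_rpow (h1.trans h2) p0.le
      rwa [← ENNReal.rpow_mul, one_div_mul_cancel p0.ne', ENNReal.rpow_one] at this
    refine (lintegral_mono e1).trans (le_of_eq ?_)
    rw [lintegral_lintegral_swap (((rm.comp measurable_snd).mul jc).aemeasurable)]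
    refine lintegral_congr fun z => ?_
    exact lintegral_const_mul _ (jc.comp (measurable_id.prodMk (measurable_const (a := z))))
  have fin : (LpN p g + LpN p g) ^ p ≠ ⊤ := ENNReal.rpow_ne_top_of_nonneg p0.le (ENNReal.add_lt_top.2 ⟨hL, hL⟩).ne
  have lim : Tendsto (fun c : ℝ => ∫⁻ z : Spc m, oR (rho z) * w (c • z)) (nhdsWithin 0 (Ioi 0)) (nhds (∫⁻ _ : Spc m, 0)) := by
    refine tendsto_lintegral_filter_of_dominated_convergence (fun z => oR (rho z) * (LpN p g + LpN p g) ^ p)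
      (evf fun c => rm.mul (wm.comp (measurable_id.const_smul c))) (evf fun c => evf fun z => mul_le_mul' le_rfl (wb _)) ?_
      (evf fun z => ?_)
    · rw [lintegral_mul_const _ rm, rL, one_mul]; exact fin
    · have h0 : Tendsto w (nhds 0) (nhds 0) := by
        have : Tendsto (fun y => LpN p (fun u => g (u + y) - g u)) (nhds 0) (nhds 0) := by
          rw [ENNReal.tendsto_nhds_zero]
          intro ε hε
          obtain ⟨η, η0, hv⟩ : ∃ η : ℝ, 0 < η ∧ oR η ≤ ε := by
            obtain ⟨r, r0, hr⟩ := ENNReal.lt_iff_exists_nnreal_btwn.1 hε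
            exact ⟨r, by exact_mod_cast r0, by simpa using hr.le⟩
          obtain ⟨δ, δ0, hδ⟩ := Zo hp.le hP hm hL η0
          filter_upwards [Metric.ball_mem_nhds 0 δ0] with y hy
          exact (hδ y (by simpa using hy)).trans hv
        have h2 := ((ENNReal.continuous_rpow_const (y := p)).tendsto 0).comp this
        rw [ENNReal.zero_rpow_of_pos p0] at h2
        exact h2.congr fun y => (wL y).symm
      have h1 : Tendsto (fun c : ℝ => c • z) (nhdsWithin 0 (Ioi 0)) (nhds 0) := by
        have : Continuous fun c : ℝ => c • z := by fun_prop
        simpa using (this.tendsto 0).mono_left nhdsWithin_le_nhds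
      simpa using ENNReal.Tendsto.const_mul (h0.comp h1) (Or.inr ofReal_ne_top)
  have l2 := ((ENNReal.continuous_rpow_const (y := 1 / p)).tendsto _).comp lim
  rw [lintegral_zero, ENNReal.zero_rpow_of_pos byp] at l2
  exact tendsto_of_tendsto_of_tendsto_of_le_of_le' tendsto_const_nhds l2 (evf fun _ => zero_le)
    (eventually_nhdsWithin_of_forall fun c hc => key c hc)

section
lemma Sol.seg20 (h : Sol V β p b ψ) (c0 : ContDiff ℝ 1 (ψ 0)) (hd : ∀ v, Differentiable ℝ (pdv v (ψ 0)))
    (hL : ∀ w v, LpN p (pdv w (pdv v (ψ 0))) < ⊤) :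
    ∃ B α H, Seg2 V β p 0 b B α H ψ ∧ ∀ t, 0 < t → t ≤ b → Good β (Gop V (ψ t)) := by
  obtain ⟨B, S⟩ := h.seg le_rfl h.hb (h.grad0 c0)
  have hj := h.hj
  have hG := Nn m
  have hb := h.hb
  obtain ⟨t0, t1, p1⟩ := Xa h.hp
  set α : ℝ := (1 - (m + 1) / p) / 2 with hα
  have α0 : 0 < α := by rw [hα]; linarith
  have α1 : α < 1 / 2 := by rw [hα]; linarith
  have e2 : 1 - (m + 1) / p = 2 * α := by rw [hα]; ring
  clear_value α
  have z0 : (0:ℝ) ∈ Icc 0 b := ⟨le_rfl, hb.le⟩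
  have per0 := S.per 0 z0
  have hol : ∀ t, 0 < t → t ≤ b → ∃ H, 0 ≤ H ∧ ∀ v, Hol (2 * α) H (pdv v (ψ t)) := fun t ht htb => by
    obtain ⟨H, H0, hh⟩ := S.hol (γ := 2 * α) byl byl ht
    exact ⟨H, H0, hh t ⟨le_rfl, htb⟩⟩
  have c1 : ∀ s ∈ Icc 0 b, ContDiff ℝ 1 (ψ s) := fun s hs => by
    rcases hs.1.eq_or_lt with e | l
    · rwa [← e]
    · obtain ⟨H, _, hh⟩ := hol s l hs.2
      exact Yw (S.diff s hs) fun v => (hh v).cont byl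
  obtain ⟨C, C0, hC⟩ := morrey h.hp (Wb hj hb)
  obtain ⟨A, A0, hA⟩ : ∃ A : ℝ, 0 ≤ A ∧ ∀ w v, LpN p (pdv w (pdv v (ψ 0))) ≤ oR A := by
    refine ⟨∑ w, ∑ v, (LpN p (pdv w (pdv v (ψ 0)))).toReal, by positivity, fun w v => ?_⟩
    rw [← ofReal_toReal (hL w v).ne]
    refine oRm ?_
    exact (single_le_sum (f := fun v => (LpN p (pdv w (pdv v (ψ 0)))).toReal) (fun _ _ => ENNReal.toReal_nonneg) (Finset.mem_univ v)).trans
      (single_le_sum (f := fun w => ∑ v, (LpN p (pdv w (pdv v (ψ 0)))).toReal) (fun _ _ => by positivity) (Finset.mem_univ w))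
  have scα : ∀ τ, 0 ≤ τ → sc β τ ^ (2 * α) = (2 / β) ^ α * τ ^ α := fun τ hτ => by
    rw [Wi hj hτ, mul_div_cancel_left₀ _ (two_ne_zero)]
  have mor : ∀ τ, 0 < τ → τ ≤ b → ∀ v x, |Ah (sc β τ) (pdv v (ψ 0)) x - pdv v (ψ 0) x| ≤ C * A * (2 / β) ^ α * τ ^ α := fun τ h1 h2 v x => by
    have := hC _ (Ql per0 (ev v)) (hd v) A A0 (fun w => hA w v) _ (Wb hj h1) (Wg hj h2) x
    rw [e2, scα _ h1.le] at this
    exact this.trans_eq (by ring)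
  set HU : ℝ := 256 * (m + 1) * G4 m * B * (2 / β) ^ ((-1 - 2 * α) / 2) * ((b - 0) ^ ((-1 - 2 * α) / 2 + 1) / ((-1 - 2 * α) / 2 + 1)) with hHU
  have B0 : 0 ≤ B := by linarith [S.hB]
  have HU0 : 0 ≤ HU := by
    have : 0 ≤ (-1 - 2 * α) / 2 + 1 := by linarith
    have hb' : 0 ≤ b - 0 := by linarith
    positivity
  have TH : ∀ t ∈ Icc 0 b, ∀ τ, 0 < τ → τ ≤ b → ∀ v x, |Ah (sc β τ) (pdv v (ψ t)) x - pdv v (ψ t) x| ≤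
      (C * A * (2 / β) ^ α + 4 * G4 m * (C * A * (2 / β) ^ α) + 16 * G4 m * (HU * (2 / β) ^ α)) * τ ^ α := fun t ht τ h1 h2 v x => by
    have n1 : 0 ≤ C * A * (2 / β) ^ α * τ ^ α := by positivity
    have n2 : 0 ≤ 4 * G4 m * (C * A * (2 / β) ^ α * τ ^ α) := by positivity
    have n3 : 0 ≤ 16 * G4 m * (HU * ((2 / β) ^ α * τ ^ α)) := by positivity
    rcases ht.1.eq_or_lt with e | l
    · rw [← e]; have := mor τ h1 h2 v x; linarith
    · have pg : PL (pdv v (ψ 0)) := PL.pd1 per0 c0 v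
      have pU : pdv v (ψ t) = fun x => Ah (sc β t) (pdv v (ψ 0)) x + Uv β 0 t (fun s => Gop V (ψ s)) v x := funext fun x => by
        rw [Yt hj h.hp le_rfl S.lc (S.pl z0) l ht.2 (S.rep t ht) v x, sub_zero, Tv per0 c0 v (Wb hj l)]
      have hU := Yz hj p1 S.lc S.fb ht.1 ht.2 (by linarith : 0 ≤ 2 * α) byl v
      have cU : Continuous (Uv β 0 t (fun s => Gop V (ψ s)) v) := hU.cont byl
      have perA : Per (Ah (sc β t) (pdv v (ψ 0))) := Tg pg.1 _
      have perU : Per (Uv β 0 t (fun s => Gop V (ψ s)) v) := by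
        have : Uv β 0 t (fun s => Gop V (ψ s)) v = fun x => pdv v (ψ t) x - Ah (sc β t) (pdv v (ψ 0)) x := by rw [pU]; funext x; ring
        rw [this]; exact (Ql (S.per t ht) _).sub perA
      have plU := PL.of_cont perU cU
      obtain ⟨BU, _, hBU⟩ := Qh perU cU
      have i1 := Qz cU.measurable hBU HU0 byl byl hU (Wc β τ) x
      rw [scα _ h1.le] at i1
      have s1 := Wb hj h1
      have st := Wb hj l
      have i2 : |Ah (sc β τ) (Ah (sc β t) (pdv v (ψ 0))) x - Ah (sc β t) (pdv v (ψ 0)) x| ≤ 4 * G4 m * (C * A * (2 / β) ^ α * τ ^ α) := by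
        have s3 : 0 < sc β (τ + t) := Wb hj byl
        rw [Qb pg s1 st s3 (Wh hj h1.le l.le) x, ← Qb pg st s1 s3 (by rw [add_comm]; exact Wh hj h1.le l.le) x]
        have := Wn Ly st (Tq pg s1) pg x
        rw [Ah, Ah.eq_def (sc β t) (pdv v (ψ 0)), ← this]
        exact Ta (fun y => mor τ h1 h2 v y) _ _
      have i3 : Ah (sc β τ) (pdv v (ψ t)) x = Ah (sc β τ) (Ah (sc β t) (pdv v (ψ 0))) x + Ah (sc β τ) (Uv β 0 t (fun s => Gop V (ψ s)) v) x := by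
        rw [pU]; exact Wm Ly s1 (Tq pg st) plU x
      rw [i3, pU]
      have := (abs_le.1 i1); have := abs_le.1 i2
      rw [abs_le]; constructor <;> nlinarith
  obtain ⟨H, S2⟩ := S.time c1 α0 α1.le byp TH
  refine ⟨B, α, H, S2, fun t h1 h2 => ?_⟩
  obtain ⟨H, _, hh⟩ := hol t h1 h2
  have ht : t ∈ Icc 0 b := ⟨h1.le, h2⟩
  exact Good.Gop hj h.hV h.hVp (S.per t ht) (S.diff t ht) (S.bd1 t ht) byl byl hh fun x =>
    ((inv_pos.2 (by linarith [S.hB])).trans_le (S.low t ht x)).ne'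
lemma Zr (f : FS m) : Measurable (lap f) := by
  have : lap f = fun x => ∑ v : OF m, pdv v (pdv v f) x := funext fun x => Ty f x
  rw [this]; exact Finset.measurable_fun_sum _ fun v _ => Xw _ _
lemma Sol.zero (h : Sol V β p b ψ) (c0 : ContDiff ℝ 1 (ψ 0)) (hd : ∀ v, Differentiable ℝ (pdv v (ψ 0)))
    (hL : ∀ w v, LpN p (pdv w (pdv v (ψ 0))) < ⊤) :
    Tendsto (fun t => LpN p (fun x => lap (ψ t) x - lap (ψ 0) x)) (nhdsWithin 0 (Ioi 0)) (nhds 0) ∧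
    Tendsto (fun t => LpN p (fun x => dd V β ψ t x - dd V β ψ 0 x)) (nhdsWithin 0 (Ioi 0)) (nhds 0) := by
  obtain ⟨B, α, H, S, hg⟩ := h.seg20 c0 hd hL
  obtain ⟨K, K0, hK⟩ := S.c2
  have hj := h.hj
  have hG := Nn m
  have hb := h.hb
  have p1 := h.p1
  have H0 := S.hH
  have q1 : 1 ≤ oR p := by rw [← ofReal_one]; exact oRm p1.le
  have z0 : (0:ℝ) ∈ Icc 0 b := ⟨le_rfl, hb.le⟩
  have per0 := S.per 0 z0
  have pf0 : PL (Gop V (ψ 0)) := PL.of_bdd (S.lc.per 0 z0) (S.lc.meas 0 z0) (S.fb 0 z0)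
  have pg : ∀ v, PL (pdv v (ψ 0)) := PL.pd1 per0 c0
  have pgg : ∀ v, PL (pdv v (pdv v (ψ 0))) := fun v => PL.of_LpN p1.le (Ql (pg v).1 _) (Xw _ _) (hL v v)
  set C : ℝ := K + β * (4 * G4 m * H) + β * H
  have sct : Tendsto (sc β) (nhdsWithin 0 (Ioi 0)) (nhdsWithin 0 (Ioi 0)) := by
    refine tendsto_nhdsWithin_iff.2 ⟨?_, eventually_nhdsWithin_of_forall fun t ht => Wb hj ht⟩
    have := ((Wf β).tendsto 0).mono_left (nhdsWithin_le_nhds (s := Ioi 0))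
    rwa [We] at this
  have a1 : ∀ v, Tendsto (fun t => LpN p (fun x => Ah (sc β t) (pdv v (pdv v (ψ 0))) x - pdv v (pdv v (ψ 0)) x)) (nhdsWithin 0 (Ioi 0)) (nhds 0) :=
    fun v => (Zq p1 (pgg v).1 (pgg v).2.1 (hL v v)).comp sct
  have a2 : Tendsto (fun t => LpN p (fun x => Ah (sc β t) (Gop V (ψ 0)) x - Gop V (ψ 0) x)) (nhdsWithin 0 (Ioi 0)) (nhds 0) :=
    (Zq p1 pf0.1 pf0.2.1 ((Qf (S.fb 0 z0)).trans_lt ofReal_lt_top)).comp sct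
  have a3 : ∀ D : ℝ, Tendsto (fun t : ℝ => oR (D * t ^ α)) (nhdsWithin 0 (Ioi 0)) (nhds 0) := fun D => by
    have : Continuous fun t : ℝ => oR (D * t ^ α) := ENNReal.continuous_ofReal.comp (ccm (Real.continuous_rpow_const S.hα.le))
    have := (this.tendsto 0).mono_left (nhdsWithin_le_nhds (s := Ioi 0))
    rwa [Real.zero_rpow S.hα.ne', mul_zero, ofReal_zero] at this
  have ev1 : ∀ᶠ t in nhdsWithin (0:ℝ) (Ioi 0), 0 < t ∧ t ≤ b := Ioc_mem_nhdsGT hb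
  have T1 : Tendsto (fun t => LpN p (fun x => lap (ψ t) x - lap (ψ 0) x)) (nhdsWithin 0 (Ioi 0)) (nhds 0) := by
    have lim := (a3 C).add ((tendsto_finsetSum Finset.univ fun v _ => a1 v).add (ENNReal.Tendsto.const_mul a2 (Or.inr (ofReal_ne_top (r := β)))))
    rw [Finset.sum_const_zero, mul_zero, add_zero, add_zero] at lim
    refine tendsto_of_tendsto_of_tendsto_of_le_of_le' tendsto_const_nhds lim (evf fun _ => zero_le) ?_
    filter_upwards [ev1] with t ht
    have htb : t ∈ Icc 0 b := ⟨ht.1.le, ht.2⟩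
    have st := Wb hj ht.1
    have E := (hK t ht.2 ht.1 (hg t ht.1 ht.2)).2 0 le_rfl ht.1
    have pft : PL (Gop V (ψ t)) := PL.of_bdd (S.lc.per t htb) (S.lc.meas t htb) (S.fb t htb)
    set a : OF m → FS m := fun v x => Ah (sc β t) (pdv v (pdv v (ψ 0))) x - pdv v (pdv v (ψ 0)) x with ha
    set c : FS m := fun x => Ah (sc β t) (Gop V (ψ 0)) x - Gop V (ψ 0) x with hc
    have am : ∀ v, Measurable (a v) := fun v => (Tq (pgg v) st).2.1.sub (pgg v).2.1
    have cm : Measurable c := (Tq pf0 st).2.1.sub pf0.2.1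
    set e : FS m := fun x => lap (ψ t) x - lap (ψ 0) x - (∑ v, a v x + β * c x) with he
    have sm : Measurable fun x => ∑ v, a v x := Finset.measurable_fun_sum _ fun v _ => am v
    have em : Measurable e := ((Zr _).sub (Zr _)).sub (sm.add (cm.const_mul β))
    have eb : ∀ x, |e x| ≤ C * t ^ α := fun x => by
      have E1 := E x
      have e3 : ∑ v, D2 v v (sc β (t - 0)) (ψ 0) x = ∑ v, a v x + lap (ψ 0) x := by
        rw [Ty, ← sum_add_distrib]
        refine sum_congr rfl fun v _ => ?_
        rw [sub_zero, Tw per0 c0 v v st, Qm (hd v) (pg v) v (pgg v) st, ha]; ring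
      have E2 : |Ah (sc β t) (Gop V (ψ t)) x - Ah (sc β t) (Gop V (ψ 0)) x| ≤ 4 * G4 m * (H * t ^ α) := by
        have := Wn Ly st pft pf0 x
        rw [Ah, Ah, ← this]
        exact Ta (fun y => by simpa using S.tf 0 z0 t htb ht.1 y) _ _
      have E3 : |Gop V (ψ t) x - Gop V (ψ 0) x| ≤ H * t ^ α := by simpa using S.tf 0 z0 t htb ht.1 x
      rw [e3, sub_zero] at E1
      have d : e x = (lap (ψ t) x + β * Gop V (ψ t) x - (∑ v, a v x + lap (ψ 0) x) - β * Ah (sc β t) (Gop V (ψ t)) x)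
          + β * (Ah (sc β t) (Gop V (ψ t)) x - Ah (sc β t) (Gop V (ψ 0)) x) - β * (Gop V (ψ t) x - Gop V (ψ 0) x) := by
        simp only [he, hc]; ring
      rw [d]
      refine (abs_sub _ _).trans ((add_le_add (abs_add_le _ _) le_rfl).trans ?_)
      rw [abs_mul, abs_mul, aop hj]
      have := mll E2 hj.le
      have := mll E3 hj.le
      show _ ≤ (K + β * (4 * G4 m * H) + β * H) * t ^ α
      linarith
    have eq : (fun x => lap (ψ t) x - lap (ψ 0) x) = e + ((fun x => ∑ v, a v x) + fun x => β * c x) := by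
      funext x; simp only [he, Pi.add_apply]; ring
    have c3 : eLpNorm (fun x => β * c x) (oR p) (μT m) = oR β * LpN p c := by
      have := eLpNorm_const_smul (p := oR p) (μ := μT m) β c
      rw [Real.enorm_of_nonneg hj.le] at this; exact this
    have c2 : eLpNorm (fun x => ∑ v, a v x) (oR p) (μT m) ≤ ∑ v, LpN p (a v) := by
      have := eLpNorm_sum_le (p := oR p) (μ := μT m) (s := Finset.univ) (f := a) (fun v _ => (am v).aestronglyMeasurable) q1
      refine le_trans (le_of_eq ?_) this
      congr 1; funext x; rw [Finset.sum_apply]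
    rw [LpN, eq]
    refine (eLpNorm_add_le em.aestronglyMeasurable (sm.add (cm.const_mul β)).aestronglyMeasurable q1).trans (add_le_add (Qf eb) ?_)
    refine (eLpNorm_add_le sm.aestronglyMeasurable (cm.const_mul β).aestronglyMeasurable q1).trans (add_le_add c2 c3.le)
  refine ⟨T1, ?_⟩
  have lim := (ENNReal.Tendsto.const_mul T1 (Or.inr (ofReal_ne_top (r := β⁻¹)))).add (a3 H)
  rw [mul_zero, add_zero] at lim
  refine tendsto_of_tendsto_of_tendsto_of_le_of_le' tendsto_const_nhds lim (evf fun _ => zero_le) ?_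
  filter_upwards [ev1] with t ht
  have htb : t ∈ Icc 0 b := ⟨ht.1.le, ht.2⟩
  have lm : Measurable fun x => lap (ψ t) x - lap (ψ 0) x := (Zr _).sub (Zr _)
  have fm : Measurable fun x => Gop V (ψ t) x - Gop V (ψ 0) x := (S.lc.meas t htb).sub (S.lc.meas 0 z0)
  have eq : (fun x => dd V β ψ t x - dd V β ψ 0 x) = (fun x => β⁻¹ * (lap (ψ t) x - lap (ψ 0) x)) + fun x => Gop V (ψ t) x - Gop V (ψ 0) x := by
    funext x; simp only [dd, Pi.add_apply]; ring
  have c3 : eLpNorm (fun x => β⁻¹ * (lap (ψ t) x - lap (ψ 0) x)) (oR p) (μT m) = oR β⁻¹ * LpN p (fun x => lap (ψ t) x - lap (ψ 0) x) := by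
    have := eLpNorm_const_smul (p := oR p) (μ := μT m) β⁻¹ (fun x => lap (ψ t) x - lap (ψ 0) x)
    rw [Real.enorm_of_nonneg (inv_nonneg.2 hj.le)] at this; exact this
  rw [LpN, eq]
  refine (eLpNorm_add_le (lm.const_mul _).aestronglyMeasurable fm.aestronglyMeasurable q1).trans (add_le_add c3.le (Qf fun x => ?_))
  simpa using S.tf 0 z0 t htb ht.1 x
end
lemma Zt (v : OF m) : ‖ev (m := m) v‖ ≤ 1 := by
  refine Kj _ zero_le_one fun w => ?_
  rw [Kc]; split_ifs <;> simp
lemma Zu (f : FS m) (v : OF m) : LpN p (pdv v f) ≤ eLpNorm (fun x => ‖grd f x‖) (oR p) (μT m) := by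
  refine eLpNorm_mono_real fun x => ?_
  refine ((fderiv ℝ f x).le_opNorm _).trans ?_
  exact mul_le_of_le_one_right (norm_nonneg _) (Zt v)
lemma Zv (h1 : 1 < σ) (h2 : σ < 2) (f : FS m) : LpN p f ≤ WNorm σ p f ∧ ∀ v, LpN p (pdv v f) ≤ WNorm σ p f := by
  rw [WNorm, if_neg byl, if_neg byl, if_pos h2]
  refine ⟨le_self_add.trans le_self_add, fun v => (Zu f v).trans (le_trans ?_ le_self_add)⟩
  exact le_add_self
lemma Zw {T : ℝ≥0∞} (ht : 0 ≤ t) (h : oR t < T) : ∃ b, t < b ∧ oR b < T := by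
  obtain ⟨r, h1, h2⟩ := ENNReal.lt_iff_exists_nnreal_btwn.1 h
  refine ⟨r, ?_, by simpa using h2⟩
  have : oR t < oR r := by simpa using h1
  exact (ofReal_lt_ofReal_iff_of_nonneg ht).1 this
lemma mkSol {ψ0 : FS m} {Tmax : ℝ≥0∞} (hV : ContDiff ℝ 2 V) (hVper : IsPeriodic V) (hj : 0 < β)
    (h2 : Hyp2 m σ p) (hψ : IsMildSolution V β σ p ψ0 Tmax ψ) (hb : 0 < b) (hbT : oR b < Tmax) : Sol V β p b ψ := by
  obtain ⟨_, hp, s1, s2⟩ := h2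
  obtain ⟨t0, t1, p1⟩ := Xa hp
  obtain ⟨i0, iD, iC, iM⟩ := hψ
  have e0 : ψ 0 = ψ0 := funext i0
  have hs : ∀ s ∈ Icc 0 b, s ∈ Ico0 Tmax := fun s hs => ⟨hs.1, (oRm hs.2).trans_lt hbT⟩
  have s3 : 1 < σ := by linarith
  have lp : ∀ s ∈ Icc 0 b, ∀ v, LpN p (pdv v (ψ s)) < ⊤ := fun s h v => ((Zv s3 s2 _).2 v).trans_lt (iD s (hs s h)).1.2.2.2.2
  refine ⟨hV, hVper, hj, hp, hb, fun s h => ?_, fun s h => (iD s (hs s h)).2, lp, fun s h ε hε => ?_, fun t ht => ?_⟩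
  · obtain ⟨⟨a1, a2, a3, a4, a5⟩, _⟩ := iD s (hs s h)
    exact ⟨a1, a3 s3.le, fun v => PL.of_LpN p1.le (Ql a1 _) (Xw _ _) (lp s h v)⟩
  · obtain ⟨δ, δ0, hδ⟩ := iC s (hs s h) ε hε
    refine ⟨δ, δ0, fun s' h' hd => ?_⟩
    have := hδ s' (hs s' h') hd
    exact ⟨(Zv s3 s2 _).1.trans this.le, fun v => ((Zv s3 s2 _).2 v).trans this.le⟩
  · rw [e0]; exact iM t (hs t ht)
lemma w2 (h : MemW 2 p f) : ContDiff ℝ 1 f ∧ (∀ v, Differentiable ℝ (pdv v f)) ∧ ∀ w v, LpN p (pdv w (pdv v f)) < ⊤ := by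
  obtain ⟨a1, a2, a3, a4, a5⟩ := h
  have d1 := a3 byn
  have d2 : Differentiable ℝ (fderiv ℝ f) := a4 le_rfl
  refine ⟨contDiff_one_iff_fderiv.2 ⟨d1, d2.continuous⟩, fun v => d2.clm_apply (differentiable_const _), fun w v => ?_⟩
  rw [WNorm, if_neg byn, if_neg byn, if_neg byn] at a5
  refine lt_of_le_of_lt (le_trans ?_ le_add_self) a5
  refine eLpNorm_mono_real fun x => ?_
  have e : pdv w (pdv v f) x = fderiv ℝ (fderiv ℝ f) x (ev w) (ev v) := by
    have := ((d2 x).hasFDerivAt.clm_apply (hasFDerivAt_const (ev v) x)).fderiv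
    show fderiv ℝ (fun y => fderiv ℝ f y (ev v)) x (ev w) = _
    rw [this]; simp
  rw [e, ← norm_iteratedFDeriv_fderiv, norm_iteratedFDeriv_one]
  refine (ContinuousLinearMap.le_opNorm _ _).trans ((mul_le_of_le_one_right (norm_nonneg _) (Zt v)).trans ?_)
  exact (ContinuousLinearMap.le_opNorm _ _).trans (mul_le_of_le_one_right (norm_nonneg _) (Zt w))
lemma Sol.hold (h : Sol V β p b ψ) (ha : 0 < a) (hab : a < b) (hμ : 0 < μ) (hμ1 : μ < 1 / 4) :
    ∃ C : ℝ, 0 ≤ C ∧ ∀ s ∈ Icc a b, ∀ t ∈ Icc a b, LpN p (fun x => dd V β ψ t x - dd V β ψ s x) ≤ oR (C * |t - s| ^ μ) ∧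
      LpN p (fun x => lap (ψ t) x - lap (ψ s) x) ≤ oR (C * |t - s| ^ μ) := by
  obtain ⟨B, H, S, hg⟩ := h.seg2 (a := a / 2) (α := μ + 1 / 4) byl byl byl byl
  obtain ⟨C, hC, hd⟩ := S.dh (fun t h1 h2 => hg t h1.le h2) hμ hμ1 (a' := a) byl
  exact ⟨C, hC, fun s hs t ht => ⟨Qf fun x => (hd s hs t ht x).1, Qf fun x => (hd s hs t ht x).2⟩⟩
lemma Zx {Tmax : ℝ≥0∞} {g : ℝ → FS m}
    (h0 : Tendsto (fun t => LpN p (fun x => g t x - g 0 x)) (nhdsWithin 0 (Ioi 0)) (nhds 0))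
    (h1 : ∀ a b : ℝ, 0 < a → a < b → oR b < Tmax → ∃ C : ℝ, 0 ≤ C ∧ ∀ s ∈ Icc a b, ∀ t ∈ Icc a b, LpN p (fun x => g t x - g s x) ≤ oR (C * |t - s| ^ (1 / 8 : ℝ))) :
    ContW 0 p (Ico0 Tmax) g := by
  intro t ht ε hε
  have ε0 : 0 < oR ε := by simpa using hε
  have hW : ∀ f : FS m, WNorm 0 p f = LpN p f := fun f => if_pos le_rfl
  simp only [hW]
  rcases ht.1.eq_or_lt with e | l
  · subst e
    have := h0.eventually (gt_mem_nhds ε0)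
    obtain ⟨δ, δ0, hδ⟩ := (mem_nhdsGT_iff_exists_Ioo_subset).1 this
    refine ⟨δ, δ0, fun t' ht' hd => ?_⟩
    rcases ht'.1.eq_or_lt with e | l
    · subst e
      simp only [sub_self]
      exact (Qf (B := 0) fun x => by simp).trans_lt (by simpa using hε)
    · exact hδ ⟨l, by rwa [sub_zero, aop l] at hd⟩
  · obtain ⟨b, b1, b2⟩ := Zw ht.1 ht.2
    obtain ⟨C, C0, hC⟩ := h1 (t / 2) b byl byl b2
    have lim : Tendsto (fun r : ℝ => oR (C * |r - t| ^ (1 / 8 : ℝ))) (nhds t) (nhds 0) := by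
      have : Continuous fun r : ℝ => oR (C * |r - t| ^ (1 / 8 : ℝ)) :=
        ENNReal.continuous_ofReal.comp (ccm ((Real.continuous_rpow_const byn).comp (by fun_prop : Continuous fun r : ℝ => |r - t|)))
      have := this.tendsto t
      rwa [sub_self, abs_zero, Real.zero_rpow byn, mul_zero, ofReal_zero] at this
    obtain ⟨δ, δ0, hδ⟩ := Metric.eventually_nhds_iff.1 ((lim.eventually (gt_mem_nhds ε0)).and (Icc_mem_nhds (by linarith : t / 2 < t) b1))
    refine ⟨δ, δ0, fun t' _ hd => ?_⟩
    obtain ⟨u1, u2⟩ := hδ (y := t') (by rwa [dist_eq])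
    exact (hC t ⟨by linarith, b1.le⟩ t' u2).trans_lt u1
end

theorem mild_solution_laplacian_and_derivative_regularity
    (m : ℕ) (V : Spc m → ℝ) (β σ p : ℝ) (ψ0 : Spc m → ℝ)
    (Tmax : ℝ≥0∞) (ψ : ℝ → Spc m → ℝ)
    (hV : ContDiff ℝ 2 V) (hVper : IsPeriodic V) (hβ : 0 < β)
    (h1 : Hyp1 σ p ψ0) (h2 : Hyp2 m σ p)
    (hψ : IsMaximalMildSolution V β σ p ψ0 Tmax ψ) :
    ∃ dψ : ℝ → Spc m → ℝ,
      (∀ t ∈ Ioo0 Tmax,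
        Tendsto (fun h : ℝ => LpN p (fun x => (ψ (t + h) x - ψ t x) / h - dψ t x))
          (nhdsWithin 0 {h : ℝ | h ≠ 0}) (nhds 0)) ∧
      (∀ ε : ℝ, 0 < ε →
          ε < min (1 - σ / 2) (σ / 2 - 1 / 2 - ((m : ℝ) + 1) / (2 * p)) →
        ∀ a b : ℝ, 0 < a → a ≤ b → ENNReal.ofReal b < Tmax →
          HolderW (min (1 - σ / 2) (σ / 2 - 1 / 2 - ((m : ℝ) + 1) / (2 * p)) - ε) 0 p
              (Set.Icc a b) (fun t => lap (ψ t)) ∧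
          HolderW (min (1 - σ / 2) (σ / 2 - 1 / 2 - ((m : ℝ) + 1) / (2 * p)) - ε) 0 p
              (Set.Icc a b) dψ) ∧
      (MemW 2 p ψ0 →
        ContW 0 p (Ico0 Tmax) (fun t => lap (ψ t)) ∧ ContW 0 p (Ico0 Tmax) dψ) := by
  have sol : ∀ b, 0 < b → oR b < Tmax → Sol V β p b ψ := fun b hb hT => mkSol hV hVper hβ h2 hψ.1 hb hT
  have hW : ∀ f : FS m, WNorm 0 p f = LpN p f := fun f => if_pos le_rfl
  refine ⟨dd V β ψ, fun t ht => ?_, fun ε hε hε2 a b ha hab hb => ?_, fun hw => ?_⟩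
  · obtain ⟨b, b1, b2⟩ := Zw ht.1.le ht.2
    obtain ⟨C, hC⟩ := (sol b (ht.1.trans b1) b2).deriv ht.1 b1
    have lim : Tendsto (fun r : ℝ => oR (C * |r| ^ (1 / 8 : ℝ))) (nhdsWithin 0 {h : ℝ | h ≠ 0}) (nhds 0) := by
      have : Continuous fun r : ℝ => oR (C * |r| ^ (1 / 8 : ℝ)) :=
        ENNReal.continuous_ofReal.comp (ccm ((Real.continuous_rpow_const byn).comp continuous_abs))
      have := (this.tendsto 0).mono_left (nhdsWithin_le_nhds (s := {h : ℝ | h ≠ 0}))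
      rwa [abs_zero, Real.zero_rpow byn, mul_zero, ofReal_zero] at this
    refine tendsto_of_tendsto_of_tendsto_of_le_of_le' tendsto_const_nhds lim (evf fun _ => zero_le) ?_
    filter_upwards [hC] with k hk
    exact Qf hk
  · obtain ⟨b', b1, b2⟩ := Zw (ha.le.trans hab) hb
    have n0 : 0 < ((m : ℝ) + 1) / (2 * p) := by
      have := h2.2.1
      have : 0 < p := by linarith [(Nat.cast_nonneg m : (0:ℝ) ≤ m)]
      positivity
    obtain ⟨C, _, hC⟩ := (sol b' byl b2).hold ha byl (sp2 hε2)
      (by linarith [min_le_left (1 - σ / 2) (σ / 2 - 1 / 2 - ((m : ℝ) + 1) / (2 * p)), min_le_right (1 - σ / 2) (σ / 2 - 1 / 2 - ((m : ℝ) + 1) / (2 * p))])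
    have sub : Icc a b ⊆ Icc a b' := Icc_subset_Icc le_rfl b1.le
    exact ⟨⟨C, fun s hs t ht => by rw [hW]; exact (hC s (sub hs) t (sub ht)).2⟩, ⟨C, fun s hs t ht => by rw [hW]; exact (hC s (sub hs) t (sub ht)).1⟩⟩
  · obtain ⟨w1, w3, w4⟩ := w2 hw
    rw [← (funext hψ.1.1 : ψ 0 = ψ0)] at w1 w3 w4
    obtain ⟨b, b1, b2⟩ := Zw (T := Tmax) le_rfl (by simpa using hψ.2.1)
    obtain ⟨z1, z2⟩ := (sol b b1 b2).zero w1 w3 w4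
    refine ⟨Zx z1 fun a b ha hab hb => ?_, Zx z2 fun a b ha hab hb => ?_⟩
    all_goals obtain ⟨C, C0, hC⟩ := (sol b (ha.trans hab) hb).hold ha hab (by norm_num : (0:ℝ) < 1 / 8) byn
    · exact ⟨C, C0, fun s hs t ht => (hC s hs t ht).2⟩
    · exact ⟨C, C0, fun s hs t ht => (hC s hs t ht).1⟩
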